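/- Domains supporting a linearly growing, nondegenerate solution of an elliptic equation satisfy the Harnack chain condition: Let n ≥ 2 and fix λ, K, M, m > 0 (only λ, K, m enter the conclusion). Let Ω ⊆ ℝ^n be an open set and u a continuous function on (closure of Ω) ∩ B₁(0), twice continuously differentiable on Ω ∩ B₁(0), with u = 0 on ∂Ω ∩ B₁(0) and u > 0 on Ω ∩ B₁(0). Assume: (1) 0 ∈ ∂Ω; (2) |∇u| ≤ 1 on Ω ∩ B₁(0); (3) for every x ∈ (closure of Ω) ∩ B₁(0) and every r < 1, sup_{B_r(x)} u ≥ m·r; (4) Σ_{i,j} a_{ij}(x)·∂_i∂_j u = f on Ω ∩ B₁(0), where ‖f‖_{C^{0,1}} ≤ 1 and a_{ij} is a symmetric matrix-valued function with λ|ξ|² ≤ Σ a_{ij}(x)ξ_iξ_j ≤ λ^{−1}|ξ|² for all ξ and Lipschitz seminorm [a_{ij}]_{C^{0,1}} ≤ 1; (5) Ω satisfies the inner and outer clean ball conditions with constant K at every point of ∂Ω ∩ B₁(0). Then there exist δ > 0 and C > 0, depending only on m, λ, K and n, such that Ω satisfies the Harnack chain condition with constant C at every pair of points x₁, x₂ ∈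 B_δ(0) ∩ Ω. -/

import Mathlib

open MeasureTheory Metric Set Bornology
open scoped ENNReal NNReal Topology

noncomputable section

abbrev Euc (n : ℕ) := EuclideanSpace ℝ (Fin n)

/-- `Ω` satisfies the inner clean ball condition with constant `K` at `x ∈ ∂Ω`. -/
def InnerCleanBallAt {n : ℕ} (K : ℝ) (Ω : Set (Euc n)) (x : Euc n) : Prop :=
  ∀ r : ℝ, 0 < r → r < 1 → ∃ y : Euc n, ball y (r / K) ⊆ ball x r ∩ Ω

/-- `Ω` satisfies the outer clean ball condition with constant `K` at `x ∈ ∂Ω`. -/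
def OuterCleanBallAt {n : ℕ} (K : ℝ) (Ω : Set (Euc n)) (x : Euc n) : Prop :=
  ∀ r : ℝ, 0 < r → r < 1 → ∃ y : Euc n, ball y (r / K) ⊆ ball x r \ Ω

/-- `Ω` satisfies the Harnack chain condition with constant `K` at `x, y ∈ Ω`: there is
a rectifiable curve in `Ω` from `x` to `y` of length at most `K·|x − y|` whose distance
to `∂Ω` at each point is at least `1/K` times the smaller of the lengths of the two
subarcs it cuts. -/
def HarnackChainAt {n : ℕ} (K : ℝ) (Ω : Set (Euc n)) (x y : Euc n) : Prop :=
  ∃ γ : ℝ → Euc n, ContinuousOn γ (Icc 0 1) ∧ γ 0 = x ∧ γ 1 = y ∧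
    (∀ t ∈ Icc (0 : ℝ) 1, γ t ∈ Ω) ∧
    eVariationOn γ (Icc 0 1) ≤ ENNReal.ofReal (K * dist x y) ∧
    ∀ t ∈ Icc (0 : ℝ) 1,
      min (eVariationOn γ (Icc 0 t)).toReal (eVariationOn γ (Icc t 1)).toReal / K ≤
        infDist (γ t) (frontier Ω)

/-- The second partial derivative `∂ᵢ∂ⱼ u`. -/
def secondDeriv {n : ℕ} (u : Euc n → ℝ) (i j : Fin n) (x : Euc n) : ℝ :=
  fderiv ℝ (fun y => fderiv ℝ u y (EuclideanSpace.single i 1)) x (EuclideanSpace.single j 1)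


section

/-! ### Second order jets on lines -/

def J2 (G : ℝ → ℝ) (g1 g2 : ℝ) : Prop :=
  ∃ G' : ℝ → ℝ, (∀ᶠ t in 𝓝 (0:ℝ), HasDerivAt G (G' t) t) ∧ G' 0 = g1 ∧ HasDerivAt G' g2 0

theorem J2.congr' {G H : ℝ → ℝ} {g1 g2 : ℝ} (h : J2 G g1 g2) (e : ∀ᶠ t in 𝓝 (0:ℝ), H t = G t) :
    J2 H g1 g2 := by
  obtain ⟨G', h1, h2, h3⟩ := h
  refine ⟨G', ?_, h2, h3⟩
  have e' := e.eventually_nhds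
  filter_upwards [h1, e'] with t ht het
  exact ht.congr_of_eventuallyEq het

theorem J2.cast {G : ℝ → ℝ} {g1 g2 k1 k2 : ℝ} (h : J2 G g1 g2) (e1 : g1 = k1) (e2 : g2 = k2) :
    J2 G k1 k2 := by subst e1; subst e2; exact h

theorem J2.hasDerivAt {G : ℝ → ℝ} {g1 g2 : ℝ} (h : J2 G g1 g2) : HasDerivAt G g1 0 := by
  obtain ⟨G', h1, h2, h3⟩ := h
  have := h1.self_of_nhds
  rwa [h2] at this

theorem J2.const (c : ℝ) : J2 (fun _ => c) 0 0 :=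
  ⟨fun _ => 0, Filter.Eventually.of_forall fun t => hasDerivAt_const t c, rfl, hasDerivAt_const 0 0⟩

theorem J2.add {G H : ℝ → ℝ} {g1 g2 h1 h2 : ℝ} (hG : J2 G g1 g2) (hH : J2 H h1 h2) :
    J2 (fun t => G t + H t) (g1 + h1) (g2 + h2) := by
  obtain ⟨G', a1, a2, a3⟩ := hG
  obtain ⟨H', b1, b2, b3⟩ := hH
  refine ⟨fun t => G' t + H' t, ?_, by simp [a2, b2], a3.add b3⟩
  filter_upwards [a1, b1] with t x y using x.add y

theorem J2.mul {G H : ℝ → ℝ} {g1 g2 h1 h2 : ℝ} (hG : J2 G g1 g2) (hH : J2 H h1 h2) :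
    J2 (fun t => G t * H t) (g1 * H 0 + G 0 * h1) (g2 * H 0 + 2 * g1 * h1 + G 0 * h2) := by
  have hG0 := hG.hasDerivAt
  have hH0 := hH.hasDerivAt
  obtain ⟨G', a1, a2, a3⟩ := hG
  obtain ⟨H', b1, b2, b3⟩ := hH
  refine ⟨fun t => G' t * H t + G t * H' t, ?_, by simp [a2, b2], ?_⟩
  · filter_upwards [a1, b1] with t x y using x.mul y
  · have := (a3.mul hH0).add (hG0.mul b3)
    refine this.congr_deriv ?_
    rw [a2, b2]; ring

theorem J2.const_mul {G : ℝ → ℝ} {g1 g2 : ℝ} (c : ℝ) (hG : J2 G g1 g2) :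
    J2 (fun t => c * G t) (c * g1) (c * g2) :=
  ((J2.const c).mul hG).cast (by ring) (by ring)

theorem J2.neg {G : ℝ → ℝ} {g1 g2 : ℝ} (hG : J2 G g1 g2) :
    J2 (fun t => - G t) (- g1) (- g2) := by
  have := hG.const_mul (-1)
  simpa using this

theorem J2.sub {G H : ℝ → ℝ} {g1 g2 h1 h2 : ℝ} (hG : J2 G g1 g2) (hH : J2 H h1 h2) :
    J2 (fun t => G t - H t) (g1 - h1) (g2 - h2) := by
  simpa [sub_eq_add_neg] using hG.add hH.neg

theorem J2.affine (a b : ℝ) : J2 (fun t => a + t * b) b 0 := by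
  refine ⟨fun _ => b, Filter.Eventually.of_forall fun t => ?_, rfl, hasDerivAt_const 0 b⟩
  have := ((hasDerivAt_id t).mul_const b).const_add a
  simpa using this

theorem J2.quad (a b c : ℝ) : J2 (fun t => a + t * b + t ^ 2 * c) b (2 * c) := by
  have h := J2.affine 0 1
  have := (J2.affine a b).add ((h.mul h).const_mul c)
  refine (this.congr' (Filter.Eventually.of_forall fun t => ?_)).cast ?_ ?_ <;> simp <;> ring

theorem J2.comp {G F F' : ℝ → ℝ} {g1 g2 f2 : ℝ} (hG : J2 G g1 g2)
    (hF : ∀ᶠ s in 𝓝 (G 0), HasDerivAt F (F' s) s) (hF2 : HasDerivAt F' f2 (G 0)) :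
    J2 (fun t => F (G t)) (F' (G 0) * g1) (f2 * g1 ^ 2 + F' (G 0) * g2) := by
  have hG0 := hG.hasDerivAt
  obtain ⟨G', a1, a2, a3⟩ := hG
  refine ⟨fun t => F' (G t) * G' t, ?_, by simp [a2], ?_⟩
  · have := hG0.continuousAt.eventually hF
    filter_upwards [a1, this] with t x y using y.comp t x
  · have := (hF2.comp 0 hG0).mul a3
    refine this.congr_deriv ?_
    simp [a2]; ring

theorem J2.exp {G : ℝ → ℝ} {g1 g2 : ℝ} (hG : J2 G g1 g2) :
    J2 (fun t => Real.exp (G t)) (Real.exp (G 0) * g1) (Real.exp (G 0) * (g1 ^ 2 + g2)) :=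
  (hG.comp (Filter.Eventually.of_forall fun s => Real.hasDerivAt_exp s)
    (Real.hasDerivAt_exp _)).cast rfl (by ring)

theorem J2.log {G : ℝ → ℝ} {g1 g2 : ℝ} (hG : J2 G g1 g2) (h0 : 0 < G 0) :
    J2 (fun t => Real.log (G t)) (g1 / G 0) (g2 / G 0 - (g1 / G 0) ^ 2) := by
  refine (hG.comp (F := Real.log) (F' := fun s => s⁻¹) ?_ (hasDerivAt_inv h0.ne')).cast ?_ ?_
  · filter_upwards [lt_mem_nhds h0] with s hs using Real.hasDerivAt_log hs.ne'
  · field_simp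
  · field_simp; ring

theorem J2.inv {G : ℝ → ℝ} {g1 g2 : ℝ} (hG : J2 G g1 g2) (h0 : 0 < G 0) :
    J2 (fun t => (G t)⁻¹) (- g1 / (G 0) ^ 2) (2 * g1 ^ 2 / (G 0) ^ 3 - g2 / (G 0) ^ 2) := by
  have hd : HasDerivAt (fun s : ℝ => -(s ^ 2)⁻¹) (2 / (G 0) ^ 3) (G 0) := by
    have := ((hasDerivAt_pow 2 (G 0)).inv (pow_ne_zero 2 h0.ne')).neg
    refine this.congr_deriv ?_
    simp only [Nat.cast_ofNat]
    field_simp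
    simp
  refine (hG.comp (F := fun s => s⁻¹) (F' := fun s => -(s ^ 2)⁻¹) ?_ hd).cast ?_ ?_
  · filter_upwards [lt_mem_nhds h0] with s hs using hasDerivAt_inv hs.ne'
  · field_simp
  · field_simp; ring

theorem J2.isLocalMax {G : ℝ → ℝ} {g1 g2 : ℝ} (hG : J2 G g1 g2) (h : IsLocalMax G 0) :
    g1 = 0 ∧ g2 ≤ 0 := by
  have hG0 := hG.hasDerivAt
  have h1 : g1 = 0 := h.hasDerivAt_eq_zero hG0
  refine ⟨h1, ?_⟩
  obtain ⟨G', a1, a2, a3⟩ := hG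
  by_contra hlt
  push Not at hlt
  have hd : ∀ᶠ t in 𝓝 (0:ℝ), deriv G t = G' t := by
    filter_upwards [a1] with t ht using ht.deriv
  have hdd : HasDerivAt (deriv G) g2 0 := a3.congr_of_eventuallyEq hd
  have hmin : IsLocalMin G 0 := isLocalMin_of_deriv_deriv_pos (by rw [hdd.deriv]; exact hlt)
    (by rw [hG0.deriv, h1]) hG0.continuousAt
  have hc : ∀ᶠ t in 𝓝 (0:ℝ), G t = G 0 := by
    filter_upwards [h, hmin] with t x y using le_antisymm x y
  have hc' : ∀ᶠ t in 𝓝 (0:ℝ), deriv G t = 0 := by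
    filter_upwards [hc.eventually_nhds] with t ht
    have : G =ᶠ[𝓝 t] fun _ => G 0 := ht
    rw [this.deriv_eq]; simp
  have h0 : HasDerivAt (deriv G) 0 0 := (hasDerivAt_const (0:ℝ) (0:ℝ)).congr_of_eventuallyEq hc'
  have := hdd.unique h0
  linarith

theorem J2.isLocalMin {G : ℝ → ℝ} {g1 g2 : ℝ} (hG : J2 G g1 g2) (h : IsLocalMin G 0) :
    g1 = 0 ∧ 0 ≤ g2 := by
  have := hG.neg.isLocalMax h.neg
  constructor <;> linarith [this.1, this.2]

variable {n : ℕ}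

local notation "⟪" x ", " y "⟫" => inner ℝ x y

theorem J2.normSq (a b : Euc n) : J2 (fun t => ‖a + t • b‖ ^ 2) (2 * ⟪a, b⟫) (2 * ‖b‖ ^ 2) := by
  refine (J2.quad (‖a‖ ^ 2) (2 * ⟪a, b⟫) (‖b‖ ^ 2)).congr' (Filter.Eventually.of_forall fun t => ?_)
  rw [norm_add_sq_real, real_inner_smul_right, norm_smul, mul_pow, Real.norm_eq_abs, sq_abs]
  ring

theorem J2.ofContDiffAt {u : Euc n → ℝ} {x : Euc n} (h : ContDiffAt ℝ 2 u x) (ξ : Euc n) :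
    J2 (fun t => u (x + t • ξ)) (fderiv ℝ u x ξ) (fderiv ℝ (fderiv ℝ u) x ξ ξ) := by
  have hl : ∀ t : ℝ, HasDerivAt (fun t : ℝ => x + t • ξ) ξ t := fun t => by
    have := ((hasDerivAt_id t).smul_const ξ).const_add x
    simpa using this
  have hx : x + (0:ℝ) • ξ = x := by simp
  refine ⟨fun t => fderiv ℝ u (x + t • ξ) ξ, ?_, by simp, ?_⟩
  · have h1 : ∀ᶠ y in 𝓝 x, DifferentiableAt ℝ u y := by
      have := h.eventually (by simp)
      filter_upwards [this] with y hy using hy.differentiableAt (by norm_num)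
    have hc : Filter.Tendsto (fun t : ℝ => x + t • ξ) (𝓝 0) (𝓝 x) := by
      have := (hl 0).continuousAt.tendsto
      rwa [hx] at this
    filter_upwards [hc.eventually h1] with t ht
    exact ht.hasFDerivAt.comp_hasDerivAt t (hl t)
  · have h2 : DifferentiableAt ℝ (fderiv ℝ u) x :=
      (h.fderiv_right (m := 1) (by norm_num)).differentiableAt (by norm_num)
    have h3 : HasFDerivAt (fderiv ℝ u) (fderiv ℝ (fderiv ℝ u) x) (x + (0:ℝ) • ξ) := by
      rw [hx]; exact h2.hasFDerivAt
    have h4 := h3.comp_hasDerivAt (0:ℝ) (hl 0)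
    have h5 := h4.clm_apply (hasDerivAt_const (0:ℝ) ξ)
    simpa using h5

end

section

/-! ### The barrier -/

variable {n : ℕ}

local notation "⟪" x ", " y "⟫" => inner ℝ x y

def bTau (c : Euc n) (t0 : ℝ) (x : Euc n) : ℝ := t0 + ⟪c, x⟫

def bG (q c : Euc n) (t0 : ℝ) (x : Euc n) : ℝ := ‖x - q‖ ^ 2 / bTau c t0 x

def bGrad (q c : Euc n) (t0 : ℝ) (x : Euc n) : Euc n :=
  (bTau c t0 x)⁻¹ • ((2:ℝ) • (x - q) - bG q c t0 x • c)

def bHess (q c : Euc n) (t0 : ℝ) (x ξ : Euc n) : ℝ :=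
  (2 * ‖ξ‖ ^ 2 - 2 * ⟪bGrad q c t0 x, ξ⟫ * ⟪c, ξ⟫) / bTau c t0 x

theorem bTau_jet (c : Euc n) (t0 : ℝ) (x ξ : Euc n) :
    J2 (fun t => bTau c t0 (x + t • ξ)) ⟪c, ξ⟫ 0 := by
  refine (J2.affine (bTau c t0 x) ⟪c, ξ⟫).congr' (Filter.Eventually.of_forall fun t => ?_)
  simp [bTau, inner_add_right, real_inner_smul_right]; ring

theorem bG_jet (q c : Euc n) (t0 : ℝ) (x ξ : Euc n) (h : 0 < bTau c t0 x) :
    J2 (fun t => bG q c t0 (x + t • ξ)) ⟪bGrad q c t0 x, ξ⟫ (bHess q c t0 x ξ) := by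
  have h1 : J2 (fun t => ‖(x + t • ξ) - q‖ ^ 2) (2 * ⟪x - q, ξ⟫) (2 * ‖ξ‖ ^ 2) := by
    refine (J2.normSq (x - q) ξ).congr' (Filter.Eventually.of_forall fun t => ?_)
    congr 2; abel
  have h2 := (bTau_jet c t0 x ξ).inv (by simpa using h)
  refine ((h1.mul h2).congr' (Filter.Eventually.of_forall fun t => ?_)).cast ?_ ?_
  · simp [bG, div_eq_mul_inv]
  · simp only [bGrad, bG, real_inner_smul_left, inner_sub_left, zero_smul, add_zero]
    field_simp
    ring
  · simp only [bHess, bGrad, bG, real_inner_smul_left, inner_sub_left, zero_smul, add_zero]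
    field_simp
    ring

def bE (q c : Euc n) (t0 α : ℝ) (x : Euc n) : ℝ := Real.exp (-α * bG q c t0 x)

theorem bE_jet (q c : Euc n) (t0 α : ℝ) (x ξ : Euc n) (h : 0 < bTau c t0 x) :
    J2 (fun t => bE q c t0 α (x + t • ξ)) (bE q c t0 α x * (-α * ⟪bGrad q c t0 x, ξ⟫))
      (bE q c t0 α x * (α ^ 2 * ⟪bGrad q c t0 x, ξ⟫ ^ 2 - α * bHess q c t0 x ξ)) := by
  have := ((bG_jet q c t0 x ξ h).const_mul (-α)).exp
  refine this.cast ?_ ?_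
  · simp [bE]
  · simp only [bE, zero_smul, add_zero]; ring

theorem bGrad_lower (q c : Euc n) (t0 : ℝ) (x : Euc n) (h : 0 < bTau c t0 x)
    (hq : 0 ≤ bTau c t0 q) : ‖x - q‖ / bTau c t0 x ≤ ‖bGrad q c t0 x‖ := by
  by_cases hx : x = q
  · simp [hx]
  have hpos : 0 < ‖x - q‖ := norm_pos_iff.2 (sub_ne_zero.2 hx)
  have h1 : ⟪bGrad q c t0 x, x - q⟫ = (‖x - q‖ ^ 2 + bG q c t0 x * bTau c t0 q) / bTau c t0 x := by
    have e : ⟪c, x⟫ = bTau c t0 x - t0 := by simp [bTau]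
    have e' : ⟪c, q⟫ = bTau c t0 q - t0 := by simp [bTau]
    have e2 : bG q c t0 x * bTau c t0 x = ‖x - q‖ ^ 2 := by
      rw [bG, div_mul_cancel₀ _ h.ne']
    rw [bGrad, real_inner_smul_left, inner_sub_left, real_inner_smul_left, real_inner_smul_left,
      real_inner_self_eq_norm_sq, inner_sub_right c, e, e', div_eq_inv_mul]
    congr 1
    linear_combination - e2
  have h2 : ‖x - q‖ ^ 2 / bTau c t0 x ≤ ⟪bGrad q c t0 x, x - q⟫ := by
    rw [h1]
    have : 0 ≤ bG q c t0 x := by unfold bG; positivity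
    gcongr
    nlinarith [mul_nonneg this hq]
  have h3 := real_inner_le_norm (bGrad q c t0 x) (x - q)
  have h4 : ‖x - q‖ / bTau c t0 x * ‖x - q‖ ≤ ‖bGrad q c t0 x‖ * ‖x - q‖ := by
    calc _ = ‖x - q‖ ^ 2 / bTau c t0 x := by ring
      _ ≤ _ := h2.trans h3
  exact le_of_mul_le_mul_right h4 hpos

theorem bGrad_upper (q c : Euc n) (t0 : ℝ) (x : Euc n) {τ0 R G C1 : ℝ} (h0 : 0 < τ0)
    (h : τ0 ≤ bTau c t0 x) (hR : ‖x - q‖ ≤ R) (hG : bG q c t0 x ≤ G) (hc : ‖c‖ ≤ C1) :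
    ‖bGrad q c t0 x‖ ≤ (2 * R + G * C1) / τ0 := by
  have hp : 0 < bTau c t0 x := h0.trans_le h
  have hg : 0 ≤ bG q c t0 x := by unfold bG; positivity
  have h1 : ‖(2:ℝ) • (x - q) - bG q c t0 x • c‖ ≤ 2 * R + G * C1 := by
    refine (norm_sub_le _ _).trans ?_
    rw [norm_smul, norm_smul, Real.norm_eq_abs, Real.norm_eq_abs, abs_of_nonneg hg]
    norm_num
    gcongr
    linarith
  rw [bGrad, norm_smul, norm_inv, Real.norm_eq_abs, abs_of_pos hp, ← div_eq_inv_mul]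
  have : 0 ≤ 2 * R + G * C1 := (norm_nonneg _).trans h1
  gcongr

theorem bHess_bound (q c : Euc n) (t0 : ℝ) (x ξ : Euc n) {τ0 B C1 : ℝ} (h0 : 0 < τ0)
    (h : τ0 ≤ bTau c t0 x) (hB : ‖bGrad q c t0 x‖ ≤ B) (hc : ‖c‖ ≤ C1) :
    |bHess q c t0 x ξ| ≤ (2 + 2 * B * C1) / τ0 * ‖ξ‖ ^ 2 := by
  have hp : 0 < bTau c t0 x := h0.trans_le h
  have hB0 : 0 ≤ B := (norm_nonneg _).trans hB
  have hC0 : 0 ≤ C1 := (norm_nonneg _).trans hc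
  have h1 : |⟪bGrad q c t0 x, ξ⟫| ≤ B * ‖ξ‖ := (abs_real_inner_le_norm _ _).trans (by gcongr)
  have h2 : |⟪c, ξ⟫| ≤ C1 * ‖ξ‖ := (abs_real_inner_le_norm _ _).trans (by gcongr)
  have h3 : |⟪bGrad q c t0 x, ξ⟫ * ⟪c, ξ⟫| ≤ (B * ‖ξ‖) * (C1 * ‖ξ‖) := by
    rw [abs_mul]; gcongr
  have h4 : |2 * ‖ξ‖ ^ 2 - 2 * ⟪bGrad q c t0 x, ξ⟫ * ⟪c, ξ⟫| ≤ (2 + 2 * B * C1) * ‖ξ‖ ^ 2 := by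
    rw [abs_le] at h3 ⊢
    constructor <;> nlinarith [h3.1, h3.2, sq_nonneg ‖ξ‖]
  rw [bHess, abs_div, abs_of_pos hp]
  calc _ ≤ ((2 + 2 * B * C1) * ‖ξ‖ ^ 2) / τ0 := by gcongr
    _ = _ := by ring

end

section

/-! ### Quantitative minimum principle -/

variable {n : ℕ}

local notation "⟪" x ", " y "⟫" => inner ℝ x y

theorem exists_alpha (a b d : ℝ) (ha : 0 < a) : ∃ α : ℝ, 1 ≤ α ∧ b * α + d ≤ a * α ^ 2 := by
  refine ⟨1 + (|b| + |d|) / a, ?_, ?_⟩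
  · have : 0 ≤ (|b| + |d|) / a := by positivity
    linarith
  · set α := 1 + (|b| + |d|) / a with hα
    have h1 : 1 ≤ α := by
      have : 0 ≤ (|b| + |d|) / a := by positivity
      linarith
    have h2 : a * α = a + (|b| + |d|) := by rw [hα]; field_simp
    have h3 : a * α ^ 2 = (a + (|b| + |d|)) * α := by rw [← h2]; ring
    rw [h3]
    nlinarith [le_abs_self b, le_abs_self d, abs_nonneg d, abs_nonneg b]

set_option maxHeartbeats 4000000 in
theorem weak_harnack (n : ℕ) (lam Lam ε ρ : ℝ) (hlam : 0 < lam) (hε : 0 < ε) (hρ : 0 < ρ) :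
    ∃ c : ℝ, 0 < c ∧ ∃ κ : ℝ, 0 < κ ∧ ∀ (v : Euc n → ℝ) (q : Euc n) (μ : ℝ), 0 < μ →
      ‖q‖ ≤ 1 - ε → ContinuousOn v (closedBall 0 1) → (∀ x ∈ closedBall (0 : Euc n) 1, 0 ≤ v x) →
      (∀ x ∈ ball q ρ, x ∈ closedBall (0 : Euc n) 1 → μ ≤ v x) →
      (∀ x ∈ ball (0 : Euc n) 1, ∃ p X : Euc n → ℝ,
        (∀ ξ, J2 (fun t => v (x + t • ξ)) (p ξ) (X ξ)) ∧
        ∃ ξ : Fin n → Euc n, (∀ ζ : Euc n, lam * ‖ζ‖ ^ 2 ≤ ∑ k, ⟪ζ, ξ k⟫ ^ 2) ∧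
          ∑ k, ‖ξ k‖ ^ 2 ≤ Lam ∧ ∑ k, X (ξ k) ≤ κ * μ) →
      c * μ ≤ v 0 := by
  set B : ℝ := (2 * 2 + 1 * 2) / ε ^ 2 with hB
  set B2 : ℝ := (2 + 2 * B * 2) / ε ^ 2 with hB2
  have hB0 : 0 < B := by positivity
  have hB20 : 0 < B2 := by positivity
  obtain ⟨α, hα1, hα⟩ := exists_alpha (lam * (ρ / 4) ^ 2) (B2 * Lam) 1 (by positivity)
  have hα0 : 0 < α := by linarith
  refine ⟨Real.exp (-α * (1 / 2)) - Real.exp (-α), ?_, Real.exp (-α) / 2, by positivity, ?_⟩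
  · rw [sub_pos, Real.exp_lt_exp]; nlinarith
  intro v q μ hμ hq hv hv0 hvq hjet
  have hq1 : ‖q‖ ≤ 1 := by linarith
  set c : Euc n := (-2 : ℝ) • q with hc
  set t0 : ℝ := 1 + ‖q‖ ^ 2 with ht0
  have hcn : ‖c‖ ≤ 2 := by rw [hc, norm_smul]; norm_num; linarith
  have hτ : ∀ x, bTau c t0 x = ‖x - q‖ ^ 2 + (1 - ‖x‖ ^ 2) := by
    intro x
    rw [bTau, hc, ht0, norm_sub_sq_real, real_inner_smul_left, real_inner_comm]; ring
  have hτ0 : ∀ x, ‖x‖ ≤ 1 → ε ^ 2 ≤ bTau c t0 x := by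
    intro x hx
    have h1 : ⟪q, x⟫ ≤ ‖q‖ * 1 := (real_inner_le_norm q x).trans (by gcongr)
    have h2 : bTau c t0 x = 1 + ‖q‖ ^ 2 - 2 * ⟪q, x⟫ := by
      rw [bTau, hc, ht0, real_inner_smul_left]; ring
    rw [h2]
    nlinarith
  have hd : ∀ x, ‖x‖ ≤ 1 → ‖x - q‖ ≤ 2 := fun x hx => (norm_sub_le _ _).trans (by linarith)
  have hτ1 : ∀ x, ‖x‖ ≤ 1 → bTau c t0 x ≤ 4 := by
    intro x hx
    have h2 : bTau c t0 x = 1 + ‖q‖ ^ 2 - 2 * ⟪q, x⟫ := by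
      rw [bTau, hc, ht0, real_inner_smul_left]; ring
    have h1 : |⟪q, x⟫| ≤ ‖q‖ * 1 := (abs_real_inner_le_norm q x).trans (by gcongr)
    rw [abs_le] at h1
    rw [h2]; nlinarith [norm_nonneg q]
  have hτp : ∀ x, ‖x‖ ≤ 1 → 0 < bTau c t0 x := fun x hx => lt_of_lt_of_le (by positivity) (hτ0 x hx)
  have hG1 : ∀ x, ‖x‖ ≤ 1 → bG q c t0 x ≤ 1 := by
    intro x hx
    rw [bG, div_le_one (hτp x hx), hτ]
    nlinarith [norm_nonneg x]
  have hG0 : ∀ x, ‖x‖ ≤ 1 → 0 ≤ bG q c t0 x := by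
    intro x hx
    have := hτp x hx
    unfold bG; positivity
  set b : Euc n → ℝ := fun x => μ * (bE q c t0 α x - Real.exp (-α)) with hb
  have hbμ : ∀ x, ‖x‖ ≤ 1 → b x < μ := by
    intro x hx
    have h1 : bE q c t0 α x ≤ 1 := by
      rw [bE, Real.exp_le_one_iff]; nlinarith [hG0 x hx]
    have := Real.exp_pos (-α)
    simp only [hb]; nlinarith
  have hbS : ∀ x, ‖x‖ = 1 → b x = 0 := by
    intro x hx
    have : bG q c t0 x = 1 := by
      have h1 := hτp x hx.le
      rw [bG, div_eq_one_iff_eq h1.ne', hτ, hx]; ring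
    simp [hb, bE, this]
  have hb0 : (Real.exp (-α * (1 / 2)) - Real.exp (-α)) * μ ≤ b 0 := by
    have h1 : bG q c t0 0 ≤ 1 / 2 := by
      have : bTau c t0 0 = 1 + ‖q‖ ^ 2 := by simp [bTau, ht0]
      rw [bG, this, div_le_iff₀ (by positivity)]
      simp
      nlinarith [norm_nonneg q]
    have h2 : Real.exp (-α * (1 / 2)) ≤ bE q c t0 α 0 := by
      rw [bE, Real.exp_le_exp]; nlinarith
    simp only [hb]; nlinarith
  by_contra hcon
  push Not at hcon
  have hcont : ContinuousOn (fun x => v x - b x) (closedBall 0 1) := by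
    refine hv.sub ?_
    have h1 : ContinuousOn (bTau c t0) (closedBall (0 : Euc n) 1) := by
      unfold bTau; fun_prop
    have h2 : ContinuousOn (bG q c t0) (closedBall (0 : Euc n) 1) := by
      unfold bG
      refine ContinuousOn.div (by fun_prop) h1 ?_
      intro x hx
      exact (hτp x (by simpa using hx)).ne'
    have h3 : ContinuousOn (bE q c t0 α) (closedBall (0 : Euc n) 1) := by
      unfold bE; exact (continuousOn_const.mul h2).rexp
    exact continuousOn_const.mul (h3.sub continuousOn_const)
  obtain ⟨x, hxm, hx⟩ := (isCompact_closedBall (0 : Euc n) 1).exists_isMinOn ⟨0, by simp⟩ hcont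
  have hxneg : v x - b x < 0 := by
    have := hx (show (0 : Euc n) ∈ closedBall 0 1 by simp)
    simp only [mem_ofPred_eq] at this
    linarith
  have hx1 : ‖x‖ ≤ 1 := by simpa using hxm
  have hxlt : ‖x‖ < 1 := by
    rcases hx1.lt_or_eq with h | h
    · exact h
    · have := hbS x h
      have := hv0 x hxm
      linarith
  have hxb : x ∈ ball (0 : Euc n) 1 := by simpa using hxlt
  have hxq : ρ ≤ ‖x - q‖ := by
    by_contra h
    push Not at h
    have := hvq x (by simpa [dist_eq_norm] using h) hxm
    have := hbμ x hx1
    linarith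
  obtain ⟨p, X, hJ, ξ, hξ1, hξ2, hξ3⟩ := hjet x hxb
  have hloc : IsLocalMin (fun x => v x - b x) x :=
    hx.isLocalMin (closedBall_mem_nhds_of_mem hxb)
  set E := bE q c t0 α x with hE
  have hE0 : 0 < E := Real.exp_pos _
  have hE1 : Real.exp (-α) ≤ E := by
    rw [hE, bE, Real.exp_le_exp]; nlinarith [hG1 x hx1]
  set Γ := bGrad q c t0 x with hΓ
  have hXk : ∀ k, μ * (E * (α ^ 2 * ⟪Γ, ξ k⟫ ^ 2 - α * bHess q c t0 x (ξ k))) ≤ X (ξ k) := by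
    intro k
    have h1 := ((bE_jet q c t0 α x (ξ k) (hτp x hx1)).sub (J2.const (Real.exp (-α)))).const_mul μ
    have h2 := (hJ (ξ k)).sub h1
    have h3 : IsLocalMin (fun t : ℝ => v (x + t • ξ k) - b (x + t • ξ k)) 0 := by
      have hct : ContinuousAt (fun t : ℝ => x + t • ξ k) 0 := by fun_prop
      have : Filter.Tendsto (fun t : ℝ => x + t • ξ k) (𝓝 0) (𝓝 x) := by
        simpa using hct.tendsto
      have := this.eventually hloc
      simpa [IsLocalMin, IsMinFilter] using this
    have := (h2.isLocalMin h3).2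
    linarith
  have hsum := Finset.sum_le_sum fun k (_ : k ∈ Finset.univ) => hXk k
  have hgl : ρ / 4 ≤ ‖Γ‖ := by
    refine le_trans ?_ (bGrad_lower q c t0 x (hτp x hx1) (hτp q hq1).le)
    have h1 := hτ1 x hx1
    have h2 := hτp x hx1
    gcongr
  have hgu : ‖Γ‖ ≤ B := bGrad_upper q c t0 x (by positivity) (hτ0 x hx1) (hd x hx1) (hG1 x hx1) hcn
  have hH : ∀ k, bHess q c t0 x (ξ k) ≤ B2 * ‖ξ k‖ ^ 2 := fun k =>
    (le_abs_self _).trans (bHess_bound q c t0 x (ξ k) (by positivity) (hτ0 x hx1) hgu hcn)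
  have hHs : ∑ k, bHess q c t0 x (ξ k) ≤ B2 * Lam := by
    calc _ ≤ ∑ k, B2 * ‖ξ k‖ ^ 2 := Finset.sum_le_sum fun k _ => hH k
      _ = B2 * ∑ k, ‖ξ k‖ ^ 2 := by rw [Finset.mul_sum]
      _ ≤ _ := by gcongr
  have hGs : lam * (ρ / 4) ^ 2 ≤ ∑ k, ⟪Γ, ξ k⟫ ^ 2 := by
    refine le_trans ?_ (hξ1 Γ)
    gcongr
  have hs2 : ∑ k, μ * (E * (α ^ 2 * ⟪Γ, ξ k⟫ ^ 2 - α * bHess q c t0 x (ξ k))) =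
      μ * (E * (α ^ 2 * ∑ k, ⟪Γ, ξ k⟫ ^ 2 - α * ∑ k, bHess q c t0 x (ξ k))) := by
    simp only [Finset.mul_sum, ← Finset.sum_sub_distrib]
  rw [hs2] at hsum
  have h1 : 1 ≤ α ^ 2 * ∑ k, ⟪Γ, ξ k⟫ ^ 2 - α * ∑ k, bHess q c t0 x (ξ k) := by
    have := mul_le_mul_of_nonneg_left hGs (sq_nonneg α)
    have := mul_le_mul_of_nonneg_left hHs hα0.le
    linarith
  have h2 : Real.exp (-α) ≤ E * (α ^ 2 * ∑ k, ⟪Γ, ξ k⟫ ^ 2 - α * ∑ k, bHess q c t0 x (ξ k)) := by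
    nlinarith
  have h3 : μ * Real.exp (-α) ≤ Real.exp (-α) / 2 * μ :=
    (mul_le_mul_of_nonneg_left h2 hμ.le).trans (hsum.trans hξ3)
  have := mul_pos hμ (Real.exp_pos (-α))
  linarith

end

section

/-! ### Two-point maximum principle -/

variable {n : ℕ}

local notation "⟪" x ", " y "⟫" => inner ℝ x y

theorem exists_refl (e : Euc n) (he : ‖e‖ = 1) :
    ∃ σ : Euc n ≃ₗᵢ[ℝ] Euc n, ∀ x, σ x = x - (2 * ⟪x, e⟫) • e := by
  refine ⟨(ℝ ∙ e)ᗮ.reflection, fun x => ?_⟩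
  rw [Submodule.reflection_orthogonal_apply, Submodule.reflection_singleton_apply]
  rw [he, real_inner_comm]
  simp [mul_smul, two_smul]

/-- The auxiliary function. -/
def tpPhi (σ : Euc n ≃ₗᵢ[ℝ] Euc n) (q e : Euc n) (α G η : ℝ) (x y : Euc n) : ℝ :=
  η * (bE q e 0 α x - Real.exp (-α * G)) - ‖y - σ x‖ ^ 2

def tpF (U1 U2 : Euc n → ℝ) (σ : Euc n ≃ₗᵢ[ℝ] Euc n) (q e : Euc n) (α G η : ℝ)
    (z : Euc n × Euc n) : ℝ :=
  U1 z.1 * U2 z.2 * Real.exp (tpPhi σ q e α G η z.1 z.2) / ‖z.1 - z.2‖ ^ 2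

theorem tp_jet {U1 U2 : Euc n → ℝ} {σ : Euc n ≃ₗᵢ[ℝ] Euc n} {q e : Euc n} {α G η : ℝ}
    {x y ξ ζ : Euc n} {p X r Y : ℝ} (hU1 : 0 < U1 x) (hU2 : 0 < U2 y)
    (hJ1 : J2 (fun t => U1 (x + t • ξ)) p X) (hJ2 : J2 (fun t => U2 (y + t • ζ)) r Y)
    (hτ : 0 < bTau e 0 x) (hxy : x ≠ y) :
    J2 (fun t => Real.log (U1 (x + t • ξ)) + Real.log (U2 (y + t • ζ)) +
      tpPhi σ q e α G η (x + t • ξ) (y + t • ζ) -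
        Real.log (‖(x + t • ξ) - (y + t • ζ)‖ ^ 2))
      (p / U1 x + r / U2 y + (η * (bE q e 0 α x * (-α * ⟪bGrad q e 0 x, ξ⟫)) -
        2 * ⟪y - σ x, ζ - σ ξ⟫) - 2 * ⟪x - y, ξ - ζ⟫ / ‖x - y‖ ^ 2)
      ((X / U1 x - (p / U1 x) ^ 2) + (Y / U2 y - (r / U2 y) ^ 2) +
        (η * (bE q e 0 α x * (α ^ 2 * ⟪bGrad q e 0 x, ξ⟫ ^ 2 - α * bHess q e 0 x ξ)) -
        2 * ‖ζ - σ ξ‖ ^ 2) - (2 * ‖ξ - ζ‖ ^ 2 / ‖x - y‖ ^ 2 -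
          (2 * ⟪x - y, ξ - ζ⟫ / ‖x - y‖ ^ 2) ^ 2)) := by
  have h1 := hJ1.log (by simpa using hU1)
  have h2 := hJ2.log (by simpa using hU2)
  have h3 := ((bE_jet q e 0 α x ξ hτ).sub (J2.const (Real.exp (-α * G)))).const_mul η
  have h4 : J2 (fun t => ‖(y + t • ζ) - σ (x + t • ξ)‖ ^ 2) _ _ :=
    (J2.normSq (y - σ x) (ζ - σ ξ)).congr' (Filter.Eventually.of_forall fun t => by
      simp only [map_add, map_smul]; congr 2; module)
  have h5 : J2 (fun t => ‖(x + t • ξ) - (y + t • ζ)‖ ^ 2) _ _ :=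
    (J2.normSq (x - y) (ξ - ζ)).congr' (Filter.Eventually.of_forall fun t => by
      congr 2; module)
  have h6 := h5.log (by
    have : 0 < ‖x - y‖ := norm_pos_iff.2 (sub_ne_zero.2 hxy)
    simp; positivity)
  have h7 := ((h1.add h2).add (h3.sub h4)).sub h6
  refine h7.cast ?_ ?_
  · simp
  · simp

theorem tp_max {U1 U2 : Euc n → ℝ} {σ : Euc n ≃ₗᵢ[ℝ] Euc n} {q e : Euc n} {α G η : ℝ}
    {x y ξ ζ : Euc n} {p X r Y : ℝ} (hU1 : 0 < U1 x) (hU2 : 0 < U2 y)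
    (hc1 : ContinuousAt U1 x) (hc2 : ContinuousAt U2 y)
    (hJ1 : J2 (fun t => U1 (x + t • ξ)) p X) (hJ2 : J2 (fun t => U2 (y + t • ζ)) r Y)
    (hτ : 0 < bTau e 0 x) (hxy : x ≠ y) (hmax : IsLocalMax (tpF U1 U2 σ q e α G η) (x, y)) :
    p / U1 x + r / U2 y + (η * (bE q e 0 α x * (-α * ⟪bGrad q e 0 x, ξ⟫)) -
        2 * ⟪y - σ x, ζ - σ ξ⟫) - 2 * ⟪x - y, ξ - ζ⟫ / ‖x - y‖ ^ 2 = 0 ∧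
      (X / U1 x - (p / U1 x) ^ 2) + (Y / U2 y - (r / U2 y) ^ 2) +
        (η * (bE q e 0 α x * (α ^ 2 * ⟪bGrad q e 0 x, ξ⟫ ^ 2 - α * bHess q e 0 x ξ)) -
        2 * ‖ζ - σ ξ‖ ^ 2) - (2 * ‖ξ - ζ‖ ^ 2 / ‖x - y‖ ^ 2 -
          (2 * ⟪x - y, ξ - ζ⟫ / ‖x - y‖ ^ 2) ^ 2) ≤ 0 := by
  refine (tp_jet (G := G) hU1 hU2 hJ1 hJ2 hτ hxy).isLocalMax ?_
  have hx : Filter.Tendsto (fun t : ℝ => x + t • ξ) (𝓝 0) (𝓝 x) := by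
    have : ContinuousAt (fun t : ℝ => x + t • ξ) 0 := by fun_prop
    simpa using this.tendsto
  have hy : Filter.Tendsto (fun t : ℝ => y + t • ζ) (𝓝 0) (𝓝 y) := by
    have : ContinuousAt (fun t : ℝ => y + t • ζ) 0 := by fun_prop
    simpa using this.tendsto
  have hxy' := hx.prodMk_nhds hy
  have e1 := hxy'.eventually hmax
  have e2 := hx.eventually (hc1.eventually (lt_mem_nhds hU1))
  have e3 := hy.eventually (hc2.eventually (lt_mem_nhds hU2))
  have e4 : ∀ᶠ t in 𝓝 (0:ℝ), 0 < ‖(x + t • ξ) - (y + t • ζ)‖ :=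
    ((hx.sub hy).norm).eventually (lt_mem_nhds (norm_pos_iff.2 (sub_ne_zero.2 hxy)))
  have key : ∀ a b : Euc n, 0 < U1 a → 0 < U2 b → 0 < ‖a - b‖ →
      Real.log (U1 a) + Real.log (U2 b) + tpPhi σ q e α G η a b - Real.log (‖a - b‖ ^ 2)
        = Real.log (tpF U1 U2 σ q e α G η (a, b)) := by
    intro a b ha hb hab
    have := Real.exp_pos (tpPhi σ q e α G η a b)
    rw [tpF, Real.log_div (by positivity) (by positivity), Real.log_mul (by positivity) (by positivity),
      Real.log_mul (by positivity) (by positivity), Real.log_exp]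
  filter_upwards [e1, e2, e3, e4] with t h1 h2 h3 h4
  rw [key _ _ h2 h3 h4]
  simp only [zero_smul, add_zero]
  rw [key _ _ hU1 hU2 (norm_pos_iff.2 (sub_ne_zero.2 hxy))]
  refine Real.log_le_log ?_ h1
  unfold tpF
  have := Real.exp_pos (tpPhi σ q e α G η (x + t • ξ) (y + t • ζ))
  simp only
  positivity

end

section

variable {n : ℕ}

local notation "⟪" x ", " y "⟫" => inner ℝ x y

set_option maxHeartbeats 4000000 in
theorem tp_alg (e d v Γ sd : Euc n) (τ η E α Hs : ℝ) (he : ‖e‖ = 1)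
    (hv : v = (2 * τ) • e - d) (hsd : sd = d - (2 * ⟪d, e⟫) • e) (hE0 : 0 < E) (hE1 : E ≤ 1)
    (hη : 0 < η) (hη4 : η ≤ 1 / 4) (hα : 0 ≤ α) (hd : ‖d‖ ^ 2 ≤ η * E) (hv0 : 0 < ‖v‖) :
    ‖(2 / ‖v‖ ^ 2) • v + (η * E * α) • Γ - (2:ℝ) • sd‖ ^ 2 +
      ‖(2:ℝ) • d - (2 / ‖v‖ ^ 2) • v‖ ^ 2 + 8 / ‖v‖ ^ 2 - 16 * ⟪v, e⟫ ^ 2 / ‖v‖ ^ 4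
      - η * E * (α ^ 2 * ‖Γ‖ ^ 2 - α * Hs) ≤
    η * E * (16 / ‖v‖ ^ 4 + 16 / ‖v‖ ^ 2 + 12 + 4 * α * ‖Γ‖ / ‖v‖ + α * Hs - α ^ 2 * ‖Γ‖ ^ 2 / 2) := by
  set L := ‖v‖ ^ 2 with hL
  have hL0 : 0 < L := by positivity
  have hee : ⟪e, e⟫ = 1 := by rw [real_inner_self_eq_norm_sq, he]; norm_num
  have hdd : ⟪d, d⟫ = ‖d‖ ^ 2 := real_inner_self_eq_norm_sq d
  have hvv : ⟪v, v⟫ = L := real_inner_self_eq_norm_sq v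
  have hed : ⟪e, d⟫ = ⟪d, e⟫ := real_inner_comm _ _
  have hve : ⟪v, e⟫ = 2 * τ - ⟪d, e⟫ := by
    rw [hv, inner_sub_left, real_inner_smul_left, hee]; ring
  have hvd : ⟪v, d⟫ = 2 * τ * ⟪d, e⟫ - ‖d‖ ^ 2 := by
    rw [hv, inner_sub_left, real_inner_smul_left, hdd, hed]
  have hLe : L = 4 * τ ^ 2 - 4 * τ * ⟪d, e⟫ + ‖d‖ ^ 2 := by
    rw [← hvv]
    nth_rw 2 [hv]
    rw [inner_sub_right, real_inner_smul_right, hve, hvd]; ring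
  have hvsd : ⟪v, sd⟫ = ⟪v, d⟫ - 2 * ⟪d, e⟫ * ⟪v, e⟫ := by
    rw [hsd, inner_sub_right, real_inner_smul_right]
  have hnsd : ‖sd‖ ^ 2 = ‖d‖ ^ 2 := by
    rw [← real_inner_self_eq_norm_sq, hsd, inner_sub_left, inner_sub_right, inner_sub_right,
      real_inner_smul_left, real_inner_smul_left, real_inner_smul_right, real_inner_smul_right,
      hee, hdd, hed]; ring
  have hs2 : ⟪d, e⟫ ^ 2 ≤ ‖d‖ ^ 2 := by
    have := abs_real_inner_le_norm d e
    rw [he, mul_one] at this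
    exact sq_le_sq' (by linarith [abs_le.1 this]) (by linarith [abs_le.1 this])
  set s := ⟪d, e⟫ with hs
  set w := ‖d‖ ^ 2 with hw
  set β := η * E * α with hβ
  have hβ0 : 0 ≤ β := by positivity
  have h1 : ‖(2:ℝ) • d - (2 / L) • v‖ ^ 2 = 4 * w - 8 / L * ⟪v, d⟫ + 4 / L := by
    rw [norm_sub_sq_real, norm_smul, norm_smul, mul_pow, mul_pow, ← hL, ← hw, real_inner_smul_left,
      real_inner_smul_right, real_inner_comm]
    simp only [Real.norm_eq_abs, sq_abs]
    field_simp; ring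
  have h2 : ‖(2 / L) • v + β • Γ - (2:ℝ) • sd‖ ^ 2 =
      4 / L + 4 / L * β * ⟪v, Γ⟫ - 8 / L * ⟪v, sd⟫ + ‖β • Γ - (2:ℝ) • sd‖ ^ 2 := by
    rw [add_sub_assoc, norm_add_sq_real, norm_smul, mul_pow, ← hL, real_inner_smul_left,
      inner_sub_right, real_inner_smul_right, real_inner_smul_right]
    simp only [Real.norm_eq_abs, sq_abs]
    field_simp
    ring
  have h3 : ‖β • Γ - (2:ℝ) • sd‖ ^ 2 ≤ 2 * β ^ 2 * ‖Γ‖ ^ 2 + 8 * w := by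
    have h := norm_sub_le (β • Γ) ((2:ℝ) • sd)
    have e1 : ‖β • Γ‖ = β * ‖Γ‖ := by rw [norm_smul, Real.norm_of_nonneg hβ0]
    have e2 : ‖(2:ℝ) • sd‖ = 2 * ‖sd‖ := by rw [norm_smul]; norm_num
    rw [e1, e2] at h
    have := pow_le_pow_left₀ (norm_nonneg _) h 2
    nlinarith [sq_nonneg (β * ‖Γ‖ - 2 * ‖sd‖)]
  have h4 : 4 / L * β * ⟪v, Γ⟫ ≤ η * E * (4 * α * ‖Γ‖ / ‖v‖) := by
    have := real_inner_le_norm v Γ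
    calc 4 / L * β * ⟪v, Γ⟫ ≤ 4 / L * β * (‖v‖ * ‖Γ‖) := by gcongr
      _ = _ := by rw [hL, hβ]; field_simp
  have h5 : 2 * β ^ 2 * ‖Γ‖ ^ 2 ≤ η * E * (α ^ 2 * ‖Γ‖ ^ 2 / 2) := by
    have : η * E ≤ 1 / 4 := by nlinarith
    have h : 0 ≤ η * E * (α ^ 2 * ‖Γ‖ ^ 2) := by positivity
    rw [hβ]; nlinarith
  have hv4 : ‖v‖ ^ 4 = L ^ 2 := by rw [hL]; ring
  have h6 : 16 / L - 16 * ⟪v, e⟫ ^ 2 / L ^ 2 = 16 * (w - s ^ 2) / L ^ 2 := by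
    field_simp
    rw [hve, hLe]; ring
  have h7 : - (8 / L * ⟪v, sd⟫) - 8 / L * ⟪v, d⟫ = 16 * (w - s ^ 2) / L := by
    rw [hvsd, hve, hvd]; field_simp; ring
  have hws : w - s ^ 2 ≤ η * E := by nlinarith [sq_nonneg s]
  have h8 : 16 * (w - s ^ 2) / L ^ 2 ≤ η * E * (16 / L ^ 2) := by
    rw [mul_div_assoc', mul_comm (16:ℝ)]; gcongr
  have h9 : 16 * (w - s ^ 2) / L ≤ η * E * (16 / L) := by
    rw [mul_div_assoc', mul_comm (16:ℝ)]; gcongr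
  rw [h1, h2, hv4]
  have e8 : 8 / L = 2 * (4 / L) := by ring
  have e16 : 16 / L = 4 * (4 / L) := by ring
  have hA : 4 / L + 4 / L + 8 / L = 16 / L := by ring
  have hX : η * E * (16 / L ^ 2 + 16 / L + 12 + 4 * α * ‖Γ‖ / ‖v‖ + α * Hs - α ^ 2 * ‖Γ‖ ^ 2 / 2) =
    η * E * (16 / L ^ 2) + η * E * (16 / L) + 12 * (η * E) + η * E * (4 * α * ‖Γ‖ / ‖v‖)
     + η * E * (α ^ 2 * ‖Γ‖ ^ 2 / 2) - η * E * (α ^ 2 * ‖Γ‖ ^ 2 - α * Hs) := by ring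
  rw [hX]
  linarith

set_option maxHeartbeats 4000000 in
/-- Consequences of the two-point maximum principle at the maximum point (normalised jets). -/
theorem tp_sum {σ : Euc n ≃ₗᵢ[ℝ] Euc n} {q e : Euc n} {α η τ0 B H : ℝ}
    {x y : Euc n} {p X r Y : Euc n → ℝ} (he : ‖e‖ = 1)
    (hσ : ∀ x, σ x = x - (2 * ⟪x, e⟫) • e)
    (h11 : ∀ ξ, p ξ + (η * (bE q e 0 α x * (-α * ⟪bGrad q e 0 x, ξ⟫)) -
        2 * ⟪y - σ x, 0 - σ ξ⟫) - 2 * ⟪x - y, ξ - 0⟫ / ‖x - y‖ ^ 2 = 0)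
    (h12 : ∀ ξ, (X ξ - (p ξ) ^ 2) +
        (η * (bE q e 0 α x * (α ^ 2 * ⟪bGrad q e 0 x, ξ⟫ ^ 2 - α * bHess q e 0 x ξ)) -
        2 * ‖0 - σ ξ‖ ^ 2) - (2 * ‖ξ - 0‖ ^ 2 / ‖x - y‖ ^ 2 -
          (2 * ⟪x - y, ξ - 0⟫ / ‖x - y‖ ^ 2) ^ 2) ≤ 0)
    (h21 : ∀ ζ, r ζ - 2 * ⟪y - σ x, ζ⟫ - 2 * ⟪x - y, 0 - ζ⟫ / ‖x - y‖ ^ 2 = 0)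
    (h22 : ∀ ζ, (Y ζ - (r ζ) ^ 2) - 2 * ‖ζ‖ ^ 2 - (2 * ‖0 - ζ‖ ^ 2 / ‖x - y‖ ^ 2 -
          (2 * ⟪x - y, 0 - ζ⟫ / ‖x - y‖ ^ 2) ^ 2) ≤ 0)
    (h3 : ∀ ξ, (X ξ - (p ξ) ^ 2) + (Y (σ ξ) - (r (σ ξ)) ^ 2) +
        (η * (bE q e 0 α x * (α ^ 2 * ⟪bGrad q e 0 x, ξ⟫ ^ 2 - α * bHess q e 0 x ξ)) -
        2 * ‖σ ξ - σ ξ‖ ^ 2) - (2 * ‖ξ - σ ξ‖ ^ 2 / ‖x - y‖ ^ 2 -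
          (2 * ⟪x - y, ξ - σ ξ⟫ / ‖x - y‖ ^ 2) ^ 2) ≤ 0)
    (hE1 : bE q e 0 α x ≤ 1) (hη : 0 < η) (hη4 : η ≤ 1 / 4) (hα : 0 ≤ α)
    (hd : ‖y - σ x‖ ^ 2 ≤ η * bE q e 0 α x) (hτ0 : 0 < τ0) (hv : τ0 ≤ ‖x - y‖)
    (hB0 : 0 ≤ B) (hB : ‖bGrad q e 0 x‖ ≤ B) (hH0 : 0 ≤ H) (hH : ∀ ξ, |bHess q e 0 x ξ| ≤ H * ‖ξ‖ ^ 2) :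
    (∀ b : OrthonormalBasis (Fin n) ℝ (Euc n), ∑ i, X (b i) + ∑ i, Y (σ (b i)) ≤
      η * bE q e 0 α x * (16 / τ0 ^ 4 + 16 / τ0 ^ 2 + 12 + 4 * α * B / τ0 + α * (n * H)
        - α ^ 2 * ‖bGrad q e 0 x‖ ^ 2 / 2)) ∧
    (∀ ξ, X ξ ≤ ((2 / τ0 + α * B + 2) ^ 2 + α * H + 2 + 2 / τ0 ^ 2) * ‖ξ‖ ^ 2) ∧
    (∀ ξ, Y ξ ≤ ((2 / τ0 + α * B + 2) ^ 2 + α * H + 2 + 2 / τ0 ^ 2) * ‖ξ‖ ^ 2) := by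
  set E := bE q e 0 α x with hE
  have hE0 : 0 < E := Real.exp_pos _
  set Γ := bGrad q e 0 x with hΓ
  set d := y - σ x with hdd
  set v := x - y with hvdef
  have hv0 : 0 < ‖v‖ := lt_of_lt_of_le hτ0 hv
  have hτe : v = (2 * ⟪x, e⟫) • e - d := by rw [hvdef, hdd, hσ]; module
  have hσσ : ∀ a b : Euc n, ⟪a, σ b⟫ = ⟪σ a, b⟫ := by
    intro a b
    rw [hσ, hσ, inner_sub_right, inner_sub_left, real_inner_smul_left, real_inner_smul_right,
      real_inner_comm e b]; ring
  set W1 := (2 / ‖v‖ ^ 2) • v + (η * E * α) • Γ - (2:ℝ) • σ d with hW1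
  set W2 := (2:ℝ) • d - (2 / ‖v‖ ^ 2) • v with hW2
  have hp : ∀ ξ, p ξ = ⟪W1, ξ⟫ := by
    intro ξ
    have := h11 ξ
    rw [zero_sub, sub_zero, inner_neg_right, hσσ] at this
    rw [hW1, inner_sub_left, inner_add_left, real_inner_smul_left, real_inner_smul_left,
      real_inner_smul_left]
    linear_combination this
  have hr : ∀ ξ, r ξ = ⟪W2, ξ⟫ := by
    intro ξ
    have := h21 ξ
    rw [zero_sub, inner_neg_right] at this
    rw [hW2, inner_sub_left, real_inner_smul_left, real_inner_smul_left]
    linear_combination this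
  have hηE : η * E ≤ 1 := by nlinarith
  have hdn : ‖d‖ ≤ 1 := by
    have : ‖d‖ ^ 2 ≤ 1 := hd.trans hηE
    nlinarith [norm_nonneg d]
  have hvn : ‖(2 / ‖v‖ ^ 2) • v‖ ≤ 2 / τ0 := by
    rw [norm_smul, Real.norm_of_nonneg (by positivity)]
    calc 2 / ‖v‖ ^ 2 * ‖v‖ = 2 / ‖v‖ := by field_simp
      _ ≤ 2 / τ0 := by gcongr
  have hW1n : ‖W1‖ ≤ 2 / τ0 + α * B + 2 := by
    rw [hW1]
    refine (norm_sub_le _ _).trans (add_le_add ((norm_add_le _ _).trans (add_le_add hvn ?_)) ?_)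
    · rw [norm_smul, Real.norm_of_nonneg (by positivity)]
      calc η * E * α * ‖Γ‖ ≤ 1 * α * B := by gcongr
        _ = _ := by ring
    · rw [norm_smul, LinearIsometryEquiv.norm_map]; norm_num; linarith
  have hW2n : ‖W2‖ ≤ 2 / τ0 + α * B + 2 := by
    rw [hW2]
    refine (norm_sub_le _ _).trans ?_
    have : ‖(2:ℝ) • d‖ ≤ 2 := by rw [norm_smul]; norm_num; linarith
    have : 0 ≤ α * B := by positivity
    linarith
  have hsq : ∀ W ξ : Euc n, ‖W‖ ≤ 2 / τ0 + α * B + 2 → ⟪W, ξ⟫ ^ 2 ≤ (2 / τ0 + α * B + 2) ^ 2 * ‖ξ‖ ^ 2 := by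
    intro W ξ hW
    rw [← mul_pow, ← sq_abs]
    have := (abs_real_inner_le_norm W ξ).trans (mul_le_mul_of_nonneg_right hW (norm_nonneg ξ))
    exact pow_le_pow_left₀ (abs_nonneg _) this 2
  have hξv : ∀ ξ : Euc n, 2 * ‖ξ‖ ^ 2 / ‖v‖ ^ 2 ≤ 2 / τ0 ^ 2 * ‖ξ‖ ^ 2 := by
    intro ξ
    rw [mul_div_right_comm]; gcongr
  refine ⟨?_, ?_, ?_⟩
  · intro b
    have hb1 : ∀ W : Euc n, ∑ i, ⟪W, b i⟫ ^ 2 = ‖W‖ ^ 2 := fun W => b.sum_sq_inner_left W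
    have hb2 : ∀ W : Euc n, ∑ i, ⟪W, σ (b i)⟫ ^ 2 = ‖W‖ ^ 2 := by
      intro W
      simp only [hσσ, hb1, LinearIsometryEquiv.norm_map]
    have hterm : ∀ i, X (b i) + Y (σ (b i)) ≤ ⟪W1, b i⟫ ^ 2 + ⟪W2, σ (b i)⟫ ^ 2
        - η * E * (α ^ 2 * ⟪Γ, b i⟫ ^ 2 - α * bHess q e 0 x (b i))
        + (8 / ‖v‖ ^ 2 - 16 * ⟪v, e⟫ ^ 2 / ‖v‖ ^ 4) * ⟪e, b i⟫ ^ 2 := by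
      intro i
      have := h3 (b i)
      rw [hp, hr, sub_self, norm_zero] at this
      have h1 : b i - σ (b i) = (2 * ⟪e, b i⟫) • e := by rw [hσ, real_inner_comm]; module
      rw [h1, norm_smul, mul_pow, he, real_inner_smul_right, Real.norm_eq_abs, sq_abs] at this
      have h2 : 2 * ((2 * ⟪e, b i⟫) ^ 2 * 1 ^ 2) / ‖v‖ ^ 2 - (2 * (2 * ⟪e, b i⟫ * ⟪v, e⟫) / ‖v‖ ^ 2) ^ 2
        = (8 / ‖v‖ ^ 2 - 16 * ⟪v, e⟫ ^ 2 / ‖v‖ ^ 4) * ⟪e, b i⟫ ^ 2 := by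
        field_simp; ring
      rw [h2] at this
      linear_combination this
    have hsum := Finset.sum_le_sum fun i (_ : i ∈ Finset.univ) => hterm i
    rw [Finset.sum_add_distrib, Finset.sum_add_distrib, Finset.sum_sub_distrib,
      Finset.sum_add_distrib, hb1, hb2, ← Finset.mul_sum, ← Finset.mul_sum, hb1, he,
      Finset.sum_sub_distrib, ← Finset.mul_sum, ← Finset.mul_sum, hb1] at hsum
    have halg := tp_alg e d v Γ (σ d) ⟪x, e⟫ η E α (∑ i, bHess q e 0 x (b i)) he hτe (hσ d) hE0 hE1
      hη hη4 hα hd hv0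
    have hHs : ∑ i, bHess q e 0 x (b i) ≤ n * H := by
      calc _ ≤ ∑ i : Fin n, H := Finset.sum_le_sum fun i _ => by
            have := (abs_le.1 (hH (b i))).2
            rwa [b.norm_eq_one, one_pow, mul_one] at this
        _ = _ := by simp
    have hfin : η * E * (16 / ‖v‖ ^ 4 + 16 / ‖v‖ ^ 2 + 12 + 4 * α * ‖Γ‖ / ‖v‖ +
        α * (∑ i, bHess q e 0 x (b i)) - α ^ 2 * ‖Γ‖ ^ 2 / 2) ≤
        η * E * (16 / τ0 ^ 4 + 16 / τ0 ^ 2 + 12 + 4 * α * B / τ0 + α * (n * H)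
        - α ^ 2 * ‖Γ‖ ^ 2 / 2) := by
      gcongr
    rw [← hW1, ← hW2] at halg
    linarith
  · intro ξ
    have := h12 ξ
    rw [hp, sub_zero, zero_sub, norm_neg, LinearIsometryEquiv.norm_map] at this
    have h1 := hsq W1 ξ hW1n
    have h2 := hξv ξ
    have h3 : η * (E * (α ^ 2 * ⟪Γ, ξ⟫ ^ 2 - α * bHess q e 0 x ξ)) ≥ - (α * H * ‖ξ‖ ^ 2) := by
      have a1 := (abs_le.1 (hH ξ)).2
      have a2 : 0 ≤ η * E * (α ^ 2 * ⟪Γ, ξ⟫ ^ 2) := by positivity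
      have a3 : η * E * (α * bHess q e 0 x ξ) ≤ η * E * (α * (H * ‖ξ‖ ^ 2)) := by gcongr
      have a4 : η * E * (α * (H * ‖ξ‖ ^ 2)) ≤ 1 * (α * (H * ‖ξ‖ ^ 2)) := by gcongr
      linarith
    have h4 := sq_nonneg (2 * ⟪v, ξ⟫ / ‖v‖ ^ 2)
    linarith
  · intro ξ
    have := h22 ξ
    rw [hr, zero_sub, norm_neg] at this
    have h1 := hsq W2 ξ hW2n
    have h2 := hξv ξ
    have h4 := sq_nonneg (2 * ⟪v, -ξ⟫ / ‖v‖ ^ 2)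
    have h5 : 0 ≤ α * H * ‖ξ‖ ^ 2 := by positivity
    linarith

end

section

variable {n : ℕ}

local notation "⟪" x ", " y "⟫" => inner ℝ x y

/-- `U` is an approximate subsolution at `x`. -/
def NearHarm (κ : ℝ) (U : Euc n → ℝ) (x : Euc n) : Prop :=
  ∃ p X : Euc n → ℝ, (∀ ξ, J2 (fun t => U (x + t • ξ)) (p ξ) (X ξ)) ∧
    ∃ ξ : Fin n → Euc n, ∑ k, ‖ξ k‖ ^ 2 ≤ κ ∧
      ∀ b : OrthonormalBasis (Fin n) ℝ (Euc n), -κ ≤ ∑ i, X (b i) + ∑ k, X (ξ k)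

/-- Geometry of the region where the barrier is nonnegative. -/
theorem bar_region {q e x : Euc n} {ρ : ℝ} (hρ : 0 < ρ) (hρ1 : ρ ≤ 1) (he : ‖e‖ = 1)
    (hq : ‖q‖ ≤ 2) (hqe : 2 * ρ ≤ ⟪q, e⟫) (hτ : 0 < bTau e 0 x) (hG : bG q e 0 x ≤ 10) :
    ρ ^ 2 / 10 ≤ bTau e 0 x ∧ ‖x - q‖ ≤ 12 ∧ ‖x‖ ≤ 14 := by
  have h1 : ‖x - q‖ ^ 2 ≤ 10 * bTau e 0 x := by
    rw [bG, div_le_iff₀ hτ] at hG; exact hG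
  have h2 : bTau e 0 x = ⟪x - q, e⟫ + ⟪q, e⟫ := by
    rw [bTau, inner_sub_left, real_inner_comm]; ring
  have h3 : |⟪x - q, e⟫| ≤ ‖x - q‖ := by
    have := abs_real_inner_le_norm (x - q) e
    rwa [he, mul_one] at this
  have h4 : |⟪q, e⟫| ≤ ‖q‖ := by
    have := abs_real_inner_le_norm q e
    rwa [he, mul_one] at this
  have h3' := abs_le.1 h3
  have h4' := abs_le.1 h4
  have h5 : ‖x - q‖ ≤ 12 := by
    by_contra h
    push Not at h
    nlinarith
  refine ⟨?_, h5, ?_⟩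
  · rcases le_or_gt ρ (bTau e 0 x) with h | h
    · nlinarith
    · have : ρ ≤ ‖x - q‖ := by linarith
      nlinarith
  · have := norm_add_le (x - q) q
    rw [sub_add_cancel] at this
    linarith

theorem bG_continuousOn (q e : Euc n) (s : Set (Euc n)) (h : ∀ x ∈ s, 0 < bTau e 0 x) :
    ContinuousOn (bG q e 0) s := by
  unfold bG
  refine ContinuousOn.div (by fun_prop) (by unfold bTau; fun_prop) ?_
  intro x hx
  exact (h x hx).ne'

theorem ia_a {η b x N : ℝ} (hη : 0 < η) (h : 0 ≤ η * (b - x) - N) (hN : 0 ≤ N) (hl : b < x) : False := by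
  have := mul_neg_of_pos_of_neg hη (sub_neg.2 hl)
  linarith

theorem ia_b {α g c : ℝ} (hα : 0 < α) (h : -α * c ≤ -α * g) : g ≤ c := by
  nlinarith

theorem ia_c {α g : ℝ} (hα : 0 < α) (h : 0 ≤ g) : -α * g ≤ 0 := by
  nlinarith

theorem ia_d {η b x N : ℝ} (hη : 0 < η) (h : 0 ≤ η * (b - x) - N) (hx : 0 < x) : N ≤ η * b := by
  nlinarith

theorem ia_e {α t : ℝ} (hα : 0 < α) (h0 : 0 ≤ t) (h : t ≤ 3) : -α * 9 ≤ -α * t ^ 2 := by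
  have : t ^ 2 ≤ 9 := by nlinarith
  nlinarith

set_option maxHeartbeats 4000000 in
theorem improve_aux (n : ℕ) (ρ : ℝ) (hρ : 0 < ρ) (hρ1 : ρ ≤ 1) :
    ∃ N : ℝ, 16 ≤ N ∧ ∀ θ0 L : ℝ, 0 < θ0 → 0 < L → ∃ κ : ℝ, 0 < κ ∧
      ∀ (e q : Euc n) (U1 U2 : Euc n → ℝ) (θ : ℝ), ‖e‖ = 1 → θ0 ≤ θ →
      ContinuousOn U1 (ball 0 N) → ContinuousOn U2 (ball 0 N) →
      (∀ x ∈ ball (0 : Euc n) N, 0 ≤ U1 x) → (∀ x ∈ ball (0 : Euc n) N, 0 ≤ U2 x) →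
      (∀ x ∈ ball (0 : Euc n) N, U1 x ≤ L) → (∀ x ∈ ball (0 : Euc n) N, U2 x ≤ L) →
      ‖q‖ ≤ 2 → 2 * ρ ≤ ⟪q, e⟫ → (∀ x ∈ ball q ρ, U1 x = 0) →
      (∀ x ∈ ball (0 : Euc n) N, 0 < U1 x → NearHarm κ U1 x) →
      (∀ x ∈ ball (0 : Euc n) N, 0 < U2 x → NearHarm κ U2 x) →
      4 * θ ≤ U1 e * U2 (-e) →
      ∃ x ∈ ball (0 : Euc n) N, ∃ y ∈ ball (0 : Euc n) N, 1 / N ≤ ‖x - y‖ ∧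
        (1 + κ) * θ * ‖x - y‖ ^ 2 < U1 x * U2 y := by
  set τ0 : ℝ := ρ ^ 2 / 20 with hτ0d
  have hτ0 : 0 < τ0 := by positivity
  have hτ01 : τ0 ≤ 1 / 20 := by rw [hτ0d]; nlinarith
  set B : ℝ := (2 * 12 + 10 * 1) / τ0 with hB
  set H : ℝ := (2 + 2 * B * 1) / τ0 with hH
  have hB0 : 0 < B := by positivity
  have hH0 : 0 < H := by positivity
  obtain ⟨α, hα1, hα⟩ := exists_alpha ((ρ / 14) ^ 2 / 2) (4 * B / τ0 + n * H)
    (16 / τ0 ^ 4 + 16 / τ0 ^ 2 + 12 + 1) (by positivity)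
  have hα0 : 0 < α := by linarith
  set η : ℝ := min (1 / 4) (τ0 ^ 2) with hη
  have hη0 : 0 < η := by rw [hη]; positivity
  have hη4 : η ≤ 1 / 4 := min_le_left _ _
  have hητ : η ≤ τ0 ^ 2 := min_le_right _ _
  set h0 : ℝ := Real.exp (-α * 9) - Real.exp (-α * 10) with hh0
  have hh0p : 0 < h0 := by rw [hh0, sub_pos, Real.exp_lt_exp]; linarith
  set C : ℝ := (2 / τ0 + α * B + 2) ^ 2 + α * H + 2 + 2 / τ0 ^ 2 with hC
  have hC0 : 0 < C := by positivity
  refine ⟨16 + 1 / τ0, by have : 0 < 1 / τ0 := by positivity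
                          linarith, ?_⟩
  set N : ℝ := 16 + 1 / τ0 with hN
  have hN16 : 16 ≤ N := by
    have : 0 < 1 / τ0 := by positivity
    linarith
  have hNτ : 1 / N ≤ τ0 := by
    rw [div_le_iff₀ (by linarith), hN, mul_add, mul_one_div_cancel hτ0.ne']
    linarith
  intro θ0 L hθ0 hL
  set c : ℝ := θ0 * τ0 ^ 2 / (3 * L) with hc
  have hc0 : 0 < c := by positivity
  refine ⟨min (η * h0 / 2) (η * Real.exp (-α * 10) / (2 * (2 * C + 2 / c))), by positivity, ?_⟩
  set κ := min (η * h0 / 2) (η * Real.exp (-α * 10) / (2 * (2 * C + 2 / c))) with hκ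
  have hκ0 : 0 < κ := by rw [hκ]; positivity
  have hκ1 : κ < η * h0 := lt_of_le_of_lt (min_le_left _ _) (by
    have := mul_pos hη0 hh0p
    linarith)
  have hκ2 : κ * (2 * C + 2 / c) < η * Real.exp (-α * 10) := by
    have hp : 0 < 2 * C + 2 / c := by positivity
    have h1 : κ ≤ η * Real.exp (-α * 10) / (2 * (2 * C + 2 / c)) := min_le_right _ _
    have h2 : κ * (2 * C + 2 / c) ≤ η * Real.exp (-α * 10) / (2 * (2 * C + 2 / c)) * (2 * C + 2 / c) := by
      gcongr
    have h3 : η * Real.exp (-α * 10) / (2 * (2 * C + 2 / c)) * (2 * C + 2 / c) = η * Real.exp (-α * 10) / 2 := by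
      field_simp
    have h4 : 0 < η * Real.exp (-α * 10) := by positivity
    linarith
  clear_value κ
  intro e q U1 U2 θ he hθ hc1 hc2 hn1 hn2 hL1 hL2 hq hqe hz1 hH1 hH2 hstart
  have hθp : 0 < θ := by linarith
  by_contra hcon
  push Not at hcon
  obtain ⟨σ, hσ⟩ := exists_refl e he
  set S : Set (Euc n × Euc n) := (closedBall (0 : Euc n) 15 ×ˢ closedBall (0 : Euc n) 15) ∩
    {z | τ0 ≤ bTau e 0 z.1} with hS
  have hScomp : IsCompact S := by
    refine ((isCompact_closedBall (0 : Euc n) 15).prod (isCompact_closedBall (0 : Euc n) 15)).inter_right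
      (isClosed_le continuous_const ?_)
    unfold bTau; fun_prop
  set φ : Euc n × Euc n → ℝ := fun z => tpPhi σ q e α 10 η z.1 z.2 with hφ
  have hbEc : ∀ T : Set (Euc n × Euc n), (∀ z ∈ T, 0 < bTau e 0 z.1) → ContinuousOn φ T := by
    intro T hT
    have h1 : ContinuousOn (fun z : Euc n × Euc n => bG q e 0 z.1) T := by
      refine (bG_continuousOn q e {x | 0 < bTau e 0 x} (fun x hx => hx)).comp continuousOn_fst ?_
      intro z hz; exact hT z hz
    have h2 : ContinuousOn (fun z : Euc n × Euc n => bE q e 0 α z.1) T := by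
      unfold bE; exact (continuousOn_const.mul h1).rexp
    have h3 : Continuous (fun z : Euc n × Euc n => ‖z.2 - σ z.1‖ ^ 2) := by
      have := σ.continuous
      fun_prop
    exact (continuousOn_const.mul (h2.sub continuousOn_const)).sub h3.continuousOn
  set Kc : Set (Euc n × Euc n) := S ∩ φ ⁻¹' (Ici 0) with hKc
  have hφS : ContinuousOn φ S := hbEc S fun z hz => lt_of_lt_of_le hτ0 hz.2
  have hKcomp : IsCompact Kc := by
    refine hScomp.of_isClosed_subset ?_ inter_subset_left
    exact hφS.preimage_isClosed_of_isClosed hScomp.isClosed isClosed_Ici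
  -- geometry of K
  have hgeo : ∀ z : Euc n × Euc n, 0 < bTau e 0 z.1 → 0 ≤ φ z → bG q e 0 z.1 ≤ 10 ∧ 2 * τ0 ≤ bTau e 0 z.1 ∧
      ‖z.1 - q‖ ≤ 12 ∧ ‖z.1‖ ≤ 14 ∧ ‖z.2 - σ z.1‖ ^ 2 ≤ η * bE q e 0 α z.1 ∧ ‖z.2 - σ z.1‖ ≤ τ0 ∧
      ‖z.2‖ < 15 ∧ τ0 ≤ ‖z.1 - z.2‖ ∧ bE q e 0 α z.1 ≤ 1 ∧ Real.exp (-α * 10) ≤ bE q e 0 α z.1 ∧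
      φ z ≤ 1 := by
    intro z hz hφz
    have hsn := sq_nonneg ‖z.2 - σ z.1‖
    have hex := Real.exp_pos (-α * 10)
    simp only [hφ, tpPhi] at hφz ⊢
    have h1 : Real.exp (-α * 10) ≤ bE q e 0 α z.1 := by
      by_contra hlt
      push Not at hlt
      exact ia_a hη0 hφz hsn hlt
    have hG : bG q e 0 z.1 ≤ 10 := by
      rw [bE, Real.exp_le_exp] at h1; exact ia_b hα0 h1
    obtain ⟨g1, g2, g3⟩ := bar_region hρ hρ1 he hq hqe hz hG
    have hG0 : 0 ≤ bG q e 0 z.1 := by unfold bG; positivity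
    have hE1 : bE q e 0 α z.1 ≤ 1 := by
      rw [bE, Real.exp_le_one_iff]; exact ia_c hα0 hG0
    have hd1 : ‖z.2 - σ z.1‖ ^ 2 ≤ η * bE q e 0 α z.1 := ia_d hη0 hφz hex
    have hd2 : ‖z.2 - σ z.1‖ ≤ τ0 := by
      have : ‖z.2 - σ z.1‖ ^ 2 ≤ τ0 ^ 2 := by
        have := mul_le_mul_of_nonneg_left hE1 hη0.le
        linarith
      exact le_of_sq_le_sq this hτ0.le
    have hz2 : ‖z.2‖ < 15 := by
      have := norm_add_le (z.2 - σ z.1) (σ z.1)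
      rw [sub_add_cancel, LinearIsometryEquiv.norm_map] at this
      linarith
    have h2τ : 2 * τ0 ≤ bTau e 0 z.1 := by rw [hτ0d]; linarith
    refine ⟨hG, h2τ, g2, g3, hd1, hd2, hz2, ?_, hE1, h1, ?_⟩
    · have e1 : z.1 - z.2 = (2 * bTau e 0 z.1) • e - (z.2 - σ z.1) := by
        rw [hσ, bTau, real_inner_comm]; module
      have e2 := norm_sub_norm_le ((2 * bTau e 0 z.1) • e) (z.2 - σ z.1)
      rw [← e1, norm_smul, he, Real.norm_of_nonneg (by linarith)] at e2
      linarith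
    · have i1 := mul_le_mul_of_nonneg_left hE1 hη0.le
      have i2 := mul_pos hη0 hex
      linarith
  have hKb : ∀ z ∈ Kc, z.1 ∈ ball (0 : Euc n) N ∧ z.2 ∈ ball (0 : Euc n) N := by
    intro z hz
    obtain ⟨-, -, -, h1, -, -, h2, -⟩ := hgeo z (lt_of_lt_of_le hτ0 hz.1.2) hz.2
    simp only [mem_ball_zero_iff]
    constructor <;> linarith
  set F := tpF U1 U2 σ q e α 10 η with hF
  have hFc : ContinuousOn F Kc := by
    unfold F tpF
    have h1 : ContinuousOn (fun z : Euc n × Euc n => U1 z.1) Kc :=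
      hc1.comp continuousOn_fst fun z hz => (hKb z hz).1
    have h2 : ContinuousOn (fun z : Euc n × Euc n => U2 z.2) Kc :=
      hc2.comp continuousOn_snd fun z hz => (hKb z hz).2
    have h3 : ContinuousOn φ Kc := hφS.mono inter_subset_left
    refine ((h1.mul h2).mul h3.rexp).div
      ((continuous_fst.sub continuous_snd).norm.pow 2).continuousOn ?_
    intro z hz
    obtain ⟨-, -, -, -, -, -, -, h, -⟩ := hgeo z (lt_of_lt_of_le hτ0 hz.1.2) hz.2
    have : 0 < ‖z.1 - z.2‖ := by linarith
    positivity
  have hee : ⟪e, e⟫ = 1 := by rw [real_inner_self_eq_norm_sq, he]; norm_num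
  have hσe : σ e = -e := by rw [hσ, hee]; module
  have hτe : bTau e 0 e = 1 := by rw [bTau, hee, zero_add]
  have hφe : η * h0 ≤ φ (e, -e) := by
    simp only [hφ, tpPhi, hσe, sub_self, norm_zero]
    have h1 : Real.exp (-α * 9) ≤ bE q e 0 α e := by
      rw [bE, Real.exp_le_exp, bG, hτe, div_one]
      have : ‖e - q‖ ≤ 3 := (norm_sub_le _ _).trans (by rw [he]; linarith)
      exact ia_e hα0 (norm_nonneg _) this
    rw [hh0]
    have i1 := mul_le_mul_of_nonneg_left h1 hη0.le
    linarith
  have heK : (e, -e) ∈ Kc := by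
    refine ⟨⟨⟨?_, ?_⟩, ?_⟩, ?_⟩
    · simp [he]
    · simp [he]
    · show τ0 ≤ bTau e 0 e
      linarith
    · exact le_trans (by positivity) hφe
  have hFe : θ * Real.exp (η * h0) ≤ F (e, -e) := by
    simp only [hF, tpF]
    have h1 : ‖e - -e‖ ^ 2 = 4 := by
      have : e - -e = (2:ℝ) • e := by module
      rw [this, norm_smul, he]; norm_num
    rw [h1, le_div_iff₀ (by norm_num)]
    have h2 : Real.exp (η * h0) ≤ Real.exp (tpPhi σ q e α 10 η e (-e)) := Real.exp_le_exp.2 hφe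
    have h3 := Real.exp_pos (η * h0)
    calc θ * Real.exp (η * h0) * 4 = 4 * θ * Real.exp (η * h0) := by ring
      _ ≤ U1 e * U2 (-e) * Real.exp (tpPhi σ q e α 10 η e (-e)) :=
        mul_le_mul hstart h2 h3.le (by linarith)
  obtain ⟨⟨x, y⟩, hzK, hzmax⟩ := hKcomp.exists_isMaxOn ⟨_, heK⟩ hFc
  have hFz : θ * Real.exp (η * h0) ≤ F (x, y) := hFe.trans (hzmax heK)
  have hτx0 : 0 < bTau e 0 x := lt_of_lt_of_le hτ0 hzK.1.2
  obtain ⟨gG, gτ, gxq, gx, gd, gd2, gy, gl, gE1, gE0, gφ1⟩ := hgeo (x, y) hτx0 hzK.2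
  simp only at gG gτ gxq gx gd gd2 gy gl gE1 gE0
  obtain ⟨hxN, hyN⟩ := hKb (x, y) hzK
  simp only at hxN hyN
  have hl0 : 0 < ‖x - y‖ := by linarith
  have hxy : x ≠ y := by rintro rfl; simp at hl0
  have hE0 := Real.exp_pos (η * h0)
  have hFz' : θ * Real.exp (η * h0) * ‖x - y‖ ^ 2 ≤ U1 x * U2 y * Real.exp (φ (x, y)) := by
    have := hFz
    simp only [hF, tpF] at this
    rwa [le_div_iff₀ (by positivity)] at this
  have hprod : 0 < U1 x * U2 y := by
    have h1 : 0 < θ * Real.exp (η * h0) * ‖x - y‖ ^ 2 := by positivity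
    exact pos_of_mul_pos_left (h1.trans_le hFz') (Real.exp_pos _).le
  have hU1 : 0 < U1 x := lt_of_le_of_ne (hn1 x hxN) fun h => by rw [← h] at hprod; simp at hprod
  have hU2 : 0 < U2 y := lt_of_le_of_ne (hn2 y hyN) fun h => by rw [← h] at hprod; simp at hprod
  have hφpos : 0 < φ (x, y) := by
    rcases (show (0:ℝ) ≤ φ (x, y) from hzK.2).lt_or_eq with h | h
    · exact h
    · exfalso
      have h1 := hcon x hxN y hyN (hNτ.trans gl)
      rw [← h, Real.exp_zero, mul_one] at hFz'
      have h2 : 1 + κ < Real.exp (η * h0) := by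
        have := Real.add_one_le_exp (η * h0)
        linarith
      have h3 : (1 + κ) * θ * ‖x - y‖ ^ 2 < θ * Real.exp (η * h0) * ‖x - y‖ ^ 2 := by
        rw [mul_comm (1 + κ)]; gcongr
      linarith
  have hloc : IsLocalMax F (x, y) := by
    refine hzmax.isLocalMax ?_
    have o1 : ∀ᶠ z : Euc n × Euc n in 𝓝 (x, y), ‖z.1‖ < 15 :=
      (continuous_fst.norm.tendsto (x, y)).eventually (gt_mem_nhds (by simp only; linarith))
    have o2 : ∀ᶠ z : Euc n × Euc n in 𝓝 (x, y), ‖z.2‖ < 15 :=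
      (continuous_snd.norm.tendsto (x, y)).eventually (gt_mem_nhds (by simp only; linarith))
    have hct : Continuous (fun z : Euc n × Euc n => bTau e 0 z.1) := by unfold bTau; fun_prop
    have o3 : ∀ᶠ z : Euc n × Euc n in 𝓝 (x, y), τ0 < bTau e 0 z.1 :=
      (hct.tendsto (x, y)).eventually (lt_mem_nhds (by simp only; linarith))
    have hcφ : ContinuousAt φ (x, y) :=
      (hbEc {z | τ0 < bTau e 0 z.1} (fun z hz => hτ0.trans hz)).continuousAt o3
    have o4 : ∀ᶠ z : Euc n × Euc n in 𝓝 (x, y), 0 < φ z :=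
      hcφ.tendsto.eventually (lt_mem_nhds hφpos)
    filter_upwards [o1, o2, o3, o4] with z h1 h2 h3 h4
    refine ⟨⟨⟨by simpa using h1.le, by simpa using h2.le⟩, h3.le⟩, h4.le⟩
  have hxρ : ρ ≤ ‖x - q‖ := by
    by_contra h
    push Not at h
    have := hz1 x (by simpa [dist_eq_norm] using h)
    linarith
  have hct1 : ContinuousAt U1 x := hc1.continuousAt (isOpen_ball.mem_nhds hxN)
  have hct2 : ContinuousAt U2 y := hc2.continuousAt (isOpen_ball.mem_nhds hyN)
  obtain ⟨p, X, hJ1, ξ, hξ, hX⟩ := hH1 x hxN hU1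
  obtain ⟨r, Y, hJ2, ζ, hζ, hY⟩ := hH2 y hyN hU2
  have hcj1 : J2 (fun t : ℝ => U1 (x + t • (0 : Euc n))) 0 0 := by
    simpa using J2.const (U1 x)
  have hcj2 : J2 (fun t : ℝ => U2 (y + t • (0 : Euc n))) 0 0 := by
    simpa using J2.const (U2 y)
  have hBx : ‖bGrad q e 0 x‖ ≤ B :=
    bGrad_upper q e 0 x hτ0 (by linarith) gxq gG he.le
  have hHx : ∀ ξ, |bHess q e 0 x ξ| ≤ H * ‖ξ‖ ^ 2 := fun ξ =>
    bHess_bound q e 0 x ξ hτ0 (by linarith) hBx he.le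
  obtain ⟨t1, t2, t3⟩ := tp_sum (σ := σ) (q := q) (e := e) (α := α) (η := η) (τ0 := τ0) (B := B) (H := H)
    (x := x) (y := y) (p := fun ξ => p ξ / U1 x) (X := fun ξ => X ξ / U1 x)
    (r := fun ξ => r ξ / U2 y) (Y := fun ξ => Y ξ / U2 y) he hσ
    (fun ξ => by
      have := (tp_max hU1 hU2 hct1 hct2 (hJ1 ξ) hcj2 hτx0 hxy hloc).1
      rwa [zero_div, add_zero] at this)
    (fun ξ => by
      have := (tp_max hU1 hU2 hct1 hct2 (hJ1 ξ) hcj2 hτx0 hxy hloc).2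
      rwa [zero_div, zero_pow two_ne_zero, sub_self, add_zero] at this)
    (fun ξ => by
      have := (tp_max hU1 hU2 hct1 hct2 hcj1 (hJ2 ξ) hτx0 hxy hloc).1
      simp only [zero_div, zero_add, inner_zero_right, mul_zero, map_zero, sub_zero, zero_sub] at this ⊢
      linarith)
    (fun ξ => by
      have := (tp_max hU1 hU2 hct1 hct2 hcj1 (hJ2 ξ) hτx0 hxy hloc).2
      have hb0 : bHess q e 0 x 0 = 0 := by simp [bHess]
      simp only [zero_div, zero_add, inner_zero_right, mul_zero, map_zero, sub_zero, zero_sub,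
        zero_pow two_ne_zero, sub_self, hb0] at this ⊢
      linarith)
    (fun ξ => (tp_max hU1 hU2 hct1 hct2 (hJ1 ξ) (hJ2 (σ ξ)) hτx0 hxy hloc).2)
    gE1 hη0 hη4 hα0.le gd hτ0 gl hB0.le hBx hH0.le hHx
  -- lower bounds
  have hPlow : θ0 * τ0 ^ 2 / 3 ≤ U1 x * U2 y := by
    have h1 : Real.exp (φ (x, y)) ≤ 3 := by
      refine (Real.exp_le_exp.2 gφ1).trans ?_
      have := Real.exp_one_lt_d9
      linarith
    have h2 : 1 ≤ Real.exp (η * h0) := Real.one_le_exp (by positivity)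
    have h3 : U1 x * U2 y * Real.exp (φ (x, y)) ≤ U1 x * U2 y * 3 := by gcongr
    have h4 : θ0 * 1 * τ0 ^ 2 ≤ θ * Real.exp (η * h0) * ‖x - y‖ ^ 2 := by gcongr
    linarith
  have hU1c : c ≤ U1 x := by
    rw [hc, div_le_iff₀ (by positivity)]
    have := mul_le_mul_of_nonneg_left (hL2 y hyN) hU1.le
    linarith
  have hU2c : c ≤ U2 y := by
    rw [hc, div_le_iff₀ (by positivity)]
    have := mul_le_mul_of_nonneg_right (hL1 x hxN) hU2.le
    linarith
  -- final contradiction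
  set b : OrthonormalBasis (Fin n) ℝ (Euc n) := EuclideanSpace.basisFun (Fin n) ℝ
  have q1 := hX b
  have q2 := hY (b.map σ)
  simp only [OrthonormalBasis.map_apply] at q2
  have q1' : -(κ / c) ≤ ∑ i, X (b i) / U1 x + ∑ k, X (ξ k) / U1 x := by
    rw [← Finset.sum_div, ← Finset.sum_div, ← add_div, neg_le, ← neg_div]
    refine (div_le_div_of_nonneg_right (neg_le.1 q1) hU1.le).trans ?_
    gcongr
  have q2' : -(κ / c) ≤ ∑ i, Y (σ (b i)) / U2 y + ∑ k, Y (ζ k) / U2 y := by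
    rw [← Finset.sum_div, ← Finset.sum_div, ← add_div, neg_le, ← neg_div]
    refine (div_le_div_of_nonneg_right (neg_le.1 q2) hU2.le).trans ?_
    gcongr
  have q3 : ∑ k, X (ξ k) / U1 x ≤ C * κ := by
    calc _ ≤ ∑ k, C * ‖ξ k‖ ^ 2 := Finset.sum_le_sum fun k _ => t2 (ξ k)
      _ = C * ∑ k, ‖ξ k‖ ^ 2 := by rw [Finset.mul_sum]
      _ ≤ _ := by gcongr
  have q4 : ∑ k, Y (ζ k) / U2 y ≤ C * κ := by
    calc _ ≤ ∑ k, C * ‖ζ k‖ ^ 2 := Finset.sum_le_sum fun k _ => t3 (ζ k)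
      _ = C * ∑ k, ‖ζ k‖ ^ 2 := by rw [Finset.mul_sum]
      _ ≤ _ := by gcongr
  have q5 := t1 b
  have hΓl : ρ / 14 ≤ ‖bGrad q e 0 x‖ := by
    refine le_trans ?_ (bGrad_lower q e 0 x hτx0 ?_)
    · have h1 : bTau e 0 x ≤ 14 := by
        rw [bTau, zero_add]
        refine (real_inner_le_norm _ _).trans ?_
        rw [he]; linarith
      gcongr
    · rw [bTau, real_inner_comm]; linarith
  have hbr : 16 / τ0 ^ 4 + 16 / τ0 ^ 2 + 12 + 4 * α * B / τ0 + α * (n * H)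
        - α ^ 2 * ‖bGrad q e 0 x‖ ^ 2 / 2 ≤ -1 := by
    have h1 : (ρ / 14) ^ 2 ≤ ‖bGrad q e 0 x‖ ^ 2 := by gcongr
    have h2 := mul_le_mul_of_nonneg_left h1 (sq_nonneg α)
    have h3 : 4 * α * B / τ0 = 4 * B / τ0 * α := by ring
    rw [h3]
    linarith
  have q6 : η * bE q e 0 α x * (16 / τ0 ^ 4 + 16 / τ0 ^ 2 + 12 + 4 * α * B / τ0 + α * (n * H)
        - α ^ 2 * ‖bGrad q e 0 x‖ ^ 2 / 2) ≤ - (η * Real.exp (-α * 10)) := by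
    have hp : 0 < η * bE q e 0 α x := mul_pos hη0 (Real.exp_pos _)
    have h1 := mul_le_mul_of_nonneg_left hbr hp.le
    have h2 := mul_le_mul_of_nonneg_left gE0 hη0.le
    linarith
  have q7 : κ * (2 * C + 2 / c) = 2 * (C * κ) + 2 * (κ / c) := by ring
  linarith

theorem improve (n : ℕ) (ρ : ℝ) (hρ : 0 < ρ) (hρ1 : ρ ≤ 1) :
    ∃ N : ℝ, 16 ≤ N ∧ ∀ θ0 L : ℝ, 0 < θ0 → 0 < L → ∃ κ : ℝ, 0 < κ ∧
      ∀ (e q : Euc n) (U1 U2 : Euc n → ℝ) (θ : ℝ), ‖e‖ = 1 → θ0 ≤ θ →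
      ContinuousOn U1 (ball 0 N) → ContinuousOn U2 (ball 0 N) →
      (∀ x ∈ ball (0 : Euc n) N, 0 ≤ U1 x) → (∀ x ∈ ball (0 : Euc n) N, 0 ≤ U2 x) →
      (∀ x ∈ ball (0 : Euc n) N, U1 x ≤ L) → (∀ x ∈ ball (0 : Euc n) N, U2 x ≤ L) →
      ‖q‖ ≤ 2 → 2 * ρ ≤ |⟪q, e⟫| → (∀ x ∈ ball q ρ, U1 x = 0) → (∀ x ∈ ball q ρ, U2 x = 0) →
      (∀ x ∈ ball (0 : Euc n) N, 0 < U1 x → NearHarm κ U1 x) →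
      (∀ x ∈ ball (0 : Euc n) N, 0 < U2 x → NearHarm κ U2 x) →
      4 * θ ≤ U1 e * U2 (-e) →
      ∃ x ∈ ball (0 : Euc n) N, ∃ y ∈ ball (0 : Euc n) N, 1 / N ≤ ‖x - y‖ ∧
        (1 + κ) * θ * ‖x - y‖ ^ 2 < U1 x * U2 y := by
  obtain ⟨N, hN, h⟩ := improve_aux n ρ hρ hρ1
  refine ⟨N, hN, fun θ0 L hθ0 hL => ?_⟩
  obtain ⟨κ, hκ, h⟩ := h θ0 L hθ0 hL
  refine ⟨κ, hκ, ?_⟩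
  intro e q U1 U2 θ he hθ hc1 hc2 hn1 hn2 hL1 hL2 hq hqe hz1 hz2 hH1 hH2 hstart
  rcases le_abs.1 hqe with hqe | hqe
  · exact h e q U1 U2 θ he hθ hc1 hc2 hn1 hn2 hL1 hL2 hq hqe hz1 hH1 hH2 hstart
  · obtain ⟨x, hx, y, hy, h1, h2⟩ := h (-e) q U2 U1 θ (by simpa using he) hθ hc2 hc1 hn2 hn1 hL2 hL1
      hq (by simpa using hqe) hz2 hH2 hH1 (by rw [neg_neg, mul_comm (U2 (-e))]; exact hstart)
    refine ⟨y, hy, x, hx, ?_, ?_⟩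
    · rwa [norm_sub_rev]
    · rw [norm_sub_rev, mul_comm (U1 y)]; exact h2

end

section

variable {n : ℕ}

local notation "⟪" x ", " y "⟫" => inner ℝ x y

/-- unit vectors -/
abbrev eb (i : Fin n) : Euc n := EuclideanSpace.single i (1 : ℝ)

theorem eb_expand (x : Euc n) : x = ∑ i, x i • eb i := by
  have := (EuclideanSpace.basisFun (Fin n) ℝ).sum_repr x
  simpa using this.symm

theorem bilin_expand (D : Euc n →L[ℝ] Euc n →L[ℝ] ℝ) (x y : Euc n) :
    D x y = ∑ i, ∑ j, x i * y j * D (eb i) (eb j) := by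
  conv_lhs => rw [eb_expand x, eb_expand y]
  simp only [map_sum, map_smul, ContinuousLinearMap.sum_apply, ContinuousLinearMap.smul_apply,
    smul_eq_mul, Finset.mul_sum]
  rw [Finset.sum_comm]
  exact Finset.sum_congr rfl fun i _ => Finset.sum_congr rfl fun j _ => by ring

theorem gram_decomp (B R : Matrix (Fin n) (Fin n) ℝ) (h : ∀ i j, B i j = ∑ k, R k i * R k j)
    (D : Euc n →L[ℝ] Euc n →L[ℝ] ℝ) :
    ∑ i, ∑ j, B i j * D (eb j) (eb i) = ∑ k, D (WithLp.toLp 2 (R k)) (WithLp.toLp 2 (R k)) := by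
  have h1 : ∀ k, D (WithLp.toLp 2 (R k)) (WithLp.toLp 2 (R k)) =
      ∑ i, ∑ j, R k i * R k j * D (eb j) (eb i) := by
    intro k
    rw [bilin_expand, Finset.sum_comm]
    exact Finset.sum_congr rfl fun i _ => Finset.sum_congr rfl fun j _ => by ring
  simp only [h1, h, Finset.sum_mul]
  rw [Finset.sum_comm' (t' := Finset.univ) (s' := fun _ => Finset.univ) (by simp)]
  rw [Finset.sum_comm (s := Finset.univ (α := Fin n)) (t := Finset.univ)]
  conv_rhs => rw [Finset.sum_comm]
  refine Finset.sum_congr rfl fun i _ => ?_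
  rw [Finset.sum_comm]

theorem psd_of_form (B : Matrix (Fin n) (Fin n) ℝ) (hs : ∀ i j, B i j = B j i)
    (hp : ∀ ζ : Fin n → ℝ, 0 ≤ ∑ i, ∑ j, B i j * ζ i * ζ j) : B.PosSemidef := by
  refine Matrix.PosSemidef.of_dotProduct_mulVec_nonneg ?_ ?_
  · ext i j; simp [hs]
  · intro ζ
    have e : dotProduct (star ζ) (B.mulVec ζ) = ∑ i, ∑ j, B i j * ζ i * ζ j := by
      unfold dotProduct
      refine Finset.sum_congr rfl fun i _ => ?_
      rw [Matrix.mulVec, dotProduct, Finset.mul_sum]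
      exact Finset.sum_congr rfl fun j _ => by simp; ring
    rw [e]
    exact hp ζ

open scoped MatrixOrder in
theorem exists_sqrt (B : Matrix (Fin n) (Fin n) ℝ) (hs : ∀ i j, B i j = B j i)
    (hp : ∀ ζ : Fin n → ℝ, 0 ≤ ∑ i, ∑ j, B i j * ζ i * ζ j) :
    ∃ R : Matrix (Fin n) (Fin n) ℝ, (∀ i j, R i j = R j i) ∧ ∀ i j, B i j = ∑ k, R k i * R k j := by
  have hB := psd_of_form B hs hp
  set R := CFC.sqrt B with hR
  have hRR : R * R = B := CFC.sqrt_mul_sqrt_self B hB.nonneg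
  have hRp : R.PosSemidef := Matrix.nonneg_iff_posSemidef.1 (CFC.sqrt_nonneg B)
  have hRs : ∀ i j, R i j = R j i := by
    intro i j
    have := hRp.1.apply i j
    simpa using this.symm
  refine ⟨R, hRs, ?_⟩
  intro i j
  rw [← hRR, Matrix.mul_apply]
  exact Finset.sum_congr rfl fun k _ => by rw [hRs i k]

theorem psd_decomp (B : Matrix (Fin n) (Fin n) ℝ) (hs : ∀ i j, B i j = B j i)
    (hp : ∀ ζ : Fin n → ℝ, 0 ≤ ∑ i, ∑ j, B i j * ζ i * ζ j) :
    ∃ ρ : Fin n → Euc n, (∀ D : Euc n →L[ℝ] Euc n →L[ℝ] ℝ,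
      ∑ i, ∑ j, B i j * D (eb j) (eb i) = ∑ k, D (ρ k) (ρ k)) ∧
      (∀ ζ : Euc n, ∑ k, ⟪ζ, ρ k⟫ ^ 2 = ∑ i, ∑ j, B i j * ζ i * ζ j) ∧
      ∑ k, ‖ρ k‖ ^ 2 = ∑ i, B i i := by
  obtain ⟨R, hRs, h⟩ := exists_sqrt B hs hp
  refine ⟨fun k => WithLp.toLp 2 (R k), gram_decomp B R h, ?_, ?_⟩
  · intro ζ
    have h1 : ∀ k, ⟪ζ, WithLp.toLp 2 (R k)⟫ ^ 2 = ∑ i, ∑ j, R k i * R k j * ζ i * ζ j := by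
      intro k
      rw [sq, PiLp.inner_apply, Finset.sum_mul_sum]
      refine Finset.sum_congr rfl fun i _ => Finset.sum_congr rfl fun j _ => ?_
      simp; ring
    simp only [h1, h, Finset.sum_mul]
    rw [Finset.sum_comm]
    refine Finset.sum_congr rfl fun i _ => ?_
    rw [Finset.sum_comm]
  · simp only [h, EuclideanSpace.real_norm_sq_eq]
    rw [Finset.sum_comm]
    exact Finset.sum_congr rfl fun i _ => Finset.sum_congr rfl fun j _ => by ring

theorem basis_indep (D : Euc n →L[ℝ] Euc n →L[ℝ] ℝ) (b : OrthonormalBasis (Fin n) ℝ (Euc n)) :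
    ∑ i, D (b i) (b i) = ∑ i, D (eb i) (eb i) := by
  have h : ∀ i j : Fin n, ∑ k, (b k) i * (b k) j = if i = j then 1 else 0 := by
    intro i j
    have := b.sum_inner_mul_inner (eb i) (eb j)
    simp [EuclideanSpace.inner_single_left, EuclideanSpace.inner_single_right] at this
    rw [this]
    simp [eq_comm]
  have h1 : ∀ k, D (b k) (b k) = ∑ i, ∑ j, (b k) i * (b k) j * D (eb i) (eb j) :=
    fun k => bilin_expand D _ _
  simp only [h1]
  rw [Finset.sum_comm]
  refine Finset.sum_congr rfl fun i _ => ?_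
  rw [Finset.sum_comm]
  simp only [← Finset.sum_mul, h]
  simp

theorem sqrt_decomp (B : Matrix (Fin n) (Fin n) ℝ) (hs : ∀ i j, B i j = B j i)
    (hp : ∀ ζ : Fin n → ℝ, 0 ≤ ∑ i, ∑ j, B i j * ζ i * ζ j) :
    ∃ S : Euc n →L[ℝ] Euc n, (∀ ζ : Euc n, ‖S ζ‖ ^ 2 = ∑ i, ∑ j, B i j * ζ i * ζ j) ∧
      ∀ (b : OrthonormalBasis (Fin n) ℝ (Euc n)) (D : Euc n →L[ℝ] Euc n →L[ℝ] ℝ),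
      ∑ i, ∑ j, B i j * D (eb j) (eb i) = ∑ k, D (S (b k)) (S (b k)) := by
  obtain ⟨R, hRs, h⟩ := exists_sqrt B hs hp
  set S : Euc n →L[ℝ] Euc n := (Matrix.toEuclideanLin R).toContinuousLinearMap with hS
  have hSa : ∀ ζ : Euc n, ∀ k, (S ζ) k = ∑ i, R k i * ζ i := by
    intro ζ k
    simp [hS, Matrix.toLpLin_apply, Matrix.mulVec, dotProduct]
  refine ⟨S, ?_, ?_⟩
  · intro ζ
    have h1 : ∀ k, (S ζ) k ^ 2 = ∑ i, ∑ j, R k i * R k j * ζ i * ζ j := by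
      intro k
      rw [hSa, sq, Finset.sum_mul_sum]
      exact Finset.sum_congr rfl fun i _ => Finset.sum_congr rfl fun j _ => by ring
    rw [EuclideanSpace.real_norm_sq_eq]
    simp only [h1, h, Finset.sum_mul]
    rw [Finset.sum_comm]
    refine Finset.sum_congr rfl fun i _ => ?_
    rw [Finset.sum_comm]
  · intro b D
    rw [gram_decomp B R h D]
    have := basis_indep ((D.bilinearComp S S)) b
    simp only [ContinuousLinearMap.bilinearComp_apply] at this
    rw [this]
    have hk : ∀ k, S (eb k) = WithLp.toLp 2 (R k) := by
      intro k
      ext i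
      rw [hSa]
      simp [hRs k i]
    simp only [hk]

end

section

variable {n : ℕ}

local notation "⟪" x ", " y "⟫" => inner ℝ x y

structure Hyp (lam K m : ℝ) (Ω : Set (Euc n)) (u : Euc n → ℝ)
    (a : Euc n → Fin n → Fin n → ℝ) (f : Euc n → ℝ) : Prop where
  hlam : 0 < lam
  hK : 0 < K
  hm : 0 < m
  opn : IsOpen Ω
  cont : ContinuousOn u (closure Ω ∩ ball 0 1)
  smooth : ContDiffOn ℝ 2 u (Ω ∩ ball 0 1)
  zero : ∀ x ∈ frontier Ω ∩ ball 0 1, u x = 0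
  pos : ∀ x ∈ Ω ∩ ball 0 1, 0 < u x
  orig : (0 : Euc n) ∈ frontier Ω
  grad : ∀ x ∈ Ω ∩ ball 0 1, ‖gradient u x‖ ≤ 1
  nondeg : ∀ x ∈ closure Ω ∩ ball 0 1, ∀ r : ℝ, 0 < r → r < 1 →
          ∀ ε : ℝ, 0 < ε → ∃ y ∈ ball x r ∩ Ω ∩ ball 0 1, m * r - ε < u y
  eqn : ∀ x ∈ Ω ∩ ball 0 1, ∑ i : Fin n, ∑ j : Fin n, a x i j * secondDeriv u i j x = f x
  symm : ∀ x : Euc n, ∀ i j : Fin n, a x i j = a x j i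
  ell : ∀ x : Euc n, ∀ ξ : Fin n → ℝ,
          lam * ∑ i : Fin n, ξ i ^ 2 ≤ ∑ i : Fin n, ∑ j : Fin n, a x i j * ξ i * ξ j ∧
          ∑ i : Fin n, ∑ j : Fin n, a x i j * ξ i * ξ j ≤ lam⁻¹ * ∑ i : Fin n, ξ i ^ 2
  lip : ∀ i j : Fin n, LipschitzWith 1 (fun x => a x i j)
  fb : ∃ Cf Lf : ℝ≥0, (∀ x ∈ Ω ∩ ball 0 1, |f x| ≤ Cf) ∧
          LipschitzOnWith Lf f (Ω ∩ ball 0 1) ∧ (Cf : ℝ) + (Lf : ℝ) ≤ 1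
  clean : ∀ x ∈ frontier Ω ∩ ball 0 1, InnerCleanBallAt K Ω x ∧ OuterCleanBallAt K Ω x

variable {lam K m : ℝ} {Ω : Set (Euc n)} {u : Euc n → ℝ}
    {a : Euc n → Fin n → Fin n → ℝ} {f : Euc n → ℝ}

namespace Hyp

theorem cda (h : Hyp lam K m Ω u a f) {x : Euc n} (hx : x ∈ Ω) (hx1 : ‖x‖ < 1) :
    ContDiffAt ℝ 2 u x :=
  h.smooth.contDiffAt ((h.opn.inter isOpen_ball).mem_nhds ⟨hx, by simpa using hx1⟩)

theorem f_le (h : Hyp lam K m Ω u a f) {x : Euc n} (hx : x ∈ Ω) (hx1 : ‖x‖ < 1) : |f x| ≤ 1 := by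
  obtain ⟨Cf, Lf, h1, -, h2⟩ := h.fb
  have := h1 x ⟨hx, by simpa using hx1⟩
  have := Lf.2
  simp only [NNReal.val_eq_coe] at this
  linarith

theorem eqn' (h : Hyp lam K m Ω u a f) {x : Euc n} (hx : x ∈ Ω) (hx1 : ‖x‖ < 1) :
    ∑ i, ∑ j, a x i j * fderiv ℝ (fderiv ℝ u) x (eb j) (eb i) = f x := by
  rw [← h.eqn x ⟨hx, by simpa using hx1⟩]
  refine Finset.sum_congr rfl fun i _ => Finset.sum_congr rfl fun j _ => ?_
  congr 1
  have hd : DifferentiableAt ℝ (fderiv ℝ u) x :=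
    ((h.cda hx hx1).fderiv_right (m := 1) (by norm_num)).differentiableAt (by norm_num)
  rw [secondDeriv, fderiv_clm_apply hd (differentiableAt_const _)]
  simp

theorem diag_le (h : Hyp lam K m Ω u a f) (x : Euc n) (i : Fin n) : a x i i ≤ lam⁻¹ := by
  have := (h.ell x (Pi.single i 1)).2
  simpa [Pi.single_apply] using this

theorem diag_nonneg (h : Hyp lam K m Ω u a f) (x : Euc n) (i : Fin n) : 0 ≤ a x i i := by
  have := (h.ell x (Pi.single i 1)).1
  have hl := h.hlam
  simp [Pi.single_apply] at this
  linarith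

theorem form_nonneg (h : Hyp lam K m Ω u a f) (x : Euc n) (ζ : Fin n → ℝ) :
    0 ≤ ∑ i, ∑ j, a x i j * ζ i * ζ j := by
  refine le_trans ?_ (h.ell x ζ).1
  have := h.hlam
  positivity

theorem vecs (h : Hyp lam K m Ω u a f) {x : Euc n} (hx : x ∈ Ω) (hx1 : ‖x‖ < 1) :
    ∃ ρ : Fin n → Euc n, (∀ ζ : Euc n, lam * ‖ζ‖ ^ 2 ≤ ∑ k, ⟪ζ, ρ k⟫ ^ 2) ∧
      ∑ k, ‖ρ k‖ ^ 2 ≤ n * lam⁻¹ ∧ |∑ k, fderiv ℝ (fderiv ℝ u) x (ρ k) (ρ k)| ≤ 1 := by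
  obtain ⟨ρ, h1, h2, h3⟩ := psd_decomp (a x) (h.symm x) (h.form_nonneg x)
  refine ⟨ρ, ?_, ?_, ?_⟩
  · intro ζ
    rw [h2, EuclideanSpace.real_norm_sq_eq]
    exact (h.ell x ζ).1
  · rw [h3]
    calc _ ≤ ∑ i : Fin n, lam⁻¹ := Finset.sum_le_sum fun i _ => h.diag_le x i
      _ = _ := by simp
  · rw [← h1, h.eqn' hx hx1]
    exact h.f_le hx hx1

theorem exists_S (h : Hyp lam K m Ω u a f) : ∃ S : Euc n ≃L[ℝ] Euc n,
    (∀ ζ, lam * ‖ζ‖ ^ 2 ≤ ‖S ζ‖ ^ 2) ∧ (∀ ζ, ‖S ζ‖ ^ 2 ≤ lam⁻¹ * ‖ζ‖ ^ 2) ∧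
    ∀ (b : OrthonormalBasis (Fin n) ℝ (Euc n)) (D : Euc n →L[ℝ] Euc n →L[ℝ] ℝ),
      ∑ i, ∑ j, a 0 i j * D (eb j) (eb i) = ∑ k, D (S (b k)) (S (b k)) := by
  obtain ⟨S, h1, h2⟩ := sqrt_decomp (a 0) (h.symm 0) (h.form_nonneg 0)
  have hl : ∀ ζ, lam * ‖ζ‖ ^ 2 ≤ ‖S ζ‖ ^ 2 := by
    intro ζ
    rw [h1, EuclideanSpace.real_norm_sq_eq]
    exact (h.ell 0 ζ).1
  have hinj : Function.Injective S.toLinearMap := by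
    rw [← LinearMap.ker_eq_bot, LinearMap.ker_eq_bot']
    intro ζ hζ
    have := hl ζ
    have h0 : S ζ = 0 := hζ
    rw [h0, norm_zero] at this
    by_contra hne
    have : 0 < ‖ζ‖ := norm_pos_iff.2 hne
    have := h.hlam
    have : 0 < lam * ‖ζ‖ ^ 2 := by positivity
    linarith
  refine ⟨(LinearEquiv.ofInjectiveEndo S.toLinearMap hinj).toContinuousLinearEquiv, ?_, ?_, ?_⟩
  · intro ζ; exact hl ζ
  · intro ζ
    refine (h1 ζ).le.trans ?_
    rw [EuclideanSpace.real_norm_sq_eq]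
    exact (h.ell 0 ζ).2
  · intro b D; exact h2 b D

end Hyp

theorem sum_abs_sq_le (ζ : Fin n → ℝ) : (∑ i, |ζ i|) ^ 2 ≤ n * ∑ i, ζ i ^ 2 := by
  have := sq_sum_le_card_mul_sum_sq (s := Finset.univ) (f := fun i : Fin n => |ζ i|)
  simpa using this

theorem nearHarm_of (n : ℕ) (lam : ℝ) (hlam : 0 < lam) (κ : ℝ) (hκ : 0 < κ) :
    ∃ δ : ℝ, 0 < δ ∧ ∀ (K m : ℝ) (Ω : Set (Euc n)) (u : Euc n → ℝ)
      (a : Euc n → Fin n → Fin n → ℝ) (f : Euc n → ℝ), Hyp lam K m Ω u a f →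
      ∀ S : Euc n ≃L[ℝ] Euc n, (∀ ζ, lam * ‖ζ‖ ^ 2 ≤ ‖S ζ‖ ^ 2) →
      (∀ (b : OrthonormalBasis (Fin n) ℝ (Euc n)) (D : Euc n →L[ℝ] Euc n →L[ℝ] ℝ),
        ∑ i, ∑ j, a 0 i j * D (eb j) (eb i) = ∑ k, D (S (b k)) (S (b k))) →
      ∀ (p0 y : Euc n) (s c : ℝ) (W : Euc n → ℝ), 0 < s → s ≤ δ →
        p0 + s • S y ∈ Ω → ‖p0 + s • S y‖ < 1 → ‖p0 + s • S y‖ ≤ δ →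
        (∀ᶠ w in 𝓝 y, W w = (u (p0 + s • S w) - c) / s) → NearHarm κ W y := by
  set M : ℝ := n * lam⁻¹ with hM
  have hM0 : 0 ≤ M := by positivity
  set Q : ℝ := lam⁻¹ * (n * (M * lam⁻¹ + 1)) with hQ
  have hQ0 : 0 ≤ Q := by positivity
  refine ⟨min (κ / 2) (min (1 / (M + 1)) (κ / (Q + 1))), by positivity, ?_⟩
  intro K m Ω u a f h S hSl hSD p0 y s c W hs hsδ hz hz1 hzδ hW
  set z := p0 + s • S y with hzdef
  have hs2 : s ≤ κ / 2 := hsδ.trans (min_le_left _ _)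
  have hzM : ‖z‖ ≤ 1 / (M + 1) := hzδ.trans ((min_le_right _ _).trans (min_le_left _ _))
  have hzQ : ‖z‖ ≤ κ / (Q + 1) := hzδ.trans ((min_le_right _ _).trans (min_le_right _ _))
  set t : ℝ := M * ‖z‖ with ht
  have ht0 : 0 ≤ t := by positivity
  have ht1 : t ≤ 1 := by
    rw [le_div_iff₀ (by positivity)] at hzM
    nlinarith [norm_nonneg z]
  have hdiff : ∀ i j, |a z i j - a 0 i j| ≤ ‖z‖ := by
    intro i j
    have := (h.lip i j).dist_le_mul z 0
    simpa [Real.dist_eq] using this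
  set B : Matrix (Fin n) (Fin n) ℝ := fun i j => (1 + t) * a z i j - a 0 i j with hB
  have hBs : ∀ i j, B i j = B j i := by
    intro i j
    simp only [hB]
    rw [h.symm z i j, h.symm 0 i j]
  have hBp : ∀ ζ : Fin n → ℝ, 0 ≤ ∑ i, ∑ j, B i j * ζ i * ζ j := by
    intro ζ
    have e1 : ∑ i, ∑ j, B i j * ζ i * ζ j = t * (∑ i, ∑ j, a z i j * ζ i * ζ j) +
        ∑ i, ∑ j, (a z i j - a 0 i j) * ζ i * ζ j := by
      simp only [Finset.mul_sum, ← Finset.sum_add_distrib]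
      refine Finset.sum_congr rfl fun i _ => Finset.sum_congr rfl fun j _ => ?_
      simp only [hB]; ring
    have e2 : -(‖z‖ * (∑ i, |ζ i|) ^ 2) ≤ ∑ i, ∑ j, (a z i j - a 0 i j) * ζ i * ζ j := by
      rw [sq, Finset.sum_mul_sum, Finset.mul_sum, ← Finset.sum_neg_distrib]
      refine Finset.sum_le_sum fun i _ => ?_
      rw [Finset.mul_sum, ← Finset.sum_neg_distrib]
      refine Finset.sum_le_sum fun j _ => ?_
      have h1 : |(a z i j - a 0 i j) * ζ i * ζ j| ≤ ‖z‖ * (|ζ i| * |ζ j|) := by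
        rw [abs_mul, abs_mul, mul_assoc]
        gcongr
        exact hdiff i j
      exact (abs_le.1 h1).1
    have e3 := mul_le_mul_of_nonneg_left (h.ell z ζ).1 ht0
    have e4 := mul_le_mul_of_nonneg_left (sum_abs_sq_le ζ) (norm_nonneg z)
    have e5 : t * (lam * ∑ i, ζ i ^ 2) = ‖z‖ * (n * ∑ i, ζ i ^ 2) := by
      rw [ht, hM]; field_simp
    linarith
  obtain ⟨ρ, r1, r2, r3⟩ := psd_decomp B hBs hBp
  set D := fderiv ℝ (fderiv ℝ u) z with hD
  refine ⟨fun ξ => s⁻¹ * (fderiv ℝ u z (s • S ξ)), fun ξ => s⁻¹ * (D (s • S ξ) (s • S ξ)), ?_,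
    fun k => S.symm (ρ k), ?_, ?_⟩
  · intro ξ
    have h1 := ((J2.ofContDiffAt (h.cda hz hz1) (s • S ξ)).sub (J2.const c)).const_mul s⁻¹
    refine (h1.congr' ?_).cast (by simp) (by simp [hD])
    have ht : Filter.Tendsto (fun t : ℝ => y + t • ξ) (𝓝 0) (𝓝 y) := by
      have : ContinuousAt (fun t : ℝ => y + t • ξ) 0 := by fun_prop
      simpa using this.tendsto
    filter_upwards [ht.eventually hW] with t hWt
    rw [hWt, div_eq_inv_mul, hzdef]
    congr 3
    rw [map_add, map_smul]; module
  · have h1 : ∀ k, ‖S.symm (ρ k)‖ ^ 2 ≤ lam⁻¹ * ‖ρ k‖ ^ 2 := by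
      intro k
      have := hSl (S.symm (ρ k))
      rw [ContinuousLinearEquiv.apply_symm_apply] at this
      rw [inv_mul_eq_div, le_div_iff₀ hlam]; linarith
    have h2 : ∑ i, B i i ≤ n * ((M * lam⁻¹ + 1) * ‖z‖) := by
      calc _ ≤ ∑ i : Fin n, (M * lam⁻¹ + 1) * ‖z‖ := Finset.sum_le_sum fun i _ => by
            have d1 := (abs_le.1 (hdiff i i)).2
            have d2 := mul_le_mul_of_nonneg_left (h.diag_le z i) ht0
            simp only [hB]
            rw [ht] at d2 ⊢
            linarith
        _ = _ := by simp
    calc ∑ k, ‖S.symm (ρ k)‖ ^ 2 ≤ ∑ k, lam⁻¹ * ‖ρ k‖ ^ 2 := Finset.sum_le_sum fun k _ => h1 k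
      _ = lam⁻¹ * ∑ i, B i i := by rw [← Finset.mul_sum, r3]
      _ ≤ lam⁻¹ * (n * ((M * lam⁻¹ + 1) * ‖z‖)) := by gcongr
      _ = Q * ‖z‖ := by rw [hQ]; ring
      _ ≤ (Q + 1) * (κ / (Q + 1)) := by gcongr; linarith
      _ = κ := by field_simp
  · intro b
    have h1 : ∀ ζ : Euc n, s⁻¹ * (D (s • ζ) (s • ζ)) = s * D ζ ζ := by
      intro ζ
      simp only [map_smul, ContinuousLinearMap.smul_apply, smul_eq_mul]
      field_simp
    simp only [h1, ContinuousLinearEquiv.apply_symm_apply]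
    rw [← Finset.mul_sum, ← Finset.mul_sum, ← r1 D, ← hSD b D, ← mul_add]
    have h2 : ∑ i, ∑ j, a 0 i j * D (eb j) (eb i) + ∑ i, ∑ j, B i j * D (eb j) (eb i)
        = (1 + t) * f z := by
      rw [← h.eqn' hz hz1, Finset.mul_sum, ← Finset.sum_add_distrib]
      refine Finset.sum_congr rfl fun i _ => ?_
      rw [Finset.mul_sum, ← Finset.sum_add_distrib]
      refine Finset.sum_congr rfl fun j _ => ?_
      simp only [hB]; ring
    rw [h2]
    have h3 := (abs_le.1 (h.f_le hz hz1)).1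
    have h4 : -2 ≤ (1 + t) * f z := by nlinarith
    nlinarith

end

section

variable {n : ℕ}

local notation "⟪" x ", " y "⟫" => inner ℝ x y

/-- First exit from an open set along a segment. -/
theorem first_exit {A : Set (Euc n)} (hA : IsOpen A) {x y : Euc n} (hx : x ∈ A)
    (hne : ∃ t ∈ Icc (0:ℝ) 1, x + t • (y - x) ∉ A) :
    ∃ t ∈ Ioc (0:ℝ) 1, x + t • (y - x) ∉ A ∧ x + t • (y - x) ∈ closure A ∧
      ∀ s ∈ Ico (0:ℝ) t, x + s • (y - x) ∈ A := by
  set γ : ℝ → Euc n := fun t => x + t • (y - x) with hγ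
  have hγc : Continuous γ := by fun_prop
  set T : Set ℝ := Icc 0 1 ∩ γ ⁻¹' Aᶜ with hT
  have hTc : IsCompact T := isCompact_Icc.inter_right (hA.isClosed_compl.preimage hγc)
  obtain ⟨t1, ht1, ht1A⟩ := hne
  obtain ⟨t, ht, hmin⟩ := hTc.exists_isLeast ⟨t1, ht1, ht1A⟩
  have hs : ∀ s ∈ Ico (0:ℝ) t, γ s ∈ A := by
    intro s hs
    by_contra hsA
    have := hmin ⟨⟨hs.1, (hs.2.le).trans ht.1.2⟩, hsA⟩
    linarith [hs.2]
  have ht0 : 0 < t := by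
    rcases ht.1.1.lt_or_eq with h | h
    · exact h
    · exfalso; apply ht.2; rw [← h]; simpa [hγ] using hx
  refine ⟨t, ⟨ht0, ht.1.2⟩, ht.2, ?_, hs⟩
  have h1 : γ t ∈ closure (γ '' Ico 0 t) := by
    refine hγc.continuousWithinAt.mem_closure_image ?_
    rw [closure_Ico ht0.ne]; exact ⟨ht0.le, le_rfl⟩
  exact closure_mono (by rintro _ ⟨s, hs', rfl⟩; exact hs s hs') h1

variable {lam K m : ℝ} {Ω : Set (Euc n)} {u : Euc n → ℝ}
    {a : Euc n → Fin n → Fin n → ℝ} {f : Euc n → ℝ}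

namespace Hyp

theorem w_nonneg (h : Hyp lam K m Ω u a f) {x : Euc n} (hx : ‖x‖ < 1) : 0 ≤ Ω.indicator u x := by
  by_cases hxΩ : x ∈ Ω
  · rw [indicator_of_mem hxΩ]
    exact (h.pos x ⟨hxΩ, by simpa using hx⟩).le
  · rw [indicator_of_notMem hxΩ]

theorem mem_of_w_pos (_h : Hyp lam K m Ω u a f) {x : Euc n} (hx : 0 < Ω.indicator u x) : x ∈ Ω := by
  by_contra hxΩ
  rw [indicator_of_notMem hxΩ] at hx
  exact lt_irrefl _ hx

theorem lip_seg (h : Hyp lam K m Ω u a f) {x y : Euc n}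
    (hs : ∀ z ∈ segment ℝ x y, z ∈ Ω ∧ ‖z‖ < 1) : u x - u y ≤ ‖x - y‖ := by
  have := Convex.norm_image_sub_le_of_norm_fderiv_le (𝕜 := ℝ) (f := u) (s := segment ℝ x y) (C := 1)
    (x := y) (y := x)
    (fun z hz => (h.cda (hs z hz).1 (hs z hz).2).differentiableAt (by norm_num))
    (fun z hz => by
      have := h.grad z ⟨(hs z hz).1, by simpa using (hs z hz).2⟩
      rwa [gradient, LinearIsometryEquiv.norm_map] at this)
    (convex_segment x y) (right_mem_segment ℝ x y) (left_mem_segment ℝ x y)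
  rw [one_mul] at this
  exact (le_abs_self _).trans this

theorem seg_norm {x y z : Euc n} (hx : ‖x‖ < 1) (hy : ‖y‖ < 1) (hz : z ∈ segment ℝ x y) : ‖z‖ < 1 := by
  have := (convex_ball (0 : Euc n) 1).segment_subset (by simpa using hx) (by simpa using hy) hz
  simpa using this

theorem w_lip (h : Hyp lam K m Ω u a f) {x y : Euc n} (hx : ‖x‖ < 1) (hy : ‖y‖ < 1) :
    Ω.indicator u x - Ω.indicator u y ≤ ‖x - y‖ := by
  have hy0 := h.w_nonneg hy
  by_cases hxΩ : x ∈ Ω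
  swap
  · rw [indicator_of_notMem hxΩ]
    have := norm_nonneg (x - y)
    linarith
  by_cases hne : ∃ t ∈ Icc (0:ℝ) 1, x + t • (y - x) ∉ Ω
  · obtain ⟨t, ht, htΩ, htc, hs⟩ := first_exit h.opn hxΩ hne
    rw [indicator_of_mem hxΩ]
    suffices hh : u x ≤ ‖x - y‖ by linarith
    set γ : ℝ → Euc n := fun t => x + t • (y - x) with hγ
    have hγc : Continuous γ := by fun_prop
    have hseg : ∀ s ∈ Icc (0:ℝ) 1, γ s ∈ segment ℝ x y := by
      intro s hs
      rw [segment_eq_image']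
      exact ⟨s, hs, rfl⟩
    have hn1 : ∀ s ∈ Icc (0:ℝ) 1, ‖γ s‖ < 1 := fun s hs => seg_norm hx hy (hseg s hs)
    have hfr : γ t ∈ frontier Ω := by
      rw [h.opn.frontier_eq]; exact ⟨htc, htΩ⟩
    have hb : ∀ s ∈ Ico (0:ℝ) t, u x - ‖x - y‖ ≤ u (γ s) := by
      intro s hs'
      have hs1 : s ≤ 1 := hs'.2.le.trans ht.2
      have h1 : u x - u (γ s) ≤ ‖x - γ s‖ := by
        refine h.lip_seg ?_
        intro z hz
        rw [segment_eq_image'] at hz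
        obtain ⟨r, hr, rfl⟩ := hz
        have e : x + r • (γ s - x) = γ (r * s) := by
          simp only [hγ]; module
        simp only
        rw [e]
        have h0 : 0 ≤ r * s := mul_nonneg hr.1 hs'.1
        have h1 : r * s ≤ s := by nlinarith [hr.2, hs'.1]
        exact ⟨hs _ ⟨h0, lt_of_le_of_lt h1 hs'.2⟩, hn1 _ ⟨h0, h1.trans hs1⟩⟩
      have h2 : ‖x - γ s‖ ≤ ‖x - y‖ := by
        have : x - γ s = s • (x - y) := by simp only [hγ]; module
        rw [this, norm_smul, Real.norm_of_nonneg hs'.1]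
        nlinarith [norm_nonneg (x - y)]
      linarith
    have hct : ContinuousWithinAt (fun s => u (γ s)) (Ico 0 t) t := by
      have h1 : ContinuousWithinAt u (closure Ω ∩ ball 0 1) (γ t) :=
        h.cont _ ⟨htc, by simpa using hn1 t ⟨ht.1.le, ht.2⟩⟩
      refine h1.comp hγc.continuousWithinAt ?_
      intro s hs'
      exact ⟨subset_closure (hs s hs'), by simpa using hn1 s ⟨hs'.1, hs'.2.le.trans ht.2⟩⟩
    have hz := h.zero (γ t) ⟨hfr, by simpa using hn1 t ⟨ht.1.le, ht.2⟩⟩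
    have hcl : t ∈ closure (Ico 0 t) := by
      rw [closure_Ico ht.1.ne]; exact ⟨ht.1.le, le_rfl⟩
    haveI : (𝓝[Ico 0 t] t).NeBot := mem_closure_iff_nhdsWithin_neBot.1 hcl
    have : u x - ‖x - y‖ ≤ u (γ t) := ge_of_tendsto hct (Filter.eventually_of_mem self_mem_nhdsWithin hb)
    rw [hz] at this
    linarith
  · push Not at hne
    have hyΩ : y ∈ Ω := by simpa using hne 1 ⟨by norm_num, by norm_num⟩
    rw [indicator_of_mem hxΩ, indicator_of_mem hyΩ]
    refine h.lip_seg ?_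
    intro z hz
    refine ⟨?_, seg_norm hx hy hz⟩
    rw [segment_eq_image'] at hz
    obtain ⟨r, hr, rfl⟩ := hz
    exact hne r hr

theorem fr_ne (h : Hyp lam K m Ω u a f) : (frontier Ω).Nonempty := ⟨0, h.orig⟩

theorem d_le (h : Hyp lam K m Ω u a f) (x : Euc n) : infDist x (frontier Ω) ≤ ‖x‖ := by
  have := infDist_le_dist_of_mem (x := x) h.orig
  simpa using this

theorem d_pos (h : Hyp lam K m Ω u a f) {x : Euc n} (hx : x ∈ Ω) : 0 < infDist x (frontier Ω) := by
  rw [← isClosed_frontier.notMem_iff_infDist_pos h.fr_ne, h.opn.frontier_eq]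
  exact fun hh => hh.2 hx

theorem ball_sub (h : Hyp lam K m Ω u a f) {x y : Euc n} (hx : x ∈ Ω)
    (hy : ‖y - x‖ < infDist x (frontier Ω)) : y ∈ Ω := by
  by_contra hyΩ
  obtain ⟨t, ht, htΩ, htc, -⟩ := first_exit h.opn (y := y) hx ⟨1, ⟨by norm_num, le_rfl⟩, by simpa using hyΩ⟩
  have hfr : x + t • (y - x) ∈ frontier Ω := by
    rw [h.opn.frontier_eq]; exact ⟨htc, htΩ⟩
  have := infDist_le_dist_of_mem (x := x) hfr
  rw [dist_self_add_right, norm_smul, Real.norm_of_nonneg ht.1.le] at this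
  nlinarith [ht.2, norm_nonneg (y - x)]

theorem nearest (h : Hyp lam K m Ω u a f) (x : Euc n) :
    ∃ z ∈ frontier Ω, infDist x (frontier Ω) = ‖x - z‖ := by
  obtain ⟨z, hz, he⟩ := isClosed_frontier.exists_infDist_eq_dist h.fr_ne x
  exact ⟨z, hz, by rw [he, dist_eq_norm]⟩

theorem not_mem_of_fr (h : Hyp lam K m Ω u a f) {z : Euc n} (hz : z ∈ frontier Ω) : z ∉ Ω := by
  rw [h.opn.frontier_eq] at hz; exact hz.2

theorem w_le_of_not (h : Hyp lam K m Ω u a f) {x z : Euc n} (hx : ‖x‖ < 1) (hz1 : ‖z‖ < 1) (hz : z ∉ Ω) :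
    Ω.indicator u x ≤ ‖x - z‖ := by
  have := h.w_lip hx hz1
  rwa [indicator_of_notMem hz, sub_zero] at this

theorem u_le_d (h : Hyp lam K m Ω u a f) {x : Euc n} (hx : x ∈ Ω) (hx1 : ‖x‖ < 1 / 2) :
    u x ≤ infDist x (frontier Ω) := by
  obtain ⟨z, hz, he⟩ := h.nearest x
  have h1 := h.d_le x
  have hz1 : ‖z‖ < 1 := by
    have := norm_sub_norm_le z x
    rw [norm_sub_rev] at this
    linarith
  have := h.w_le_of_not (x := x) (by linarith) hz1 (h.not_mem_of_fr hz)
  rwa [indicator_of_mem hx, ← he] at this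

theorem jetv (h : Hyp lam K m Ω u a f) {x y : Euc n} {s α β : ℝ} (hz : x + s • y ∈ Ω)
    (hz1 : ‖x + s • y‖ < 1) :
    ∃ p X : Euc n → ℝ, (∀ ξ, J2 (fun t => α + β * Ω.indicator u (x + s • (y + t • ξ))) (p ξ) (X ξ)) ∧
      ∃ ξ : Fin n → Euc n, (∀ ζ : Euc n, lam * ‖ζ‖ ^ 2 ≤ ∑ k, ⟪ζ, ξ k⟫ ^ 2) ∧
        ∑ k, ‖ξ k‖ ^ 2 ≤ n * lam⁻¹ ∧ ∑ k, X (ξ k) ≤ |β| * s ^ 2 := by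
  obtain ⟨ρ, h1, h2, h3⟩ := h.vecs hz hz1
  set z := x + s • y with hzdef
  set D := fderiv ℝ (fderiv ℝ u) z with hD
  refine ⟨fun ξ => β * fderiv ℝ u z (s • ξ), fun ξ => β * D (s • ξ) (s • ξ), ?_, ρ, h1, h2, ?_⟩
  · intro ξ
    have h1 := (J2.const α).add ((J2.ofContDiffAt (h.cda hz hz1) (s • ξ)).const_mul β)
    refine (h1.congr' ?_).cast (by simp) (by simp [hD])
    have ht : Filter.Tendsto (fun t : ℝ => x + s • (y + t • ξ)) (𝓝 0) (𝓝 z) := by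
      have : ContinuousAt (fun t : ℝ => x + s • (y + t • ξ)) 0 := by fun_prop
      simpa using this.tendsto
    filter_upwards [ht.eventually (h.opn.mem_nhds hz)] with t ht
    rw [indicator_of_mem ht, hzdef]
    congr 3
    module
  · have e : ∑ k, β * D (s • ρ k) (s • ρ k) = β * s ^ 2 * ∑ k, D (ρ k) (ρ k) := by
      rw [Finset.mul_sum]
      refine Finset.sum_congr rfl fun k _ => ?_
      simp only [map_smul, ContinuousLinearMap.smul_apply, smul_eq_mul]; ring
    simp only
    rw [e]
    refine (le_abs_self _).trans ?_
    rw [abs_mul, abs_mul, abs_of_nonneg (sq_nonneg s)]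
    have : 0 ≤ |β| * s ^ 2 := by positivity
    nlinarith

theorem w_contOn (h : Hyp lam K m Ω u a f) {x : Euc n} {s : ℝ}
    (hb : ∀ y ∈ closedBall (0 : Euc n) 1, ‖x + s • y‖ < 1) :
    ContinuousOn (fun y => Ω.indicator u (x + s • y)) (closedBall 0 1) := by
  have hw : ContinuousOn (Ω.indicator u) (ball 0 1) := by
    have : LipschitzOnWith 1 (Ω.indicator u) (ball 0 1) := by
      refine LipschitzOnWith.of_le_add ?_
      intro p hp q hq
      have := h.w_lip (x := p) (y := q) (by simpa using hp) (by simpa using hq)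
      rw [dist_eq_norm]; linarith
    exact this.continuousOn
  refine hw.comp (by fun_prop) ?_
  intro y hy
  simpa using hb y hy

end Hyp

theorem lemmaA (n : ℕ) (lam m : ℝ) (hlam : 0 < lam) (hm : 0 < m) :
    ∃ c0 : ℝ, 0 < c0 ∧ c0 ≤ 1 ∧ ∃ δ0 : ℝ, 0 < δ0 ∧ δ0 ≤ 1 / 4 ∧ ∀ (K : ℝ) (Ω : Set (Euc n)) (u : Euc n → ℝ)
      (a : Euc n → Fin n → Fin n → ℝ) (f : Euc n → ℝ), Hyp lam K m Ω u a f →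
      ∀ x ∈ Ω, ‖x‖ < δ0 → c0 * infDist x (frontier Ω) ≤ u x := by
  obtain ⟨c, hc, κ, hκ, H⟩ := weak_harnack n lam (n * lam⁻¹) (1 / 2) (m / 8) hlam (by norm_num) (by positivity)
  refine ⟨min (c * (m / 16)) 1, by positivity, min_le_right _ _,
    min (1 / 4) (κ * m / 4), by positivity, min_le_left _ _, ?_⟩
  intro K Ω u a f h x hx hxδ
  have hx4 : ‖x‖ < 1 / 4 := hxδ.trans_le (min_le_left _ _)
  have hxκ : ‖x‖ < κ * m / 4 := hxδ.trans_le (min_le_right _ _)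
  set d := infDist x (frontier Ω) with hd
  have hd0 : 0 < d := h.d_pos hx
  have hdx : d ≤ ‖x‖ := h.d_le x
  refine (mul_le_mul_of_nonneg_right (min_le_left _ _) hd0.le).trans ?_
  have hin : ∀ y : Euc n, ‖y‖ ≤ 1 → x + (d / 2) • y ∈ Ω ∧ ‖x + (d / 2) • y‖ < 1 := by
    intro y hy
    have h1 : ‖(d / 2) • y‖ ≤ d / 2 := by
      rw [norm_smul, Real.norm_of_nonneg (by positivity)]; nlinarith
    refine ⟨h.ball_sub hx ?_, (norm_add_le _ _).trans_lt (by linarith)⟩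
    rw [add_sub_cancel_left, ← hd]; linarith
  obtain ⟨y0, ⟨⟨hy0, hy0Ω⟩, hy01⟩, hy0u⟩ := h.nondeg x ⟨subset_closure hx, by simp; linarith⟩ (d / 4)
    (by positivity) (by linarith) (m * d / 8) (by positivity)
  have hy0' : ‖y0 - x‖ < d / 4 := by simpa [dist_eq_norm] using hy0
  have hy01' : ‖y0‖ < 1 := by simpa using hy01
  have key := H (fun y => 0 + 1 * Ω.indicator u (x + (d / 2) • y)) ((2 / d) • (y0 - x)) (m * d / 16)
    (by positivity) ?_ ?_ ?_ ?_ ?_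
  · simp only [smul_zero, add_zero, zero_add, one_mul, indicator_of_mem hx] at key
    linarith
  · rw [norm_smul, Real.norm_of_nonneg (by positivity)]
    calc 2 / d * ‖y0 - x‖ ≤ 2 / d * (d / 4) := by gcongr
      _ = 1 - 1 / 2 := by field_simp; norm_num
  · simp only [zero_add, one_mul]
    exact h.w_contOn fun y hy => (hin y (by simpa using hy)).2
  · intro y hy
    simp only [zero_add, one_mul]
    exact h.w_nonneg (hin y (by simpa using hy)).2
  · intro y hy hy1
    simp only [zero_add, one_mul]
    have h1 := h.w_lip hy01' (hin y (by simpa using hy1)).2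
    rw [indicator_of_mem hy0Ω] at h1
    have h2 : ‖y0 - (x + (d / 2) • y)‖ ≤ d / 2 * (m / 8) := by
      have e : y0 - (x + (d / 2) • y) = (d / 2) • ((2 / d) • (y0 - x) - y) := by
        rw [smul_sub, smul_smul]
        have : d / 2 * (2 / d) = 1 := by field_simp
        rw [this]; module
      rw [e, norm_smul, Real.norm_of_nonneg (by positivity)]
      have : ‖(2 / d) • (y0 - x) - y‖ < m / 8 := by
        rw [norm_sub_rev]; simpa [dist_eq_norm] using hy
      gcongr
    linarith
  · intro y hy
    have hy' : ‖y‖ ≤ 1 := by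
      have : ‖y‖ < 1 := by simpa using hy
      exact this.le
    obtain ⟨p, X, hJ, ξ, h1, h2, h3⟩ := h.jetv (α := 0) (β := 1) (hin y hy').1 (hin y hy').2
    refine ⟨p, X, hJ, ξ, h1, h2, h3.trans ?_⟩
    rw [abs_one, one_mul]
    nlinarith

theorem lemmaB (n : ℕ) (lam m : ℝ) (hlam : 0 < lam) (hm : 0 < m) :
    ∃ c0 : ℝ, 0 < c0 ∧ c0 ≤ 1 ∧ ∃ δ0 : ℝ, 0 < δ0 ∧ δ0 ≤ 1 / 4 ∧ ∀ (K : ℝ) (Ω : Set (Euc n)) (u : Euc n → ℝ)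
      (a : Euc n → Fin n → Fin n → ℝ) (f : Euc n → ℝ), Hyp lam K m Ω u a f →
      ∀ x ∈ Ω, ‖x‖ < δ0 → c0 * infDist x (frontier Ω) ≤ u x ∧
        ∃ y ∈ Ω, ‖y - x‖ < infDist x (frontier Ω) ∧ (1 + c0) * u x ≤ u y := by
  obtain ⟨c0, hc0, hc01, δ0, hδ0, hδ04, HA⟩ := lemmaA n lam m hlam hm
  set ε := c0 / 6 with hε
  have hε0 : 0 < ε := by positivity
  obtain ⟨c, hc, κ, hκ, H⟩ := weak_harnack n lam (n * lam⁻¹) ε ε hlam hε0 hε0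
  refine ⟨min (c / 4) c0, by positivity, (min_le_right _ _).trans hc01,
    min δ0 (κ * c0 / 2), by positivity, (min_le_left _ _).trans hδ04, ?_⟩
  set c1 := min (c / 4) c0 with hc1
  have hc10 : 0 < c1 := by rw [hc1]; positivity
  have hc1c : c1 ≤ c / 4 := min_le_left _ _
  have hc1c0 : c1 ≤ c0 := min_le_right _ _
  intro K Ω u a f h x hx hxδ
  have hxδ0 : ‖x‖ < δ0 := hxδ.trans_le (min_le_left _ _)
  have hx4 : ‖x‖ < 1 / 4 := by linarith
  have hxκ : ‖x‖ < κ * c0 / 2 := hxδ.trans_le (min_le_right _ _)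
  have hA := HA K Ω u a f h x hx hxδ0
  set d := infDist x (frontier Ω) with hd
  have hd0 : 0 < d := h.d_pos hx
  have hdx : d ≤ ‖x‖ := h.d_le x
  refine ⟨(mul_le_mul_of_nonneg_right hc1c0 hd0.le).trans hA, ?_⟩
  by_contra hcon
  push Not at hcon
  set s := (1 - ε) * d with hs
  have hε1 : ε ≤ 1 / 6 := by rw [hε]; linarith
  have hs0 : 0 < s := mul_pos (by linarith) hd0
  have hsd : s < d := by rw [hs]; nlinarith
  have hin' : ∀ y : Euc n, ‖y‖ ≤ 1 → ‖s • y‖ < d := by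
    intro y hy
    rw [norm_smul, Real.norm_of_nonneg hs0.le]; nlinarith
  have hin : ∀ y : Euc n, ‖y‖ ≤ 1 → x + s • y ∈ Ω ∧ ‖x + s • y‖ < 1 := by
    intro y hy
    have h1 := hin' y hy
    refine ⟨h.ball_sub hx ?_, (norm_add_le _ _).trans_lt (by linarith)⟩
    rw [add_sub_cancel_left, ← hd]; linarith
  obtain ⟨z, hz, hze⟩ := h.nearest x
  rw [← hd] at hze
  have hz1 : ‖z‖ < 1 := by
    have := norm_sub_norm_le z x
    rw [norm_sub_rev] at this
    linarith
  have hzΩ := h.not_mem_of_fr hz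
  have hu0 : 0 < u x := h.pos x ⟨hx, by simp; linarith⟩
  have hzx : ‖z - x‖ = d := by rw [norm_sub_rev, hze]
  have key := H (fun y => (1 + c1) * u x + (-1) * Ω.indicator u (x + s • y)) (((1 - ε) / d) • (z - x)) (u x / 2)
    (by positivity) ?_ ?_ ?_ ?_ ?_
  · simp only [smul_zero, add_zero, indicator_of_mem hx] at key
    nlinarith
  · rw [norm_smul, hzx, Real.norm_of_nonneg (by apply div_nonneg _ hd0.le; linarith)]
    rw [div_mul_cancel₀ _ hd0.ne']
  · exact continuousOn_const.add (continuousOn_const.mul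
      (h.w_contOn fun y hy => (hin y (by simpa using hy)).2))
  · intro y hy
    have hy1 : ‖y‖ ≤ 1 := by simpa using hy
    have h1 := hcon (x + s • y) (hin y hy1).1 (by rw [add_sub_cancel_left]; exact hin' y hy1)
    rw [indicator_of_mem (hin y hy1).1]
    linarith
  · intro y hy hy1
    have hy1 : ‖y‖ ≤ 1 := by simpa using hy1
    have h1 := h.w_le_of_not (hin y hy1).2 hz1 hzΩ
    have h2 : ‖x + s • y - z‖ ≤ s * ε + 2 * ε * d := by
      have e : x + s • y - z = s • (y - ((1 - ε) / d) • (z - x)) + ((1 - ε) ^ 2 - 1) • (z - x) := by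
        rw [smul_sub, smul_smul]
        have : s * ((1 - ε) / d) = (1 - ε) ^ 2 := by rw [hs]; field_simp
        rw [this]; module
      rw [e]
      refine (norm_add_le _ _).trans ?_
      rw [norm_smul, norm_smul, Real.norm_of_nonneg hs0.le, hzx]
      have h3 : ‖y - ((1 - ε) / d) • (z - x)‖ < ε := by simpa [dist_eq_norm] using hy
      have h4 : ‖(1 - ε) ^ 2 - 1‖ ≤ 2 * ε := by
        rw [Real.norm_eq_abs, abs_le]; constructor <;> nlinarith
      gcongr
    have h3 : s * ε ≤ d * ε := by gcongr
    have h4 : 3 * ε * d ≤ u x / 2 := by rw [hε]; linarith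
    have := mul_pos hc10 hu0
    linarith
  · intro y hy
    have hy' : ‖y‖ ≤ 1 := by
      have : ‖y‖ < 1 := by simpa using hy
      exact this.le
    obtain ⟨p, X, hJ, ξ, h1, h2, h3⟩ := h.jetv (α := (1 + c1) * u x) (β := -1) (hin y hy').1 (hin y hy').2
    refine ⟨p, X, hJ, ξ, h1, h2, h3.trans ?_⟩
    rw [abs_neg, abs_one, one_mul]
    have e1 : s ^ 2 ≤ d ^ 2 := by gcongr
    have e2 : d ^ 2 ≤ (κ * c0 / 2) * d := by nlinarith
    have e3 : κ / 2 * (c0 * d) ≤ κ / 2 * u x := by gcongr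
    linarith

end

section

variable {n : ℕ}

local notation "⟪" x ", " y "⟫" => inner ℝ x y

structure Comp (Ω : Set (Euc n)) (u : Euc n → ℝ) (ε : ℝ) (P : Euc n) (R : ℝ) (A : Set (Euc n)) : Prop where
  opn : IsOpen A
  sub : A ⊆ Ω
  gt : ∀ z ∈ A, ε < u z
  cl : ∀ z ∈ ball P R, z ∈ closure A → z ∉ A → Ω.indicator u z ≤ ε

variable {lam K m : ℝ} {Ω : Set (Euc n)} {u : Euc n → ℝ}
    {a : Euc n → Fin n → Fin n → ℝ} {f : Euc n → ℝ} {ε R : ℝ} {P : Euc n} {A : Set (Euc n)}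

namespace Comp

theorem nonneg (c : Comp Ω u ε P R A) (x : Euc n) : 0 ≤ A.indicator (fun z => u z - ε) x := by
  refine indicator_nonneg ?_ x
  intro z hz
  have := c.gt z hz
  linarith

theorem mem_of_pos {x : Euc n} (hx : 0 < A.indicator (fun z => u z - ε) x) : x ∈ A := by
  by_contra hh
  rw [indicator_of_notMem hh] at hx
  exact lt_irrefl _ hx

theorem exit (c : Comp Ω u ε P R A) {x y : Euc n} (hx : x ∈ ball P R) (hy : y ∈ ball P R)
    (hxA : x ∈ A) (hyA : ∃ t ∈ Icc (0:ℝ) 1, x + t • (y - x) ∉ A) :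
    ∃ t ∈ Ioc (0:ℝ) 1, x + t • (y - x) ∈ ball P R ∧ x + t • (y - x) ∈ closure A ∧
      Ω.indicator u (x + t • (y - x)) ≤ ε := by
  obtain ⟨t, ht, h1, h2, -⟩ := first_exit c.opn hxA hyA
  have hb : x + t • (y - x) ∈ ball P R := by
    refine (convex_ball P R).segment_subset hx hy ?_
    rw [segment_eq_image']
    exact ⟨t, ⟨ht.1.le, ht.2⟩, rfl⟩
  exact ⟨t, ht, hb, h2, c.cl _ hb h2 h1⟩

theorem lip (c : Comp Ω u ε P R A) (h : Hyp lam K m Ω u a f) (hPR : ‖P‖ + R ≤ 1)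
    {x y : Euc n} (hx : x ∈ ball P R) (hy : y ∈ ball P R) :
    A.indicator (fun z => u z - ε) x - A.indicator (fun z => u z - ε) y ≤ ‖x - y‖ := by
  have hn : ∀ z ∈ ball P R, ‖z‖ < 1 := by
    intro z hz
    have h1 : ‖z - P‖ < R := by simpa [dist_eq_norm] using hz
    have h2 : ‖z‖ ≤ ‖z - P‖ + ‖P‖ := by simpa using norm_add_le (z - P) P
    linarith
  have hy0 := c.nonneg y
  by_cases hxA : x ∈ A
  swap
  · rw [indicator_of_notMem hxA]
    have := norm_nonneg (x - y)
    linarith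
  by_cases hyA : ∃ t ∈ Icc (0:ℝ) 1, x + t • (y - x) ∉ A
  · obtain ⟨t, ht, hb, -, hle⟩ := c.exit hx hy hxA hyA
    have := h.w_lip (hn x hx) (hn _ hb)
    have e : x - (x + t • (y - x)) = t • (x - y) := by module
    rw [indicator_of_mem (c.sub hxA), e, norm_smul, Real.norm_of_nonneg ht.1.le] at this
    rw [indicator_of_mem hxA]
    have := norm_nonneg (x - y)
    nlinarith [ht.2]
  · push Not at hyA
    have hyA' : y ∈ A := by simpa using hyA 1 ⟨by norm_num, by norm_num⟩
    have := h.w_lip (hn x hx) (hn y hy)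
    rw [indicator_of_mem (c.sub hxA), indicator_of_mem (c.sub hyA')] at this
    rw [indicator_of_mem hxA, indicator_of_mem hyA']
    linarith

theorem le_of_not (c : Comp Ω u ε P R A) (h : Hyp lam K m Ω u a f) (hPR : ‖P‖ + R ≤ 1)
    {x y : Euc n} (hx : x ∈ ball P R) (hy : y ∈ ball P R) (hyA : y ∉ A) :
    A.indicator (fun z => u z - ε) x ≤ ‖x - y‖ := by
  have := c.lip h hPR hx hy
  rwa [indicator_of_notMem hyA, sub_zero] at this

theorem contOn (c : Comp Ω u ε P R A) (h : Hyp lam K m Ω u a f) (hPR : ‖P‖ + R ≤ 1) :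
    ContinuousOn (A.indicator (fun z => u z - ε)) (ball P R) := by
  have : LipschitzOnWith 1 (A.indicator (fun z => u z - ε)) (ball P R) := by
    refine LipschitzOnWith.of_dist_le_mul fun x hx y hy => ?_
    rw [Real.dist_eq, dist_eq_norm, NNReal.coe_one, one_mul, abs_le]
    have h1 := c.lip h hPR hx hy
    have h2 := c.lip h hPR hy hx
    rw [norm_sub_rev] at h2
    constructor <;> linarith
  exact this.continuousOn

/-- A frontier point near the segment joining two different components. -/
theorem near_fr (c : Comp Ω u ε P R A) (h : Hyp lam K m Ω u a f) {c0 δ0 : ℝ} (hc0 : 0 < c0)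
    (hA : ∀ x ∈ Ω, ‖x‖ < δ0 → c0 * infDist x (frontier Ω) ≤ u x) (hPR : ‖P‖ + R ≤ δ0) (hε : 0 ≤ ε)
    {x y : Euc n} (hx : x ∈ ball P R) (hy : y ∈ ball P R) (hxA : x ∈ A) (hyA : y ∉ A) :
    ∃ t ∈ Icc (0:ℝ) 1, ∃ z' ∈ frontier Ω, ‖z' - (x + t • (y - x))‖ ≤ ε / c0 := by
  obtain ⟨t, ht, hb, hcl, hle⟩ := c.exit hx hy hxA ⟨1, ⟨by norm_num, le_rfl⟩, by simpa using hyA⟩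
  refine ⟨t, ⟨ht.1.le, ht.2⟩, ?_⟩
  set z := x + t • (y - x)
  by_cases hz : z ∈ Ω
  · have h1 : ‖z - P‖ < R := by simpa [dist_eq_norm] using hb
    have h2 : ‖z‖ ≤ ‖z - P‖ + ‖P‖ := by simpa using norm_add_le (z - P) P
    have h3 := hA z hz (by linarith)
    obtain ⟨z', hz', he⟩ := h.nearest z
    refine ⟨z', hz', ?_⟩
    rw [indicator_of_mem hz] at hle
    rw [norm_sub_rev, ← he, le_div_iff₀ hc0]
    linarith
  · refine ⟨z, ?_, by simp; positivity⟩
    rw [h.opn.frontier_eq]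
    exact ⟨closure_mono c.sub hcl, hz⟩

end Comp

end

section

variable {n : ℕ}

local notation "⟪" x ", " y "⟫" => inner ℝ x y

theorem S_bounds {lam : ℝ} (hlam : 0 < lam) {S : Euc n ≃L[ℝ] Euc n}
    (hl : ∀ ζ, lam * ‖ζ‖ ^ 2 ≤ ‖S ζ‖ ^ 2) (hu : ∀ ζ, ‖S ζ‖ ^ 2 ≤ lam⁻¹ * ‖ζ‖ ^ 2) :
    (∀ ζ, √lam * ‖ζ‖ ≤ ‖S ζ‖) ∧ (∀ ζ, √lam * ‖S ζ‖ ≤ ‖ζ‖) := by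
  have h0 := Real.sqrt_pos.2 hlam
  have h2 := Real.sq_sqrt hlam.le
  constructor <;> intro ζ
  · refine abs_le_of_sq_le_sq' ?_ (norm_nonneg _) |>.2
    rw [mul_pow, h2]; exact hl ζ
  · refine abs_le_of_sq_le_sq' ?_ (norm_nonneg _) |>.2
    rw [mul_pow, h2]
    calc lam * ‖S ζ‖ ^ 2 ≤ lam * (lam⁻¹ * ‖ζ‖ ^ 2) := by gcongr; exact hu ζ
      _ = _ := by field_simp

theorem zero_ball {lam K m : ℝ} {Ω : Set (Euc n)} {u : Euc n → ℝ}
    {a : Euc n → Fin n → Fin n → ℝ} {f : Euc n → ℝ} {ε R : ℝ} {P : Euc n} {A : Set (Euc n)}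
    (h : Hyp lam K m Ω u a f) (c : Comp Ω u ε P R A)
    {c0 δ0 : ℝ} (hc0 : 0 < c0)
    (hA : ∀ x ∈ Ω, ‖x‖ < δ0 → c0 * infDist x (frontier Ω) ≤ u x) (hPR : ‖P‖ + R ≤ δ0)
    (hδ0 : δ0 ≤ 1 / 4) (hε : 0 ≤ ε)
    {S : Euc n ≃L[ℝ] Euc n} (hl : ∀ ζ, √lam * ‖ζ‖ ≤ ‖S ζ‖) (hu : ∀ ζ, √lam * ‖S ζ‖ ≤ ‖ζ‖)
    {p0 e : Euc n} {s ρ : ℝ} (hs : 0 < s) (he : ‖e‖ = 1) (hx : p0 + s • S e ∈ ball P R)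
    (hy : p0 + s • S (-e) ∈ ball P R) (hxA : p0 + s • S e ∈ A) (hyA : p0 + s • S (-e) ∉ A)
    (hεs : ε / c0 ≤ √lam * s / 4) (hρ : 0 < ρ) (hρ1 : ρ ≤ 1 / 8) (hρ2 : 12 * K * ρ ≤ lam) :
    ∃ q : Euc n, ‖q‖ ≤ 2 ∧ 2 * ρ ≤ |⟪q, e⟫| ∧ ∀ ζ ∈ ball q ρ, p0 + s • S ζ ∉ Ω := by
  have l0 : 0 < √lam := Real.sqrt_pos.2 h.hlam
  have l2 := Real.mul_self_sqrt h.hlam.le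
  obtain ⟨t, ht, z', hz', hzz⟩ := c.near_fr h hc0 hA hPR hε hx hy hxA hyA
  set ζ0 : Euc n := (1 - 2 * t) • e with hζ0
  have hz : p0 + s • S e + t • (p0 + s • S (-e) - (p0 + s • S e)) = p0 + s • S ζ0 := by
    rw [hζ0, map_smul, map_neg]; module
  rw [hz] at hzz
  have hζ0n : ‖ζ0‖ ≤ 1 := by
    rw [hζ0, norm_smul, he, mul_one, Real.norm_eq_abs, abs_le]
    constructor <;> linarith [ht.1, ht.2]
  have hx' : ‖p0 + s • S e - P‖ < R := by simpa [dist_eq_norm] using hx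
  have hy' : ‖p0 + s • S (-e) - P‖ < R := by simpa [dist_eq_norm] using hy
  have hR : 0 ≤ ‖P‖ := norm_nonneg _
  -- smallness of s
  have hsl : √lam * s ≤ 1 / 4 := by
    have e1 : (p0 + s • S e - P) - (p0 + s • S (-e) - P) = (2 * s) • S e := by
      rw [map_neg]; module
    have e2 := norm_sub_le (p0 + s • S e - P) (p0 + s • S (-e) - P)
    rw [e1, norm_smul, Real.norm_of_nonneg (by positivity)] at e2
    have e3 := hl e
    rw [he, mul_one] at e3
    have : 2 * s * √lam ≤ 2 * s * ‖S e‖ := by gcongr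
    linarith
  have hz1 : ‖p0 + s • S ζ0‖ < 1 / 4 := by
    have hm : p0 + s • S ζ0 ∈ ball P R := (convex_ball P R).segment_subset hx hy (by
      rw [segment_eq_image', ← hz]
      exact ⟨t, ht, rfl⟩)
    have h1 : ‖p0 + s • S ζ0 - P‖ < R := by simpa [dist_eq_norm] using hm
    have h2 : ‖p0 + s • S ζ0‖ ≤ ‖p0 + s • S ζ0 - P‖ + ‖P‖ := by
      simpa using norm_add_le (p0 + s • S ζ0 - P) P
    linarith
  have hz'1 : ‖z'‖ < 1 := by
    have : ‖z'‖ ≤ ‖z' - (p0 + s • S ζ0)‖ + ‖p0 + s • S ζ0‖ := by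
      simpa using norm_add_le (z' - (p0 + s • S ζ0)) (p0 + s • S ζ0)
    linarith
  set r0 := √lam * s / 4 with hr0
  have hr0p : 0 < r0 := by positivity
  obtain ⟨y0, hy0⟩ := (h.clean z' ⟨hz', by simpa using hz'1⟩).2 r0 hr0p (by linarith)
  have hK := h.hK
  have hy0c : ‖y0 - z'‖ < r0 := by
    have := (hy0 (mem_ball_self (by positivity))).1
    simpa [dist_eq_norm] using this
  set qh : Euc n := S.symm (s⁻¹ • (y0 - p0)) with hqh
  have hSq : p0 + s • S qh = y0 := by
    rw [hqh, S.apply_symm_apply, smul_smul, mul_inv_cancel₀ hs.ne', one_smul]; abel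
  have hqd : ‖qh - ζ0‖ ≤ 1 / 2 := by
    have e1 := hl (qh - ζ0)
    have e2 : s • S (qh - ζ0) = (y0 - z') + (z' - (p0 + s • S ζ0)) := by
      rw [← hSq, map_sub]; module
    have e3 := norm_add_le (y0 - z') (z' - (p0 + s • S ζ0))
    rw [← e2, norm_smul, Real.norm_of_nonneg hs.le] at e3
    have e4 : s * (√lam * ‖qh - ζ0‖) ≤ √lam * s / 2 := by
      calc _ ≤ s * ‖S (qh - ζ0)‖ := by gcongr
        _ ≤ _ := by linarith
    have e5 : (√lam * s) * ‖qh - ζ0‖ ≤ (√lam * s) * (1 / 2) := by linarith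
    exact le_of_mul_le_mul_left e5 (by positivity)
  have hqhn : ‖qh‖ ≤ 3 / 2 := by
    have : ‖qh‖ ≤ ‖qh - ζ0‖ + ‖ζ0‖ := by simpa using norm_add_le (qh - ζ0) ζ0
    linarith
  have hzero : ∀ ζ, ‖ζ - qh‖ < 3 * ρ → p0 + s • S ζ ∉ Ω := by
    intro ζ hζ
    refine (hy0 (?_ : p0 + s • S ζ ∈ ball y0 (r0 / K))).2
    have e2 : p0 + s • S ζ - y0 = s • S (ζ - qh) := by
      rw [← hSq, map_sub]; module
    rw [mem_ball, dist_eq_norm, e2, norm_smul, Real.norm_of_nonneg hs.le, lt_div_iff₀ hK, hr0]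
    have e1 := hu (ζ - qh)
    have e3 : √lam * (s * ‖S (ζ - qh)‖ * K) < √lam * (√lam * s / 4) := by
      calc √lam * (s * ‖S (ζ - qh)‖ * K) = (s * K) * (√lam * ‖S (ζ - qh)‖) := by ring
        _ ≤ (s * K) * ‖ζ - qh‖ := by gcongr
        _ < (s * K) * (3 * ρ) := by gcongr
        _ = s / 4 * (12 * K * ρ) := by ring
        _ ≤ s / 4 * lam := by gcongr
        _ = (√lam * √lam) * (s / 4) := by rw [l2]; ring
        _ = _ := by ring
    exact lt_of_mul_lt_mul_left e3 l0.le
  have hee : ⟪e, e⟫ = (1:ℝ) := by rw [real_inner_self_eq_norm_sq, he]; norm_num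
  obtain ⟨σ, hσ, hσe⟩ : ∃ σ : ℝ, |σ| = 1 ∧ 2 * ρ ≤ |⟪qh + (2 * ρ * σ) • e, e⟫| := by
    rcases le_total 0 (⟪qh, e⟫ : ℝ) with h0 | h0
    · refine ⟨1, by norm_num, le_trans ?_ (le_abs_self _)⟩
      rw [inner_add_left, real_inner_smul_left, hee]; linarith
    · refine ⟨-1, by norm_num, le_trans ?_ (neg_le_abs _)⟩
      rw [inner_add_left, real_inner_smul_left, hee]; linarith
  have hsh : ‖(2 * ρ * σ) • e‖ = 2 * ρ := by
    rw [norm_smul, he, mul_one, Real.norm_eq_abs, abs_mul, hσ, abs_of_pos (by positivity), mul_one]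
  refine ⟨qh + (2 * ρ * σ) • e, ?_, hσe, ?_⟩
  · have := norm_add_le qh ((2 * ρ * σ) • e)
    linarith
  · intro ζ hζ
    refine hzero ζ ?_
    have h1 : ‖ζ - (qh + (2 * ρ * σ) • e)‖ < ρ := by simpa [dist_eq_norm] using hζ
    have h2 := norm_add_le (ζ - (qh + (2 * ρ * σ) • e)) ((2 * ρ * σ) • e)
    have h3 : ζ - (qh + (2 * ρ * σ) • e) + ((2 * ρ * σ) • e) = ζ - qh := by abel
    rw [h3] at h2
    linarith

theorem two_step (n : ℕ) (lam K m : ℝ) (hlam : 0 < lam) (hK : 0 < K) (hm : 0 < m) (θ0 : ℝ) (hθ0 : 0 < θ0) :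
    ∃ N : ℝ, 16 ≤ N ∧ ∃ κ : ℝ, 0 < κ ∧ ∃ c : ℝ, 0 < c ∧ ∃ δ : ℝ, 0 < δ ∧ δ ≤ 1 / 4 ∧
    ∀ (Ω : Set (Euc n)) (u : Euc n → ℝ)
      (a : Euc n → Fin n → Fin n → ℝ) (f : Euc n → ℝ), Hyp lam K m Ω u a f →
    ∀ S : Euc n ≃L[ℝ] Euc n, (∀ ζ, lam * ‖ζ‖ ^ 2 ≤ ‖S ζ‖ ^ 2) → (∀ ζ, ‖S ζ‖ ^ 2 ≤ lam⁻¹ * ‖ζ‖ ^ 2) →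
      (∀ (b : OrthonormalBasis (Fin n) ℝ (Euc n)) (D : Euc n →L[ℝ] Euc n →L[ℝ] ℝ),
        ∑ i, ∑ j, a 0 i j * D (eb j) (eb i) = ∑ k, D (S (b k)) (S (b k))) →
    ∀ (P : Euc n) (R ε θ : ℝ) (A1 A2 : Set (Euc n)), 0 < ε → ‖P‖ + R ≤ δ → R ≤ √lam * δ →
      Comp Ω u ε P R A1 → Comp Ω u ε P R A2 → Disjoint A1 A2 →
    ∀ x ∈ A1, ∀ y ∈ A2, ∀ ρ' : ℝ, ‖x - P‖ ≤ ρ' → ‖y - P‖ ≤ ρ' → ρ' * (1 + N / lam) < R →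
      θ0 ≤ θ → ε ≤ c * ‖S.symm (x - y)‖ → θ * ‖S.symm (x - y)‖ ^ 2 ≤ (u x - ε) * (u y - ε) →
      ∃ x' ∈ A1, ∃ y' ∈ A2, ‖x' - P‖ ≤ ρ' * (1 + N / lam) ∧ ‖y' - P‖ ≤ ρ' * (1 + N / lam) ∧
        ‖S.symm (x - y)‖ / (2 * N) ≤ ‖S.symm (x' - y')‖ ∧
        (1 + κ) * θ * ‖S.symm (x' - y')‖ ^ 2 ≤ (u x' - ε) * (u y' - ε) := by
  have l0 : 0 < √lam := Real.sqrt_pos.2 hlam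
  have l2 := Real.mul_self_sqrt hlam.le
  obtain ⟨c0, hc0, -, δ0, hδ0, hδ04, hA⟩ := lemmaA n lam m hlam hm
  set ρ : ℝ := min (1 / 8) (lam / (12 * K)) with hρd
  have hρ : 0 < ρ := by positivity
  have hρ1 : ρ ≤ 1 / 8 := min_le_left _ _
  have hρ2 : 12 * K * ρ ≤ lam := by
    have : ρ ≤ lam / (12 * K) := min_le_right _ _
    rw [le_div_iff₀ (by positivity)] at this; linarith
  obtain ⟨N, hN, hI⟩ := improve n ρ hρ (by linarith)
  have hN0 : 0 < N := by linarith
  obtain ⟨κ, hκ, hI⟩ := hI θ0 ((N + 1) / √lam) hθ0 (by positivity)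
  obtain ⟨δ1, hδ1, hH⟩ := nearHarm_of n lam hlam κ hκ
  refine ⟨N, hN, κ, hκ, c0 * √lam / 8, by positivity, min δ0 δ1, by positivity,
    (min_le_left _ _).trans hδ04, ?_⟩
  intro Ω u a f h S hl2 hu2 hSD P R ε θ A1 A2 hε hPR hRδ c1 c2 hdis x hx y hy ρ' hxP hyP hρR hθ hεc hθx
  obtain ⟨hl, hu⟩ := S_bounds hlam hl2 hu2
  have hPR0 : ‖P‖ + R ≤ δ0 := hPR.trans (min_le_left _ _)
  have hPR1 : ‖P‖ + R ≤ δ1 := hPR.trans (min_le_right _ _)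
  have hPRo : ‖P‖ + R ≤ 1 := by linarith
  set D := ‖S.symm (x - y)‖ with hD
  have hD0 : 0 < D := by
    by_contra hh
    have h1 : c0 * √lam / 8 * D ≤ 0 := mul_nonpos_of_nonneg_of_nonpos (by positivity) (not_lt.1 hh)
    linarith
  set s := D / 2 with hs
  have hs0 : 0 < s := by positivity
  set p0 : Euc n := (2:ℝ)⁻¹ • (x + y) with hp0
  set e : Euc n := D⁻¹ • S.symm (x - y) with he
  have hen : ‖e‖ = 1 := by
    rw [he, norm_smul, Real.norm_of_nonneg (by positivity), ← hD, inv_mul_cancel₀ hD0.ne']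
  have hSe : s • S e = (2:ℝ)⁻¹ • (x - y) := by
    rw [he, map_smul, S.apply_symm_apply, smul_smul, hs]
    congr 1; field_simp
  have hxe : p0 + s • S e = x := by rw [hSe, hp0]; module
  have hye : p0 + s • S (-e) = y := by rw [map_neg, smul_neg, hSe, hp0]; module
  have hρ0 : 0 ≤ ρ' := (norm_nonneg _).trans hxP
  have hsρ : √lam * s ≤ ρ' := by
    have h1 := hl (S.symm (x - y))
    rw [S.apply_symm_apply, ← hD] at h1
    have h2 : ‖x - y‖ ≤ ‖x - P‖ + ‖y - P‖ := by
      have : x - y = (x - P) - (y - P) := by abel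
      rw [this]; exact norm_sub_le _ _
    rw [hs]; linarith
  have hp0P : ‖p0 - P‖ ≤ ρ' := by
    have : p0 - P = (2:ℝ)⁻¹ • (x - P) + (2:ℝ)⁻¹ • (y - P) := by rw [hp0]; module
    rw [this]
    refine (norm_add_le _ _).trans ?_
    rw [norm_smul, norm_smul, Real.norm_of_nonneg (by norm_num)]
    linarith
  have hsS : ∀ ζ : Euc n, s * ‖S ζ‖ ≤ ρ' * (‖ζ‖ / lam) := by
    intro ζ
    have h1 := hu ζ
    rw [← mul_div_assoc, le_div_iff₀ hlam, ← l2]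
    calc s * ‖S ζ‖ * (√lam * √lam) = (√lam * s) * (√lam * ‖S ζ‖) := by ring
      _ ≤ ρ' * ‖ζ‖ := by gcongr
  have hmapn : ∀ ζ ∈ ball (0 : Euc n) N, ‖p0 + s • S ζ - P‖ ≤ ρ' * (1 + N / lam) := by
    intro ζ hζ
    have hζ' : ‖ζ‖ < N := by simpa using hζ
    have e1 : p0 + s • S ζ - P = (p0 - P) + s • S ζ := by abel
    rw [e1]
    refine (norm_add_le _ _).trans ?_
    rw [norm_smul, Real.norm_of_nonneg hs0.le]
    have := hsS ζ
    have : ρ' * (‖ζ‖ / lam) ≤ ρ' * (N / lam) := by gcongr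
    linarith
  have hmap : ∀ ζ ∈ ball (0 : Euc n) N, p0 + s • S ζ ∈ ball P R := by
    intro ζ hζ
    rw [mem_ball, dist_eq_norm]
    exact (hmapn ζ hζ).trans_lt hρR
  have hmapδ : ∀ ζ ∈ ball (0 : Euc n) N, ‖p0 + s • S ζ‖ < min δ0 δ1 := by
    intro ζ hζ
    have h1 : ‖p0 + s • S ζ - P‖ < R := by simpa [dist_eq_norm] using hmap ζ hζ
    have h2 : ‖p0 + s • S ζ‖ ≤ ‖p0 + s • S ζ - P‖ + ‖P‖ := by simpa using norm_add_le (p0 + s • S ζ - P) P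
    linarith
  have heN : e ∈ ball (0 : Euc n) N := by rw [mem_ball_zero_iff, hen]; linarith
  have heN' : -e ∈ ball (0 : Euc n) N := by rw [mem_ball_zero_iff, norm_neg, hen]; linarith
  have hxB : x ∈ ball P R := by rw [← hxe]; exact hmap _ heN
  have hyB : y ∈ ball P R := by rw [← hye]; exact hmap _ heN'
  have hρ'R : ρ' ≤ R := by
    have : 0 ≤ ρ' * (N / lam) := by positivity
    linarith
  have hsδ : s ≤ δ1 := by
    have h1 : √lam * s ≤ √lam * min δ0 δ1 := by linarith
    exact (le_of_mul_le_mul_left h1 l0).trans (min_le_right _ _)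
  have hyA1 : y ∉ A1 := fun hh => (Set.disjoint_left.1 hdis hh) hy
  have hxA2 : x ∉ A2 := Set.disjoint_left.1 hdis hx
  -- generic facts
  have gen : ∀ A : Set (Euc n), Comp Ω u ε P R A → ∀ v : Euc n, v ∈ ball (0 : Euc n) N → ‖v‖ = 1 →
      p0 + s • S v ∉ A → 
      ContinuousOn (fun ζ => A.indicator (fun z => u z - ε) (p0 + s • S ζ) / s) (ball 0 N) ∧
      (∀ ζ ∈ ball (0 : Euc n) N, 0 ≤ A.indicator (fun z => u z - ε) (p0 + s • S ζ) / s) ∧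
      (∀ ζ ∈ ball (0 : Euc n) N, A.indicator (fun z => u z - ε) (p0 + s • S ζ) / s ≤ (N + 1) / √lam) ∧
      (∀ ζ ∈ ball (0 : Euc n) N, 0 < A.indicator (fun z => u z - ε) (p0 + s • S ζ) / s →
        NearHarm κ (fun ζ => A.indicator (fun z => u z - ε) (p0 + s • S ζ) / s) ζ) := by
    intro A c v hv hv1 hvA
    have hcS : Continuous (fun ζ : Euc n => p0 + s • S ζ) := by fun_prop
    refine ⟨?_, ?_, ?_, ?_⟩
    · refine ContinuousOn.div_const ?_ s
      exact (c.contOn h hPRo).comp hcS.continuousOn hmap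
    · intro ζ _
      exact div_nonneg (c.nonneg _) hs0.le
    · intro ζ hζ
      have h1 := c.le_of_not h hPRo (hmap ζ hζ) (hmap v hv) hvA
      have e1 : p0 + s • S ζ - (p0 + s • S v) = s • S (ζ - v) := by rw [map_sub]; module
      rw [e1, norm_smul, Real.norm_of_nonneg hs0.le] at h1
      rw [div_le_iff₀ hs0]
      have h2 := hu (ζ - v)
      have h3 : ‖ζ - v‖ ≤ N + 1 := by
        have := norm_sub_le ζ v
        have hζ' : ‖ζ‖ < N := by simpa using hζ
        linarith
      have h4 : ‖S (ζ - v)‖ ≤ (N + 1) / √lam := by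
        rw [le_div_iff₀ l0]; linarith
      calc _ ≤ s * ‖S (ζ - v)‖ := h1
        _ ≤ s * ((N + 1) / √lam) := by gcongr
        _ = _ := by ring
    · intro ζ hζ hpos
      have hpos' : 0 < A.indicator (fun z => u z - ε) (p0 + s • S ζ) := by
        have := mul_pos hpos hs0
        rwa [div_mul_cancel₀ _ hs0.ne'] at this
      have hmem := Comp.mem_of_pos hpos'
      have hzδ := hmapδ ζ hζ
      have hz1 := hzδ.trans_le (min_le_right _ _)
      have hz0 := hzδ.trans_le (min_le_left _ _)
      refine hH K m Ω u a f h S hl2 hSD p0 ζ s ε _ hs0 hsδ (c.sub hmem) (by linarith) hz1.le ?_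
      have : ∀ᶠ w in 𝓝 ζ, p0 + s • S w ∈ A := hcS.continuousAt (c.opn.mem_nhds hmem)
      filter_upwards [this] with w hw
      rw [indicator_of_mem hw]
  obtain ⟨g1, g2, g3, g4⟩ := gen A1 c1 (-e) heN' (by rw [norm_neg, hen]) (by rw [hye]; exact hyA1)
  obtain ⟨k1, k2, k3, k4⟩ := gen A2 c2 e heN hen (by rw [hxe]; exact hxA2)
  obtain ⟨q, hq1, hq2, hq3⟩ := zero_ball h c1 hc0 (hA K Ω u a f h) hPR0 hδ04 hε.le hl hu hs0 hen
    (by rw [hxe]; exact hxB) (by rw [hye]; exact hyB) (by rw [hxe]; exact hx) (by rw [hye]; exact hyA1)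
    (by rw [div_le_iff₀ hc0, hs]; linarith) hρ hρ1 hρ2
  have hz : ∀ A : Set (Euc n), Comp Ω u ε P R A → ∀ ζ ∈ ball q ρ,
      A.indicator (fun z => u z - ε) (p0 + s • S ζ) / s = 0 := by
    intro A c ζ hζ
    rw [indicator_of_notMem (fun hh => hq3 ζ hζ (c.sub hh)), zero_div]
  obtain ⟨ζ1, hζ1, ζ2, hζ2, hd, hfin⟩ := hI e q _ _ θ hen hθ g1 k1 g2 k2 g3 k3 hq1 hq2 (hz A1 c1) (hz A2 c2)
    g4 k4 (by
      rw [hxe, hye, indicator_of_mem hx, indicator_of_mem hy, div_mul_div_comm, le_div_iff₀ (by positivity), hs]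
      linarith)
  have e3 : S.symm (p0 + s • S ζ1 - (p0 + s • S ζ2)) = s • (ζ1 - ζ2) := by
    rw [S.symm_apply_eq, map_smul, map_sub]; module
  have hpos : 0 < A1.indicator (fun z => u z - ε) (p0 + s • S ζ1) / s *
      (A2.indicator (fun z => u z - ε) (p0 + s • S ζ2) / s) := by
    refine lt_of_le_of_lt ?_ hfin
    have : 0 < θ := hθ0.trans_le hθ
    positivity
  have hp1 : 0 < A1.indicator (fun z => u z - ε) (p0 + s • S ζ1) := by
    rcases (c1.nonneg (p0 + s • S ζ1)).eq_or_lt with h0 | h0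
    · rw [← h0] at hpos; simp at hpos
    · exact h0
  have hp2 : 0 < A2.indicator (fun z => u z - ε) (p0 + s • S ζ2) := by
    rcases (c2.nonneg (p0 + s • S ζ2)).eq_or_lt with h0 | h0
    · rw [← h0] at hpos; simp at hpos
    · exact h0
  have hm1 := Comp.mem_of_pos hp1
  have hm2 := Comp.mem_of_pos hp2
  refine ⟨_, hm1, _, hm2, hmapn _ hζ1, hmapn _ hζ2, ?_, ?_⟩
  · rw [e3, norm_smul, Real.norm_of_nonneg hs0.le]
    calc D / (2 * N) = s * (1 / N) := by rw [hs]; field_simp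
      _ ≤ _ := by gcongr
  · rw [e3, norm_smul, Real.norm_of_nonneg hs0.le]
    rw [indicator_of_mem hm1, indicator_of_mem hm2, div_mul_div_comm, lt_div_iff₀ (by positivity)] at hfin
    nlinarith [hfin]

end

section

variable {n : ℕ}

set_option maxHeartbeats 800000 in
theorem no_sep (n : ℕ) (lam K m : ℝ) (hlam : 0 < lam) (hK : 0 < K) (hm : 0 < m) (C : ℝ) (hC : 1 ≤ C) :
    ∃ M : ℝ, C + 1 ≤ M ∧ ∃ ε0 : ℝ, 0 < ε0 ∧ ε0 ≤ 1 ∧ ∃ δ1 : ℝ, 0 < δ1 ∧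
    ∀ (Ω : Set (Euc n)) (u : Euc n → ℝ)
      (a : Euc n → Fin n → Fin n → ℝ) (f : Euc n → ℝ), Hyp lam K m Ω u a f →
    ∀ (P : Euc n) (r : ℝ), 0 < r → ‖P‖ ≤ δ1 → r ≤ δ1 → ∀ y1 y2 : Euc n,
      ‖y1 - P‖ ≤ C * r → ‖y2 - P‖ ≤ C * r → 2 * r ≤ u y1 → 2 * r ≤ u y2 →
      ∀ A1 A2 : Set (Euc n), Comp Ω u (ε0 * r) P (M * r) A1 → Comp Ω u (ε0 * r) P (M * r) A2 →
      Disjoint A1 A2 → y1 ∈ A1 → y2 ∈ A2 → False := by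
  have l0 : 0 < √lam := Real.sqrt_pos.2 hlam
  have l2 := Real.mul_self_sqrt hlam.le
  have hC0 : 0 < C := by linarith
  set θ0 := lam / (4 * C ^ 2) with hθ0
  have hθ0p : 0 < θ0 := by positivity
  obtain ⟨N, hN, κ, hκ, c, hc, δ, hδ, hδ4, hstep⟩ := two_step n lam K m hlam hK hm θ0 hθ0p
  have hN0 : 0 < N := by linarith
  obtain ⟨J, hJ⟩ := pow_unbounded_of_one_lt (lam⁻¹ / θ0) (by linarith : 1 < 1 + κ)
  rw [div_lt_iff₀ hθ0p] at hJ
  set G := 1 + N / lam with hG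
  have hG1 : 1 ≤ G := by have : 0 < N / lam := by positivity
                         linarith
  have hG0 : 0 < G := by linarith
  set M := C * G ^ J + 1 with hM
  have hM0 : 0 < M := by positivity
  refine ⟨M, ?_, min 1 (c * √lam / (2 * N) ^ J), by positivity, min_le_left _ _,
    min (δ / (1 + M)) (√lam * δ / M), by positivity, ?_⟩
  · have : C * 1 ≤ C * G ^ J := by gcongr; exact one_le_pow₀ hG1
    linarith
  intro Ω u a f h P r hr hP hrδ y1 y2 hy1P hy2P hu1 hu2 A1 A2 c1 c2 hdis hy1 hy2
  set ε0 := min 1 (c * √lam / (2 * N) ^ J) with hε0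
  have hε0p : 0 < ε0 := by positivity
  have hε01 : ε0 ≤ 1 := min_le_left _ _
  obtain ⟨S, hl2, hu2', hSD⟩ := h.exists_S
  obtain ⟨hl, hu⟩ := S_bounds hlam hl2 hu2'
  have hPR : ‖P‖ + M * r ≤ δ := by
    have h1 := hP.trans (min_le_left _ _)
    have h2 := hrδ.trans (min_le_left _ _)
    have h3 : M * r ≤ M * (δ / (1 + M)) := by gcongr
    have h4 : δ / (1 + M) + M * (δ / (1 + M)) = δ := by field_simp
    linarith
  have hR : M * r ≤ √lam * δ := by
    have h2 := hrδ.trans (min_le_right _ _)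
    rw [le_div_iff₀ hM0] at h2; linarith
  have hinv : ∀ x y : Euc n, √lam * ‖x - y‖ ≤ ‖S.symm (x - y)‖ ∧ √lam * ‖S.symm (x - y)‖ ≤ ‖x - y‖ := by
    intro x y
    have h1 := hl (S.symm (x - y))
    have h2 := hu (S.symm (x - y))
    rw [S.apply_symm_apply] at h1 h2
    exact ⟨h2, h1⟩
  have hball : ∀ x : Euc n, ∀ k ≤ J, ‖x - P‖ ≤ C * r * G ^ k → x ∈ ball P (M * r) := by
    intro x k hk hx
    rw [mem_ball, dist_eq_norm]
    have : G ^ k ≤ G ^ J := pow_le_pow_right₀ hG1 hk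
    have : C * r * G ^ k ≤ C * r * G ^ J := by gcongr
    have e1 : (C * G ^ J + 1) * r = C * r * G ^ J + r := by ring
    rw [hM, e1]; linarith
  have hprod : ∀ x ∈ A1, ∀ y ∈ A2, x ∈ ball P (M * r) → y ∈ ball P (M * r) →
      u x - ε0 * r ≤ ‖x - y‖ ∧ u y - ε0 * r ≤ ‖x - y‖ := by
    intro x hx y hy hxB hyB
    have h1 := c1.le_of_not h (by linarith) hxB hyB (fun hh => (Set.disjoint_left.1 hdis hh) hy)
    have h2 := c2.le_of_not h (by linarith) hyB hxB (Set.disjoint_left.1 hdis hx)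
    rw [indicator_of_mem hx] at h1
    rw [indicator_of_mem hy, norm_sub_rev] at h2
    exact ⟨h1, h2⟩
  have key : ∀ k ≤ J, ∃ x ∈ A1, ∃ y ∈ A2, ‖x - P‖ ≤ C * r * G ^ k ∧ ‖y - P‖ ≤ C * r * G ^ k ∧
      √lam * r / (2 * N) ^ k ≤ ‖S.symm (x - y)‖ ∧
      (1 + κ) ^ k * θ0 * ‖S.symm (x - y)‖ ^ 2 ≤ (u x - ε0 * r) * (u y - ε0 * r) := by
    intro k
    induction k with
    | zero =>
      intro _
      have hεr : ε0 * r ≤ r := by nlinarith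
      have hp := hprod y1 hy1 y2 hy2 (hball y1 0 (Nat.zero_le _) (by simpa using hy1P))
        (hball y2 0 (Nat.zero_le _) (by simpa using hy2P))
      obtain ⟨i1, i2⟩ := hinv y1 y2
      refine ⟨y1, hy1, y2, hy2, by simpa using hy1P, by simpa using hy2P, ?_, ?_⟩
      · rw [pow_zero, div_one]
        refine le_trans ?_ i1
        gcongr; linarith
      · rw [pow_zero, one_mul]
        have h2 : ‖y1 - y2‖ ≤ 2 * C * r := by
          have : y1 - y2 = (y1 - P) - (y2 - P) := by abel
          rw [this]; have := norm_sub_le (y1 - P) (y2 - P); linarith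
        have h3 : (√lam * ‖S.symm (y1 - y2)‖) ^ 2 ≤ (2 * C * r) ^ 2 := by
          exact pow_le_pow_left₀ (by positivity) (i2.trans h2) 2
        have h4 : lam * ‖S.symm (y1 - y2)‖ ^ 2 ≤ 4 * C ^ 2 * r ^ 2 := by
          calc _ = (√lam * ‖S.symm (y1 - y2)‖) ^ 2 := by rw [mul_pow, Real.sq_sqrt hlam.le]
            _ ≤ _ := h3
            _ = _ := by ring
        have h5 : θ0 * ‖S.symm (y1 - y2)‖ ^ 2 ≤ r ^ 2 := by
          rw [hθ0, div_mul_eq_mul_div, div_le_iff₀ (by positivity)]; linarith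
        refine h5.trans ?_
        rw [pow_two]
        apply mul_le_mul <;> linarith
    | succ k ih =>
      intro hk
      obtain ⟨x, hx, y, hy, hxP, hyP, hD, hth⟩ := ih (by omega)
      have hG' : C * r * G ^ k * (1 + N / lam) = C * r * G ^ (k + 1) := by rw [pow_succ]; ring
      obtain ⟨x', hx', y', hy', q1, q2, q3, q4⟩ := hstep Ω u a f h S hl2 hu2' hSD P (M * r) (ε0 * r)
        ((1 + κ) ^ k * θ0) A1 A2 (by positivity) hPR hR c1 c2 hdis x hx y hy (C * r * G ^ k) hxP hyP
        (by
          rw [hG']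
          have : G ^ (k + 1) ≤ G ^ J := pow_le_pow_right₀ hG1 hk
          have : C * r * G ^ (k + 1) ≤ C * r * G ^ J := by gcongr
          have e1 : (C * G ^ J + 1) * r = C * r * G ^ J + r := by ring
          rw [hM, e1]; linarith)
        (by
          exact le_mul_of_one_le_left hθ0p.le (one_le_pow₀ (by linarith)))
        (by
          have h1 : ε0 ≤ c * √lam / (2 * N) ^ J := min_le_right _ _
          have h2 : (2 * N) ^ k ≤ (2 * N) ^ J := pow_le_pow_right₀ (by linarith) (by omega)
          calc ε0 * r ≤ c * √lam / (2 * N) ^ J * r := by gcongr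
            _ ≤ c * √lam / (2 * N) ^ k * r := by gcongr
            _ = c * (√lam * r / (2 * N) ^ k) := by ring
            _ ≤ _ := by gcongr)
        hth
      refine ⟨x', hx', y', hy', by rw [← hG']; exact q1, by rw [← hG']; exact q2, ?_, ?_⟩
      · refine le_trans ?_ q3
        rw [le_div_iff₀ (by positivity)]
        refine le_trans (le_of_eq ?_) hD
        rw [pow_succ]; field_simp
      · refine le_trans (le_of_eq ?_) q4
        rw [pow_succ]; ring
  obtain ⟨x, hx, y, hy, hxP, hyP, hD, hth⟩ := key J le_rfl
  have hp := hprod x hx y hy (hball x J le_rfl hxP) (hball y J le_rfl hyP)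
  have hDp : 0 < ‖S.symm (x - y)‖ := lt_of_lt_of_le (by positivity) hD
  have h1 : (u x - ε0 * r) * (u y - ε0 * r) ≤ ‖x - y‖ * ‖x - y‖ := by
    apply mul_le_mul hp.1 hp.2 _ (norm_nonneg _)
    linarith [c2.gt y hy]
  obtain ⟨i1, i2⟩ := hinv x y
  have h2 : lam * (‖x - y‖ * ‖x - y‖) ≤ ‖S.symm (x - y)‖ ^ 2 := by
    calc _ = (√lam * ‖x - y‖) ^ 2 := by rw [mul_pow, Real.sq_sqrt hlam.le]; ring
      _ ≤ _ := by gcongr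
  have h3 : lam⁻¹ * ‖S.symm (x - y)‖ ^ 2 < (1 + κ) ^ J * θ0 * ‖S.symm (x - y)‖ ^ 2 := by gcongr
  have h4 : ‖x - y‖ * ‖x - y‖ ≤ lam⁻¹ * ‖S.symm (x - y)‖ ^ 2 := by
    rw [inv_mul_eq_div, le_div_iff₀ hlam]; linarith
  linarith

end

section

variable {n : ℕ}

/-- A path parametrized with speed at most one. -/
def Pth (x y : Euc n) (T : ℝ) (Q : ℝ → Euc n → Prop) : Prop :=
  0 ≤ T ∧ ∃ γ : ℝ → Euc n, LipschitzWith 1 γ ∧ γ 0 = x ∧ γ T = y ∧ ∀ t ∈ Icc 0 T, Q t (γ t)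

namespace Pth

theorem lipd {γ : ℝ → Euc n} (h : LipschitzWith 1 γ) (s t : ℝ) : ‖γ s - γ t‖ ≤ |s - t| := by
  have := h.dist_le_mul s t
  rwa [dist_eq_norm, Real.dist_eq, NNReal.coe_one, one_mul] at this

theorem dist_le {x y : Euc n} {T : ℝ} {Q : ℝ → Euc n → Prop} (h : Pth x y T Q) : ‖y - x‖ ≤ T := by
  obtain ⟨h0, γ, h1, rfl, rfl, -⟩ := h
  have := lipd h1 T 0
  rwa [sub_zero, abs_of_nonneg h0] at this

theorem nil (x : Euc n) {Q : ℝ → Euc n → Prop} (hQ : Q 0 x) : Pth x x 0 Q := by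
  refine ⟨le_rfl, fun _ => x, (LipschitzWith.const x).weaken (by norm_num), rfl, rfl, ?_⟩
  intro t ht
  have : t = 0 := le_antisymm ht.2 ht.1
  rw [this]; exact hQ

theorem seg (x y : Euc n) : Pth x y ‖y - x‖ (fun t p => ‖p - x‖ ≤ t ∧ ‖p - y‖ ≤ ‖y - x‖ - t) := by
  refine ⟨norm_nonneg _, fun t => x + (t / ‖y - x‖) • (y - x), ?_, by simp, ?_, ?_⟩
  · refine LipschitzWith.of_dist_le_mul fun s t => ?_
    rw [dist_eq_norm, Real.dist_eq, NNReal.coe_one, one_mul]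
    have : x + (s / ‖y - x‖) • (y - x) - (x + (t / ‖y - x‖) • (y - x)) = ((s - t) / ‖y - x‖) • (y - x) := by
      rw [sub_div]; module
    rw [this, norm_smul, norm_div, norm_norm, Real.norm_eq_abs]
    rcases eq_or_ne ‖y - x‖ 0 with h0 | h0
    · rw [h0, mul_zero]; exact abs_nonneg _
    · rw [div_mul_cancel₀ _ h0]
  · rcases eq_or_ne ‖y - x‖ 0 with h0 | h0
    · have : y = x := by rwa [norm_eq_zero, sub_eq_zero] at h0
      simp [this]
    · simp only; rw [div_self h0]; module
  · intro t ht
    rcases eq_or_ne ‖y - x‖ 0 with h0 | h0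
    · have hyx : y = x := by rwa [norm_eq_zero, sub_eq_zero] at h0
      rw [h0] at ht
      have : t = 0 := le_antisymm ht.2 ht.1
      simp [this, hyx]
    · have e1 : x + (t / ‖y - x‖) • (y - x) - x = (t / ‖y - x‖) • (y - x) := by abel
      have e2 : x + (t / ‖y - x‖) • (y - x) - y = -((1 - t / ‖y - x‖) • (y - x)) := by module
      have hp : 0 < ‖y - x‖ := lt_of_le_of_ne (norm_nonneg _) (Ne.symm h0)
      constructor
      · simp only
        rw [e1, norm_smul, Real.norm_of_nonneg (div_nonneg ht.1 hp.le), div_mul_cancel₀ _ h0]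
      · simp only
        have : t / ‖y - x‖ ≤ 1 := (div_le_one hp).2 ht.2
        rw [e2, norm_neg, norm_smul, Real.norm_of_nonneg (by linarith), sub_mul, div_mul_cancel₀ _ h0, one_mul]

theorem trans {x y z : Euc n} {T T' : ℝ} {Q Q1 Q2 : ℝ → Euc n → Prop} (h1 : Pth x y T Q1) (h2 : Pth y z T' Q2)
    (hQ1 : ∀ t ∈ Icc 0 T, ∀ p, Q1 t p → Q t p) (hQ2 : ∀ t ∈ Icc 0 T', ∀ p, Q2 t p → Q (T + t) p) :
    Pth x z (T + T') Q := by
  obtain ⟨hT, γ, l1, rfl, hy, q1⟩ := h1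
  obtain ⟨hT', η, l2, hη, rfl, q2⟩ := h2
  refine ⟨by positivity, fun t => if t ≤ T then γ t else η (t - T), ?_, ?_, ?_, ?_⟩
  · have key : ∀ s t, s ≤ t → ‖(if s ≤ T then γ s else η (s - T)) - (if t ≤ T then γ t else η (t - T))‖ ≤ t - s := by
      intro s t hst
      by_cases ht : t ≤ T
      · rw [if_pos ht, if_pos (hst.trans ht)]
        refine (lipd l1 s t).trans ?_
        rw [abs_sub_comm, abs_of_nonneg (by linarith)]
      · rw [if_neg ht]
        by_cases hs : s ≤ T
        · rw [if_pos hs]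
          have e1 := lipd l1 s T
          have e2 := lipd l2 0 (t - T)
          rw [hy] at e1
          rw [hη] at e2
          have e3 : γ s - η (t - T) = (γ s - y) + (y - η (t - T)) := by abel
          rw [e3]
          refine (norm_add_le _ _).trans ?_
          rw [abs_sub_comm, abs_of_nonneg (by linarith)] at e1
          rw [abs_sub_comm, abs_of_nonneg (by linarith)] at e2
          linarith
        · rw [if_neg hs]
          refine (lipd l2 _ _).trans ?_
          rw [abs_sub_comm, abs_of_nonneg (by linarith)]
          linarith
    refine LipschitzWith.of_dist_le_mul fun s t => ?_
    rw [dist_eq_norm, Real.dist_eq, NNReal.coe_one, one_mul]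
    rcases le_total s t with h | h
    · rw [abs_sub_comm, abs_of_nonneg (by linarith)]; exact key s t h
    · rw [abs_of_nonneg (by linarith), norm_sub_rev]; exact key t s h
  · simp only; rw [if_pos hT]
  · simp only
    split_ifs with hh
    · have : T' = 0 := by linarith
      rw [this, add_zero, hy, hη]
    · rw [add_sub_cancel_left]
  · intro t ht
    simp only
    split_ifs with hh
    · exact hQ1 t ⟨ht.1, hh⟩ _ (q1 t ⟨ht.1, hh⟩)
    · have h3 : t - T ∈ Icc 0 T' := ⟨by linarith, by linarith [ht.2]⟩
      have := hQ2 _ h3 _ (q2 _ h3)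
      rwa [add_sub_cancel] at this

theorem symm {x y : Euc n} {T : ℝ} {Q : ℝ → Euc n → Prop} (h : Pth x y T Q) :
    Pth y x T (fun t p => Q (T - t) p) := by
  obtain ⟨hT, γ, l1, hx, hy, q1⟩ := h
  refine ⟨hT, fun t => γ (T - t), ?_, by simpa using hy, by simpa using hx, ?_⟩
  · refine LipschitzWith.of_dist_le_mul fun s t => ?_
    rw [dist_eq_norm, Real.dist_eq, NNReal.coe_one, one_mul]
    refine (lipd l1 _ _).trans (le_of_eq ?_)
    rw [abs_sub_comm]; congr 1; ring
  · intro t ht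
    exact q1 _ ⟨by linarith [ht.2], by linarith [ht.1]⟩

theorem mono {x y : Euc n} {T : ℝ} {Q Q' : ℝ → Euc n → Prop} (h : Pth x y T Q)
    (hQ : ∀ t ∈ Icc 0 T, ∀ p, Q t p → Q' t p) : Pth x y T Q' := by
  obtain ⟨hT, γ, l1, hx, hy, q1⟩ := h
  exact ⟨hT, γ, l1, hx, hy, fun t ht => hQ t ht _ (q1 t ht)⟩

theorem evar {γ : ℝ → Euc n} (h : LipschitzWith 1 γ) {T a b : ℝ} (hT : 0 ≤ T) (hab : a ≤ b) :
    eVariationOn (fun t => γ (T * t)) (Icc a b) ≤ ENNReal.ofReal (T * (b - a)) := by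
  have h1 : eVariationOn (γ ∘ (fun t => T * t)) (Icc a b) ≤ (1 : ℝ≥0) * eVariationOn (fun t : ℝ => T * t) (Icc a b) :=
    (h.lipschitzOnWith (s := univ)).comp_eVariationOn_le (fun _ _ => mem_univ _)
  have hm : MonotoneOn (fun t : ℝ => T * t) (Icc a b) := fun s _ t _ hst => by
    simp only; gcongr
  have h2 := hm.eVariationOn_le (left_mem_Icc.2 hab) (right_mem_Icc.2 hab)
  rw [inter_self] at h2
  refine h1.trans ?_
  rw [ENNReal.coe_one, one_mul]
  refine h2.trans (le_of_eq ?_)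
  congr 1; ring

theorem harnack {x y : Euc n} {T K : ℝ} {Ω : Set (Euc n)} (hK : 0 < K) (hT : T ≤ K * ‖x - y‖)
    (h : Pth x y T (fun t p => p ∈ Ω ∧ min t (T - t) ≤ K * infDist p (frontier Ω))) :
    HarnackChainAt K Ω x y := by
  obtain ⟨hT0, γ, l1, hx, hy, q1⟩ := h
  have hin : ∀ t ∈ Icc (0:ℝ) 1, T * t ∈ Icc 0 T := fun t ht =>
    ⟨mul_nonneg hT0 ht.1, by nlinarith [ht.2]⟩
  refine ⟨fun t => γ (T * t), ?_, by simpa using hx, by simpa using hy, fun t ht => (q1 _ (hin t ht)).1, ?_, ?_⟩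
  · exact (l1.continuous.comp (by fun_prop)).continuousOn
  · refine (evar l1 hT0 zero_le_one).trans ?_
    apply ENNReal.ofReal_le_ofReal
    rw [dist_eq_norm]; linarith
  · intro t ht
    have := (q1 _ (hin t ht)).2
    rw [div_le_iff₀ hK, mul_comm]
    refine le_trans ?_ this
    apply min_le_min
    · have := ENNReal.toReal_mono ENNReal.ofReal_ne_top (evar l1 hT0 ht.1)
      rw [ENNReal.toReal_ofReal (by have := ht.1; simp; positivity)] at this
      simpa using this
    · have := ENNReal.toReal_mono ENNReal.ofReal_ne_top (evar l1 hT0 ht.2)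
      rw [ENNReal.toReal_ofReal (mul_nonneg hT0 (by linarith [ht.2]))] at this
      linarith

end Pth

end

section

variable {n : ℕ}

theorem d_lip (F : Set (Euc n)) (x y : Euc n) : infDist x F ≤ infDist y F + ‖x - y‖ := by
  have := infDist_le_infDist_add_dist (s := F) (x := x) (y := y)
  rwa [dist_eq_norm] at this

theorem climb (n : ℕ) (lam m : ℝ) (hlam : 0 < lam) (hm : 0 < m) :
    ∃ C : ℝ, 1 ≤ C ∧ ∃ δ : ℝ, 0 < δ ∧ ∀ (K : ℝ) (Ω : Set (Euc n)) (u : Euc n → ℝ)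
      (a : Euc n → Fin n → Fin n → ℝ) (f : Euc n → ℝ), Hyp lam K m Ω u a f →
      ∀ x ∈ Ω, ∀ r : ℝ, 0 < r → ‖x‖ ≤ δ → r ≤ δ →
        ∃ y ∈ Ω, ∃ T : ℝ, 2 * r ≤ u y ∧ T ≤ C * r ∧
          Pth x y T (fun t p => p ∈ Ω ∧ t ≤ C * infDist p (frontier Ω)) := by
  obtain ⟨c0, hc0, hc1, δ0, hδ0, hδ04, hB⟩ := lemmaB n lam m hlam hm
  set C1 := 1 / c0 ^ 2 with hC1
  have hC1p : 0 < C1 := by positivity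
  have hC1c : C1 * c0 * c0 = 1 := by rw [hC1]; field_simp
  have hC11 : 1 ≤ C1 := by rw [hC1, le_div_iff₀ (by positivity)]; nlinarith
  set C2 := 2 * (C1 + 1) / c0 with hC2
  have hC2p : 0 < C2 := by positivity
  have hC2c : C2 * (c0 / 2) = C1 + 1 := by rw [hC2]; field_simp
  have hC22 : C1 ≤ C2 := by nlinarith
  set C3 := C1 * (2 + 2 / c0) with hC3
  have hC3p : 0 < C3 := by positivity
  refine ⟨C2 + C3, by linarith, δ0 / (4 * (1 + 2 * C1)), by positivity, ?_⟩
  intro K Ω u a f h x hx r hr hxδ hrδ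
  have hδs : ‖x‖ + C1 * (2 * r) < δ0 := by
    have e : δ0 / (4 * (1 + 2 * C1)) * (1 + 2 * C1) = δ0 / 4 := by field_simp
    have e2 : r * (2 * C1) ≤ δ0 / (4 * (1 + 2 * C1)) * (2 * C1) := by gcongr
    linarith
  have hux : 0 < u x := h.pos x ⟨hx, by
    have : 0 < C1 * (2 * r) := by positivity
    rw [mem_ball_zero_iff]; linarith⟩
  set Q : ℝ → Euc n → Prop := fun t p => p ∈ Ω ∧ t ≤ (C2 + C3) * infDist p (frontier Ω) with hQ
  have key : ∀ k : ℕ, (∃ y ∈ Ω, ∃ T : ℝ, 2 * r ≤ u y ∧ T ≤ (C2 + C3) * r ∧ Pth x y T Q) ∨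
      (∃ y ∈ Ω, ∃ T : ℝ, u y < 2 * r ∧ (1 + c0) ^ k * u x ≤ u y ∧ T ≤ C1 * u y ∧ Pth x y T Q) := by
    intro k
    induction k with
    | zero =>
      have hp : Pth x x 0 Q := Pth.nil x ⟨hx, mul_nonneg (by positivity) infDist_nonneg⟩
      by_cases h2 : 2 * r ≤ u x
      · exact Or.inl ⟨x, hx, 0, h2, by positivity, hp⟩
      · exact Or.inr ⟨x, hx, 0, not_le.1 h2, by simp, by positivity, hp⟩
    | succ k ih =>
      rcases ih with ih | ⟨y, hy, T, h2, hk, hT, hp⟩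
      · exact Or.inl ih
      · have hT0 := hp.1
        have hyx := hp.dist_le
        have huy : 0 < u y := lt_of_lt_of_le (by positivity) hk
        have hyn : ‖y‖ < δ0 := by
          have e1 : ‖y‖ ≤ ‖y - x‖ + ‖x‖ := by simpa using norm_add_le (y - x) x
          have e2 : C1 * u y ≤ C1 * (2 * r) := by gcongr
          linarith
        obtain ⟨b1, z, hz, hzy, huz⟩ := hB K Ω u a f h y hy hyn
        set d := infDist y (frontier Ω) with hd
        have hd0 : 0 < d := h.d_pos hy
        have hdy : d ≤ ‖y‖ := h.d_le y
        have hzn : ‖z‖ < 1 / 2 := by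
          have e1 : ‖z‖ ≤ ‖z - y‖ + ‖y‖ := by simpa using norm_add_le (z - y) y
          linarith
        have hud : u y ≤ d := h.u_le_d hy (by linarith)
        have hudz := h.u_le_d hz hzn
        have huyz : u y ≤ u z := by nlinarith
        have hp' : Pth x z (T + ‖z - y‖) Q := by
          refine hp.trans (Pth.seg y z) (fun _ _ _ q => q) ?_
          rintro t ht p ⟨q1, q2⟩
          have hpd : ‖p - y‖ < d := by linarith [ht.2]
          refine ⟨h.ball_sub hy hpd, ?_⟩
          have e1 := d_lip (frontier Ω) y p
          have e2 := d_lip (frontier Ω) z p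
          rw [norm_sub_rev] at e1 e2
          have e3 : c0 / 2 * d ≤ infDist p (frontier Ω) := by linarith
          have e4 : T + t ≤ (C1 + 1) * d := by
            have : C1 * u y ≤ C1 * d := by gcongr
            linarith [ht.2]
          calc T + t ≤ (C1 + 1) * d := e4
            _ = C2 * (c0 / 2 * d) := by rw [← hC2c]; ring
            _ ≤ C2 * infDist p (frontier Ω) := by gcongr
            _ ≤ (C2 + C3) * infDist p (frontier Ω) := by
              have := infDist_nonneg (s := frontier Ω) (x := p)
              gcongr; linarith
        have hdu : d ≤ C1 * c0 * u y := by
          calc d = C1 * c0 * (c0 * d) := by rw [← mul_assoc, hC1c, one_mul]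
            _ ≤ C1 * c0 * u y := by gcongr
        have hT' : T + ‖z - y‖ ≤ C1 * u z := by
          calc _ ≤ C1 * u y + C1 * c0 * u y := by linarith
            _ = C1 * ((1 + c0) * u y) := by ring
            _ ≤ _ := by gcongr
        by_cases h3 : 2 * r ≤ u z
        · refine Or.inl ⟨z, hz, _, h3, ?_, hp'⟩
          have e1 := h.w_lip (x := z) (y := y) (by linarith) (by linarith)
          rw [indicator_of_mem hz, indicator_of_mem hy] at e1
          have e2 : d ≤ 2 * r / c0 := by rw [le_div_iff₀ hc0]; linarith
          calc _ ≤ C1 * u z := hT'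
            _ ≤ C1 * (2 * r + 2 * r / c0) := by gcongr; linarith
            _ = C3 * r := by rw [hC3]; ring
            _ ≤ _ := by gcongr; linarith
        · refine Or.inr ⟨z, hz, _, not_le.1 h3, ?_, hT', hp'⟩
          calc _ = (1 + c0) * ((1 + c0) ^ k * u x) := by rw [pow_succ]; ring
            _ ≤ (1 + c0) * u y := by gcongr
            _ ≤ _ := huz
  obtain ⟨k, hk⟩ := pow_unbounded_of_one_lt (2 * r / u x) (by linarith : 1 < 1 + c0)
  rw [div_lt_iff₀ hux] at hk
  rcases key k with h1 | ⟨y, hy, T, h2, h3, -⟩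
  · exact h1
  · linarith

end

section

variable {n : ℕ}

/-- The superlevel set used for chains. -/
def Vset (Ω : Set (Euc n)) (u : Euc n → ℝ) (ε : ℝ) (P : Euc n) (R : ℝ) : Set (Euc n) :=
  {z | z ∈ Ω ∧ z ∈ ball P R ∧ ε < u z}

/-- One short jump. -/
def Jmp (V : Set (Euc n)) (η : ℝ) (x y : Euc n) : Prop := x ∈ V ∧ y ∈ V ∧ ‖x - y‖ < η

theorem Jmp.symm' {V : Set (Euc n)} {η : ℝ} {x y : Euc n} (h : Jmp V η x y) : Jmp V η y x :=
  ⟨h.2.1, h.1, by rw [norm_sub_rev]; exact h.2.2⟩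

theorem chain_symm {V : Set (Euc n)} {η : ℝ} {x y : Euc n} (h : Relation.ReflTransGen (Jmp V η) x y) :
    Relation.ReflTransGen (Jmp V η) y x := by
  induction h with
  | refl => exact Relation.ReflTransGen.refl
  | tail _ h2 ih => exact Relation.ReflTransGen.head h2.symm' ih

variable {lam K m : ℝ} {Ω : Set (Euc n)} {u : Euc n → ℝ}
    {a : Euc n → Fin n → Fin n → ℝ} {f : Euc n → ℝ} {ε R : ℝ} {P : Euc n}

theorem Vset_open (h : Hyp lam K m Ω u a f) (hPR : ‖P‖ + R ≤ 1) : IsOpen (Vset Ω u ε P R) := by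
  have hb : ball P R ⊆ ball 0 1 := by
    apply ball_subset_ball'
    rw [dist_zero_right]; linarith
  have hc : ContinuousOn u (Ω ∩ ball P R) :=
    h.cont.mono fun z hz => ⟨subset_closure hz.1, hb hz.2⟩
  have := hc.isOpen_inter_preimage (h.opn.inter isOpen_ball) (isOpen_Ioi (a := ε))
  convert this using 1
  ext z
  simp only [Vset, mem_setOf_eq, mem_inter_iff, mem_preimage, mem_Ioi]
  tauto

theorem comp_chain (h : Hyp lam K m Ω u a f) (hPR : ‖P‖ + R ≤ 1) {η : ℝ} (hη : 0 < η) {y : Euc n}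
    (hε : 0 ≤ ε) (hy : y ∈ Vset Ω u ε P R) :
    Comp Ω u ε P R {z | Relation.ReflTransGen (Jmp (Vset Ω u ε P R) η) y z} := by
  have hsub : ∀ z, Relation.ReflTransGen (Jmp (Vset Ω u ε P R) η) y z → z ∈ Vset Ω u ε P R := by
    intro z hz
    induction hz with
    | refl => exact hy
    | tail _ h2 _ => exact h2.2.1
  refine ⟨?_, fun z hz => (hsub z hz).1, fun z hz => (hsub z hz).2.2, ?_⟩
  · rw [isOpen_iff_mem_nhds]
    intro z hz
    filter_upwards [(Vset_open h hPR).mem_nhds (hsub z hz), ball_mem_nhds z hη] with w hw hwb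
    refine Relation.ReflTransGen.tail hz ⟨hsub z hz, hw, ?_⟩
    rw [norm_sub_rev]; simpa [dist_eq_norm] using hwb
  · intro z hzB hzc hzn
    by_contra hlt
    have hlt := not_le.1 hlt
    have hzΩ : z ∈ Ω := h.mem_of_w_pos (hε.trans_lt hlt)
    rw [indicator_of_mem hzΩ] at hlt
    have hzV : z ∈ Vset Ω u ε P R := ⟨hzΩ, hzB, hlt⟩
    obtain ⟨w, hw, hwz⟩ := Metric.mem_closure_iff.1 hzc η hη
    refine hzn (Relation.ReflTransGen.tail hw ⟨hsub w hw, hzV, ?_⟩)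
    rw [norm_sub_rev, ← dist_eq_norm]; exact hwz

/-- Cells. -/
def Cell (t : Set (Euc n)) (P : Euc n) (r η : ℝ) (i : t) : Set (Euc n) :=
  {z | ‖r⁻¹ • (z - P) - (i : Euc n)‖ < η}

theorem cell_dist {t : Set (Euc n)} {r η : ℝ} (hr : 0 < r) {i : t} {z w : Euc n}
    (hz : z ∈ Cell t P r η i) (hw : w ∈ Cell t P r η i) : ‖w - z‖ ≤ 2 * (η * r) := by
  have e : w - z = r • ((r⁻¹ • (w - P) - (i : Euc n)) - (r⁻¹ • (z - P) - (i : Euc n))) := by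
    have e0 : (r⁻¹ • (w - P) - (i : Euc n)) - (r⁻¹ • (z - P) - (i : Euc n)) = r⁻¹ • (w - z) := by module
    rw [e0, smul_smul, mul_inv_cancel₀ hr.ne', one_smul]
  have h1 : ‖r⁻¹ • (z - P) - (i : Euc n)‖ < η := hz
  have h2 : ‖r⁻¹ • (w - P) - (i : Euc n)‖ < η := hw
  rw [e, norm_smul, Real.norm_of_nonneg hr.le]
  have := norm_sub_le (r⁻¹ • (w - P) - (i : Euc n)) (r⁻¹ • (z - P) - (i : Euc n))
  calc _ ≤ r * (2 * η) := by gcongr; linarith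
    _ = _ := by ring

/-- Adjacency graph of cells. -/
def cellGraph (V t : Set (Euc n)) (P : Euc n) (r η ν : ℝ) : SimpleGraph t where
  Adj i j := i ≠ j ∧ ∃ z ∈ Cell t P r η i, ∃ w ∈ Cell t P r η j, Jmp V ν z w
  symm := ⟨by
    rintro i j ⟨hij, z, hz, w, hw, hJ⟩
    exact ⟨hij.symm, w, hw, z, hz, hJ.symm'⟩⟩
  loopless := ⟨fun i hi => hi.1 rfl⟩

theorem short_seg (h : Hyp lam K m Ω u a f) (hPR : ‖P‖ + R ≤ 1 / 4) {z w : Euc n}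
    (hz : z ∈ Vset Ω u ε P R) (hzw : ‖w - z‖ ≤ ε / 2) :
    Pth z w ‖w - z‖ (fun _ p => p ∈ Ω ∧ ε / 2 ≤ infDist p (frontier Ω)) := by
  refine (Pth.seg z w).mono ?_
  rintro t ht p ⟨q1, -⟩
  have h1 : ‖z - P‖ < R := by simpa [dist_eq_norm] using hz.2.1
  have h2 : ‖z‖ ≤ ‖z - P‖ + ‖P‖ := by simpa using norm_add_le (z - P) P
  have h3 := h.u_le_d hz.1 (by linarith)
  have h4 := hz.2.2
  have hn := norm_nonneg (w - z)
  refine ⟨h.ball_sub hz.1 (by linarith [ht.2]), ?_⟩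
  have := d_lip (frontier Ω) z p
  rw [norm_sub_rev] at this
  linarith [ht.2]

theorem walk_path (h : Hyp lam K m Ω u a f) (hPR : ‖P‖ + R ≤ 1 / 4) {t : Set (Euc n)} {r η : ℝ} (hr : 0 < r)
    (hη : η * r = ε / 16) {i j : t} (w : (cellGraph (Vset Ω u ε P R) t P r η (ε / 4)).Walk i j) :
    ∀ z ∈ Vset Ω u ε P R, z ∈ Cell t P r η i → ∀ z' ∈ Vset Ω u ε P R, z' ∈ Cell t P r η j → 
      ∃ T : ℝ, T ≤ (w.length + 1) * ε ∧ 
        Pth z z' T (fun _ p => p ∈ Ω ∧ ε / 2 ≤ infDist p (frontier Ω)) := by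
  induction w with
  | nil =>
    intro z hz hzi z' hz' hzi'
    have h1 := cell_dist hr hzi hzi'
    rw [hη] at h1
    have := norm_nonneg (z' - z)
    refine ⟨_, ?_, short_seg h hPR hz (by linarith)⟩
    simp only [SimpleGraph.Walk.length_nil, Nat.cast_zero]; linarith
  | cons hadj w ih =>
    intro z hz hzi z' hz' hzi'
    have hadj' := hadj
    obtain ⟨-, p, hp, q, hq, hJ⟩ := hadj'
    have h1 := cell_dist hr hzi hp
    rw [hη] at h1
    have h2 : ‖q - z‖ ≤ ε / 2 := by
      have e : q - z = (q - p) + (p - z) := by abel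
      rw [e]
      have e1 := hJ.2.2
      rw [norm_sub_rev] at e1
      have := norm_add_le (q - p) (p - z)
      have := norm_nonneg (q - p)
      linarith
    obtain ⟨T, hT, hpth⟩ := ih q hJ.2.1 hq z' hz' hzi'
    refine ⟨_, ?_, (short_seg h hPR hz h2).trans hpth (fun _ _ _ q => q) (fun _ _ _ q => q)⟩
    have := norm_nonneg (q - z)
    rw [SimpleGraph.Walk.length_cons]; push_cast; linarith

theorem middle (n : ℕ) (lam K m : ℝ) (hlam : 0 < lam) (hK : 0 < K) (hm : 0 < m) (C : ℝ) (hC : 1 ≤ C) :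
    ∃ C' : ℝ, 0 < C' ∧ ∃ ε1 : ℝ, 0 < ε1 ∧ ∃ δ : ℝ, 0 < δ ∧
    ∀ (Ω : Set (Euc n)) (u : Euc n → ℝ)
      (a : Euc n → Fin n → Fin n → ℝ) (f : Euc n → ℝ), Hyp lam K m Ω u a f →
    ∀ (P : Euc n) (r : ℝ), 0 < r → ‖P‖ ≤ δ → r ≤ δ → ∀ y1 ∈ Ω, ∀ y2 ∈ Ω,
      ‖y1 - P‖ ≤ C * r → ‖y2 - P‖ ≤ C * r → 2 * r ≤ u y1 → 2 * r ≤ u y2 →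
      ∃ T : ℝ, T ≤ C' * r ∧ Pth y1 y2 T (fun _ p => p ∈ Ω ∧ ε1 * r ≤ infDist p (frontier Ω)) := by
  obtain ⟨M, hM, ε0, hε0, hε01, δ1, hδ1, hsep⟩ := no_sep n lam K m hlam hK hm C hC
  have hM0 : 0 < M := by linarith
  obtain ⟨t, -, htf, htc⟩ := (isCompact_closedBall (0 : Euc n) M).finite_cover_balls
    (show 0 < ε0 / 16 by positivity)
  haveI : Fintype t := htf.fintype
  refine ⟨(Fintype.card t + 1) * ε0, by positivity, ε0 / 2, by positivity,
    min δ1 (1 / (4 * (1 + M))), by positivity, ?_⟩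
  intro Ω u a f h P r hr hP hrδ y1 hy1 y2 hy2 hy1P hy2P hu1 hu2
  have hPR : ‖P‖ + M * r ≤ 1 / 4 := by
    have h1 := hP.trans (min_le_right _ _)
    have h2 := hrδ.trans (min_le_right _ _)
    have h3 : M * r ≤ M * (1 / (4 * (1 + M))) := by gcongr
    have h4 : 1 / (4 * (1 + M)) + M * (1 / (4 * (1 + M))) = 1 / 4 := by field_simp
    linarith
  set ε := ε0 * r with hε
  have hεp : 0 < ε := by positivity
  have hεr : ε ≤ r := by nlinarith
  set V := Vset Ω u ε P (M * r) with hV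
  have hinV : ∀ y ∈ Ω, ‖y - P‖ ≤ C * r → 2 * r ≤ u y → y ∈ V := by
    intro y hy h1 h2
    refine ⟨hy, ?_, by linarith⟩
    rw [mem_ball, dist_eq_norm]
    nlinarith
  have hy1V := hinV y1 hy1 hy1P hu1
  have hy2V := hinV y2 hy2 hy2P hu2
  have hchain : Relation.ReflTransGen (Jmp V (ε / 4)) y1 y2 := by
    by_contra hno
    refine hsep Ω u a f h P r hr (hP.trans (min_le_left _ _)) (hrδ.trans (min_le_left _ _)) y1 y2 hy1P hy2P
      hu1 hu2 _ _ (comp_chain h (by linarith) (show 0 < ε / 4 by positivity) hεp.le hy1V)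
      (comp_chain h (by linarith) (show 0 < ε / 4 by positivity) hεp.le hy2V) ?_
      Relation.ReflTransGen.refl Relation.ReflTransGen.refl
    rw [Set.disjoint_left]
    intro z hz1 hz2
    exact hno (Relation.ReflTransGen.trans hz1 (chain_symm hz2))
  have hcell : ∀ z ∈ V, ∃ i : t, z ∈ Cell t P r (ε0 / 16) i := by
    intro z hz
    have h1 : ‖z - P‖ < M * r := by simpa [dist_eq_norm] using hz.2.1
    have h2 : r⁻¹ • (z - P) ∈ closedBall (0 : Euc n) M := by
      rw [mem_closedBall_zero_iff, norm_smul, Real.norm_of_nonneg (by positivity), inv_mul_eq_div,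
        div_le_iff₀ hr]
      exact h1.le
    obtain ⟨i, hi, hb⟩ := mem_iUnion₂.1 (htc h2)
    exact ⟨⟨i, hi⟩, by simpa [dist_eq_norm, Cell] using hb⟩
  have hreach : ∀ z, Relation.ReflTransGen (Jmp V (ε / 4)) y1 z → ∀ i j : t, y1 ∈ Cell t P r (ε0 / 16) i →
      z ∈ Cell t P r (ε0 / 16) j → (cellGraph V t P r (ε0 / 16) (ε / 4)).Reachable i j := by
    intro z hz
    induction hz with
    | refl =>
      intro i j hi hj
      by_cases hij : i = j
      · rw [hij]
      · exact SimpleGraph.Adj.reachable ⟨hij, y1, hi, y1, hj, hy1V, hy1V, by simpa using hεp⟩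
    | tail h1 h2 ih =>
      intro i j hi hj
      obtain ⟨k, hk⟩ := hcell _ h2.1
      refine (ih i k hi hk).trans ?_
      by_cases hij : k = j
      · rw [hij]
      · exact SimpleGraph.Adj.reachable ⟨hij, _, hk, _, hj, h2⟩
  obtain ⟨i, hi⟩ := hcell y1 hy1V
  obtain ⟨j, hj⟩ := hcell y2 hy2V
  obtain ⟨w, hw⟩ := (hreach y2 hchain i j hi hj).exists_isPath
  have hlen := hw.length_lt
  obtain ⟨T, hT, hp⟩ := walk_path h hPR hr (by rw [hε]; ring) w y1 hy1V hi y2 hy2V hj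
  refine ⟨T, hT.trans ?_, hp.mono fun _ _ p q => ⟨q.1, by linarith [q.2]⟩⟩
  have : (w.length : ℝ) ≤ Fintype.card t := by exact_mod_cast hlen.le
  calc ((w.length : ℝ) + 1) * ε ≤ (Fintype.card t + 1) * ε := by gcongr
    _ = _ := by rw [hε]; ring

end

/-- **Domains supporting a linearly growing, nondegenerate solution of an elliptic
equation satisfy the Harnack chain condition.** -/
theorem harnack_chain_from_elliptic_solution (n : ℕ) (hn : 2 ≤ n)
    (lam K m : ℝ) (hlam : 0 < lam) (hK : 0 < K) (hm : 0 < m) :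
    ∃ δ : ℝ, 0 < δ ∧ ∃ C : ℝ, 0 < C ∧
      ∀ (Ω : Set (Euc n)) (u : Euc n → ℝ)
        (a : Euc n → Fin n → Fin n → ℝ) (f : Euc n → ℝ),
        IsOpen Ω →
        ContinuousOn u (closure Ω ∩ ball 0 1) →
        ContDiffOn ℝ 2 u (Ω ∩ ball 0 1) →
        (∀ x ∈ frontier Ω ∩ ball 0 1, u x = 0) →
        (∀ x ∈ Ω ∩ ball 0 1, 0 < u x) →
        -- (1) the origin lies on the boundary
        (0 : Euc n) ∈ frontier Ω →
        -- (2) gradient bound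
        (∀ x ∈ Ω ∩ ball 0 1, ‖gradient u x‖ ≤ 1) →
        -- (3) nondegeneracy: sup_{B_r(x)} u ≥ m r
        (∀ x ∈ closure Ω ∩ ball 0 1, ∀ r : ℝ, 0 < r → r < 1 →
          ∀ ε : ℝ, 0 < ε → ∃ y ∈ ball x r ∩ Ω ∩ ball 0 1, m * r - ε < u y) →
        -- (4) uniformly elliptic equation with Lipschitz coefficients and C^{0,1} rhs
        (∀ x ∈ Ω ∩ ball 0 1, ∑ i : Fin n, ∑ j : Fin n, a x i j * secondDeriv u i j x = f x) →
        (∀ x : Euc n, ∀ i j : Fin n, a x i j = a x j i) →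
        (∀ x : Euc n, ∀ ξ : Fin n → ℝ,
          lam * ∑ i : Fin n, ξ i ^ 2 ≤ ∑ i : Fin n, ∑ j : Fin n, a x i j * ξ i * ξ j ∧
          ∑ i : Fin n, ∑ j : Fin n, a x i j * ξ i * ξ j ≤ lam⁻¹ * ∑ i : Fin n, ξ i ^ 2) →
        (∀ i j : Fin n, LipschitzWith 1 (fun x => a x i j)) →
        (∃ Cf Lf : ℝ≥0, (∀ x ∈ Ω ∩ ball 0 1, |f x| ≤ Cf) ∧
          LipschitzOnWith Lf f (Ω ∩ ball 0 1) ∧ (Cf : ℝ) + (Lf : ℝ) ≤ 1) →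
        -- (5) clean ball conditions on ∂Ω ∩ B₁
        (∀ x ∈ frontier Ω ∩ ball 0 1, InnerCleanBallAt K Ω x ∧ OuterCleanBallAt K Ω x) →
        ∀ x₁ ∈ ball (0 : Euc n) δ ∩ Ω, ∀ x₂ ∈ ball (0 : Euc n) δ ∩ Ω,
          HarnackChainAt C Ω x₁ x₂ := by
  obtain ⟨Cc, hCc, δc, hδc, hclimb⟩ := climb n lam m hlam hm
  obtain ⟨C', hC', ε1, hε1, δm, hδm, hmid⟩ := middle n lam K m hlam hK hm (Cc + 1) (by linarith)
  set B := 2 * Cc + C' with hB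
  have hBp : 0 < B := by positivity
  set Kf := Cc + B + B / ε1 with hKf
  have hBε : 0 < B / ε1 := by positivity
  have hKp : 0 < Kf := by positivity
  refine ⟨min δc δm / 2, by positivity, Kf, hKp, ?_⟩
  intro Ω u a f h1 h2 h3 h4 h5 h6 h7 h8 h9 h10 h11 h12 h13 h14 x₁ hx₁ x₂ hx₂
  have h : Hyp lam K m Ω u a f := ⟨hlam, hK, hm, h1, h2, h3, h4, h5, h6, h7, h8, h9, h10, h11, h12, h13, h14⟩
  have hδ1 : min δc δm ≤ δc := min_le_left _ _
  have hδ2 : min δc δm ≤ δm := min_le_right _ _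
  have hn1 : ‖x₁‖ < min δc δm / 2 := by simpa using hx₁.1
  have hn2 : ‖x₂‖ < min δc δm / 2 := by simpa using hx₂.1
  rcases eq_or_ne x₁ x₂ with rfl | hne
  · refine Pth.harnack hKp (T := 0) (by simp) (Pth.nil x₁ ⟨hx₁.2, ?_⟩)
    have := infDist_nonneg (s := frontier Ω) (x := x₁)
    simp; positivity
  set r := ‖x₁ - x₂‖ with hr
  have hr0 : 0 < r := norm_pos_iff.2 (sub_ne_zero.2 hne)
  have hrn : r ≤ ‖x₁‖ + ‖x₂‖ := norm_sub_le _ _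
  have hp1 := norm_nonneg x₁
  have hp2 := norm_nonneg x₂
  obtain ⟨y₁, hy₁, T₁, hu₁, hT₁, P₁⟩ := hclimb K Ω u a f h x₁ hx₁.2 r hr0 (by linarith) (by linarith)
  obtain ⟨y₂, hy₂, T₂, hu₂, hT₂, P₂⟩ := hclimb K Ω u a f h x₂ hx₂.2 r hr0 (by linarith) (by linarith)
  have hd1 := P₁.dist_le
  have hd2 := P₂.dist_le
  have hd3 : ‖y₂ - x₁‖ ≤ ‖y₂ - x₂‖ + r := by
    have e : y₂ - x₁ = (y₂ - x₂) - (x₁ - x₂) := by abel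
    rw [e]; exact norm_sub_le _ _
  obtain ⟨Tm, hTm, Pm⟩ := hmid Ω u a f h x₁ r hr0 (by linarith) (by linarith) y₁ hy₁ y₂ hy₂
    (by linarith) (by linarith) hu₁ hu₂
  have hT : T₁ + (Tm + T₂) ≤ B * r := by rw [hB]; linarith
  have t1 := P₁.1
  have t2 := P₂.1
  have tm := Pm.1
  refine Pth.harnack hKp (T := T₁ + (Tm + T₂)) (hT.trans ?_) ?_
  · rw [← hr]; gcongr; linarith
  · have hCd : ∀ p, Cc * infDist p (frontier Ω) ≤ Kf * infDist p (frontier Ω) := by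
      intro p
      have := infDist_nonneg (s := frontier Ω) (x := p)
      gcongr; linarith
    refine P₁.trans (Pm.trans P₂.symm
      (Q := fun t p => p ∈ Ω ∧ min (T₁ + t) (T₁ + (Tm + T₂) - (T₁ + t)) ≤ Kf * infDist p (frontier Ω)) ?_ ?_) ?_ ?_
    · rintro t ht p ⟨q1, q2⟩
      refine ⟨q1, (min_le_left _ _).trans ?_⟩
      calc T₁ + t ≤ B * r := by linarith [ht.2]
        _ = B / ε1 * (ε1 * r) := by field_simp
        _ ≤ B / ε1 * infDist p (frontier Ω) := by gcongr
        _ ≤ _ := by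
          have := infDist_nonneg (s := frontier Ω) (x := p)
          gcongr; linarith
    · rintro t ht p ⟨q1, q2⟩
      refine ⟨q1, (min_le_right _ _).trans (le_trans ?_ (q2.trans (hCd p)))⟩
      linarith
    · rintro t ht p ⟨q1, q2⟩
      exact ⟨q1, (min_le_left _ _).trans (q2.trans (hCd p))⟩
    · rintro t ht p q
      exact q
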